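/- (Stable tensor product rule for GL_n, i.e. GL_n ⊂ GL_n × GL_n.) Let p,q,r,s be non-negative integers with n ≥ p+q+r+s, and let λ⁺,μ⁺,ν⁺,λ⁻,μ⁻,ν⁻ be non-negative integer partitions with ℓ(λ⁺) ≤ p+r, ℓ(λ⁻) ≤ q+s, ℓ(μ⁺) ≤ p, ℓ(μ⁻) ≤ q, ℓ(ν⁺) ≤ r, ℓ(ν⁻) ≤ s. Then [F^{(μ⁺,μ⁻)}_(n) ⊗ F^{(ν⁺,ν⁻)}_(n), F^{(λ⁺,λ⁻)}_(n)] = Σ c^{λ⁺}_{α₂ α₁} c^{μ⁺}_{α₁ γ₁} c^{ν⁻}_{γ₁ β₂} c^{λ⁻}_{β₂ β₁} c^{μ⁻}_{β₁ γ₂} c^{ν⁺}_{γ₂ α₂}, the sum over all sextuples of non-negative integer partitions (α₁,α₂,β₁,β₂,γ₁,γ₂). -/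

import Mathlib

open scoped BigOperators TensorProduct
open Matrix

noncomputable section

def IsPartition (f : ℕ → ℕ) : Prop :=
  (∀ ⦃i j : ℕ⦄, i ≤ j → f j ≤ f i) ∧ ∃ N, f N = 0

def Ptn : Type := {f : ℕ → ℕ // IsPartition f}

def plen (f : ℕ → ℕ) : ℕ := sInf {k | f k = 0}

def conj (f : ℕ → ℕ) : ℕ → ℕ := fun i => Set.ncard {j | i < f j}

def double (f : ℕ → ℕ) : ℕ → ℕ := fun i => 2 * f i

def InSkew (l m : ℕ → ℕ) (i j : ℕ) : Prop := m i ≤ j ∧ j < l i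

def IsLRTableau (l m nu : ℕ → ℕ) (T : ℕ → ℕ → ℕ) : Prop :=
  (∀ i, m i ≤ l i) ∧
  (∀ i j, T i j ≠ 0 ↔ InSkew l m i j) ∧
  (∀ i j k, InSkew l m i j → InSkew l m i k → j ≤ k → T i j ≤ T i k) ∧
  (∀ i k j, InSkew l m i j → InSkew l m k j → i < k → T i j < T k j) ∧
  (∀ r, Set.ncard {p : ℕ × ℕ | T p.1 p.2 = r + 1} = nu r) ∧
  (∀ i j r, Set.ncard {p : ℕ × ℕ | (p.1 < i ∨ (p.1 = i ∧ j ≤ p.2)) ∧ T p.1 p.2 = r + 2}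
          ≤ Set.ncard {p : ℕ × ℕ | (p.1 < i ∨ (p.1 = i ∧ j ≤ p.2)) ∧ T p.1 p.2 = r + 1})

def lrCoeff (l m nu : ℕ → ℕ) : ℕ := Set.ncard {T : ℕ → ℕ → ℕ | IsLRTableau l m nu T}

section Reps

variable {G : Type*} [Group G] {V W : Type*}
  [AddCommGroup V] [Module ℂ V] [AddCommGroup W] [Module ℂ W]

def IsSubrep (ρ : Representation ℂ G V) (U : Submodule ℂ V) : Prop :=
  ∀ g : G, ∀ x ∈ U, ρ g x ∈ U

def IsIrreducibleRep (ρ : Representation ℂ G V) : Prop :=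
  Nontrivial V ∧ ∀ U : Submodule ℂ V, IsSubrep ρ U → U = ⊥ ∨ U = ⊤

def equivariantMaps (π : Representation ℂ G W) (ρ : Representation ℂ G V) :
    Submodule ℂ (W →ₗ[ℂ] V) where
  carrier := {f | ∀ g : G, f ∘ₗ (π g) = (ρ g) ∘ₗ f}
  add_mem' := by
    intro f h hf hh g
    simp only [Set.mem_setOf_eq] at *
    rw [LinearMap.add_comp, LinearMap.comp_add, hf g, hh g]
  zero_mem' := by
    intro g
    simp only [Set.mem_setOf_eq, LinearMap.zero_comp, LinearMap.comp_zero]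
  smul_mem' := by
    intro c f hf g
    simp only [Set.mem_setOf_eq] at *
    rw [LinearMap.smul_comp, LinearMap.comp_smul, hf g]

def repMult (ρ : Representation ℂ G V) (π : Representation ℂ G W) : ℕ :=
  Module.finrank ℂ (equivariantMaps π ρ)

end Reps

def IsUpperUni {N : ℕ} (A : Matrix (Fin N) (Fin N) ℂ) : Prop :=
  (∀ i, A i i = 1) ∧ ∀ i j : Fin N, (j : ℕ) < (i : ℕ) → A i j = 0

def IsGLHW (n : ℕ) (a : Fin n → ℤ) {V : Type*} [AddCommGroup V] [Module ℂ V]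
    (ρ : Representation ℂ (GL (Fin n) ℂ) V) : Prop :=
  IsIrreducibleRep ρ ∧ FiniteDimensional ℂ V ∧
  ∃ v : V, v ≠ 0 ∧
    (∀ g : GL (Fin n) ℂ, IsUpperUni (g : Matrix (Fin n) (Fin n) ℂ) → ρ g v = v) ∧
    (∀ (g : GL (Fin n) ℂ) (d : Fin n → ℂ),
      (g : Matrix (Fin n) (Fin n) ℂ) = Matrix.diagonal d →
      ρ g v = (∏ i, d i ^ (a i)) • v)

def polyWeight (n : ℕ) (lam : ℕ → ℕ) : Fin n → ℤ := fun i => (lam (i : ℕ) : ℤ)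

def ratWeight (n : ℕ) (lp lm : ℕ → ℕ) : Fin n → ℤ :=
  fun i => (lp (i : ℕ) : ℤ) - (lm (n - 1 - (i : ℕ)) : ℤ)

def formGroup {ι : Type*} [Fintype ι] [DecidableEq ι] (S : Matrix ι ι ℂ) :
    Subgroup (GL ι ℂ) where
  carrier := {g | (g : Matrix ι ι ℂ)ᵀ * S * (g : Matrix ι ι ℂ) = S}
  one_mem' := by
    simp [Matrix.transpose_one]
  mul_mem' := by
    intro a b ha hb
    set A : Matrix ι ι ℂ := (a : Matrix ι ι ℂ) with hA
    set B : Matrix ι ι ℂ := (b : Matrix ι ι ℂ) with hB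
    have ha' : Aᵀ * S * A = S := ha
    have hb' : Bᵀ * S * B = S := hb
    show ((↑(a * b) : Matrix ι ι ℂ))ᵀ * S * (↑(a * b) : Matrix ι ι ℂ) = S
    have hab : (↑(a * b) : Matrix ι ι ℂ) = A * B := Units.val_mul a b
    rw [hab, Matrix.transpose_mul]
    calc Bᵀ * Aᵀ * S * (A * B) = Bᵀ * (Aᵀ * S * A) * B := by noncomm_ring
    _ = S := by rw [ha', hb']
  inv_mem' := by
    intro a ha
    set A : Matrix ι ι ℂ := (a : Matrix ι ι ℂ) with hA
    have ha' : Aᵀ * S * A = S := ha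
    set C : Matrix ι ι ℂ := ((a⁻¹ : GL ι ℂ) : Matrix ι ι ℂ) with hC
    show Cᵀ * S * C = S
    have hac : A * C = 1 := by
      rw [hA, hC, ← Units.val_mul, mul_inv_cancel, Units.val_one]
    calc Cᵀ * S * C = Cᵀ * (Aᵀ * S * A) * C := by rw [ha']
    _ = (A * C)ᵀ * S * (A * C) := by rw [Matrix.transpose_mul]; noncomm_ring
    _ = S := by rw [hac]; simp [Matrix.transpose_one]

def symForm (n : ℕ) : Matrix (Fin n) (Fin n) ℂ :=
  Matrix.of fun i j => if (i : ℕ) + (j : ℕ) = n - 1 then 1 else 0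

def sympForm (n : ℕ) : Matrix (Fin (2 * n)) (Fin (2 * n)) ℂ :=
  Matrix.of fun i j =>
    if (i : ℕ) + (j : ℕ) = 2 * n - 1 then (if (i : ℕ) < n then 1 else -1) else 0

def OGL (n : ℕ) : Subgroup (GL (Fin n) ℂ) := formGroup (symForm n)

def SpGL (n : ℕ) : Subgroup (GL (Fin (2 * n)) ℂ) := formGroup (sympForm n)

/-- The matrix of a distinguished reflection (an element of `O_n(ℂ)` of determinant `-1`
fixing the highest weight vectors of the representations `E^mu_(n)` for
`ℓ(mu) < n/2`): for odd `n`, the reflection negating the middle basis vector; for even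
`n`, the permutation swapping the two middle basis vectors. -/
def reflMatrix (n : ℕ) : Matrix (Fin n) (Fin n) ℂ :=
  Matrix.of fun i j =>
    if 2 * (i : ℕ) + 1 = n ∧ i = j then -1
    else if (2 * (i : ℕ) = n ∧ 2 * (j : ℕ) + 2 = n) ∨ (2 * (i : ℕ) + 2 = n ∧ 2 * (j : ℕ) = n)
      then 1
    else if i = j ∧ ¬(2 * (i : ℕ) = n ∨ 2 * (i : ℕ) + 2 = n) then 1
    else 0

/-- The partition associated to `mu` (with `(mu')_1 + (mu')_2 ≤ n`): the first column
length `(mu')_1` is replaced by `n - (mu')_1`.  One has `E^{assoc n mu} = E^mu ⊗ det`. -/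
def assocPtn (n : ℕ) (mu : ℕ → ℕ) : ℕ → ℕ :=
  conj (fun j => if j = 0 then n - conj mu 0 else conj mu j)

/-- `v` is a highest weight vector of weight `mu` for (the identity component of)
`O_n(ℂ)`: it is fixed by all upper triangular unipotent elements, and the diagonal
torus elements of determinant one act via the character attached to `mu`. -/
def IsOHWvec (n : ℕ) (mu : ℕ → ℕ) {V : Type*} [AddCommGroup V] [Module ℂ V]
    (ρ : Representation ℂ (OGL n) V) (v : V) : Prop :=
  (∀ g : OGL n, IsUpperUni ((g : GL (Fin n) ℂ) : Matrix (Fin n) (Fin n) ℂ) → ρ g v = v) ∧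
  (∀ (g : OGL n) (d : Fin n → ℂ),
    ((g : GL (Fin n) ℂ) : Matrix (Fin n) (Fin n) ℂ) = Matrix.diagonal d →
    (∏ i, d i) = 1 →
    ρ g v = (∏ i, d i ^ (mu (i : ℕ))) • v)

/-- `ρ` is the irreducible rational representation `E^mu_(n)` of the complex orthogonal
group `O_n(ℂ)`, indexed by a partition `mu` with `(mu')_1 + (mu')_2 ≤ n`. -/
def IsOIrrep (n : ℕ) (mu : ℕ → ℕ) {V : Type*} [AddCommGroup V] [Module ℂ V]
    (ρ : Representation ℂ (OGL n) V) : Prop :=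
  IsIrreducibleRep ρ ∧ FiniteDimensional ℂ V ∧
  (if 2 * conj mu 0 ≤ n then
    ∃ v : V, v ≠ 0 ∧ IsOHWvec n mu ρ v ∧
      (2 * conj mu 0 = n ∨
        ∀ g : OGL n, ((g : GL (Fin n) ℂ) : Matrix (Fin n) (Fin n) ℂ) = reflMatrix n →
          ρ g v = v)
  else
    ∃ v : V, v ≠ 0 ∧ IsOHWvec n (assocPtn n mu) ρ v ∧
      (∀ g : OGL n, ((g : GL (Fin n) ℂ) : Matrix (Fin n) (Fin n) ℂ) = reflMatrix n →
        ρ g v = - v))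

/-- `ρ` is the irreducible rational representation `V^mu_(2n)` of `Sp_{2n}(ℂ)` with
highest weight `mu` (a partition with at most `n` parts). -/
def IsSpHW (n : ℕ) (mu : ℕ → ℕ) {V : Type*} [AddCommGroup V] [Module ℂ V]
    (ρ : Representation ℂ (SpGL n) V) : Prop :=
  IsIrreducibleRep ρ ∧ FiniteDimensional ℂ V ∧
  ∃ v : V, v ≠ 0 ∧
    (∀ g : SpGL n,
      IsUpperUni ((g : GL (Fin (2 * n)) ℂ) : Matrix (Fin (2 * n)) (Fin (2 * n)) ℂ) →
      ρ g v = v) ∧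
    (∀ (g : SpGL n) (d : Fin (2 * n) → ℂ),
      ((g : GL (Fin (2 * n)) ℂ) : Matrix (Fin (2 * n)) (Fin (2 * n)) ℂ) = Matrix.diagonal d →
      ρ g v = (∏ i, d i ^ (mu (i : ℕ))) • v)


namespace StableGL

/-- A chain of horizontal strips from `κ` to `ν` with `n` steps. -/
def IsChain (n : ℕ) (κ ν : ℕ → ℕ) (t : ℕ → ℕ → ℕ) : Prop :=
  t 0 = κ ∧ (∀ i, n ≤ i → t i = ν) ∧ ∀ i k, t (i + 1) (k + 1) ≤ t i k ∧ t i k ≤ t (i + 1) k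

/-- The size of the `i`-th strip of a chain. -/
def wt (L : ℕ) (t : ℕ → ℕ → ℕ) (i : ℕ) : ℤ :=
  ∑ k ∈ Finset.range L, ((t (i + 1) k : ℤ) - t i k)

def lo (t : ℕ → ℕ → ℕ) (i k : ℕ) : ℕ := max (t (i + 2) (k + 1)) (t i k)

def hi (t : ℕ → ℕ → ℕ) (i : ℕ) : ℕ → ℕ
  | 0 => t (i + 2) 0
  | k + 1 => min (t (i + 2) (k + 1)) (t i k)

/-- Modify level `i + 1` of a chain: rows before `k` are kept, row `k` is set to `x`, and later
rows are reflected in the interval of admissible values. -/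
def tog (t : ℕ → ℕ → ℕ) (i k x : ℕ) : ℕ → ℕ → ℕ := fun j r =>
  if j = i + 1 then
    if r < k then t j r else if r = k then x else lo t i r + hi t i r - t j r
  else t j r

section
variable {n : ℕ} {κ ν : ℕ → ℕ} {t : ℕ → ℕ → ℕ}

lemma IsChain.lo_le (h : IsChain n κ ν t) (i k : ℕ) : lo t i k ≤ t (i + 1) k :=
  max_le (h.2.2 (i + 1) k).1 (h.2.2 i k).2

lemma IsChain.le_hi (h : IsChain n κ ν t) (i k : ℕ) : t (i + 1) k ≤ hi t i k := by
  cases k with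
  | zero => exact (h.2.2 (i + 1) 0).2
  | succ k => exact le_min (h.2.2 (i + 1) (k + 1)).2 (h.2.2 i k).1

lemma tog_of_ne {i k x j : ℕ} (hj : j ≠ i + 1) : tog t i k x j = t j := by
  funext r; simp [tog, hj]

lemma tog_lt {i k x r : ℕ} (hr : r < k) : tog t i k x (i + 1) r = t (i + 1) r := by
  simp [tog, hr]

lemma tog_self {i k x : ℕ} : tog t i k x (i + 1) k = x := by simp [tog]

lemma tog_gt {i k x r : ℕ} (hr : k < r) :
    tog t i k x (i + 1) r = lo t i r + hi t i r - t (i + 1) r := by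
  simp [tog, hr.ne', not_lt.2 hr.le]

lemma lo_tog {i k x r : ℕ} : lo (tog t i k x) i r = lo t i r := by
  simp [lo, tog]

lemma hi_tog {i k x r : ℕ} : hi (tog t i k x) i r = hi t i r := by
  cases r <;> simp [hi, tog]

lemma IsChain.tog_mem (h : IsChain n κ ν t) {i k x : ℕ} (hl : lo t i k ≤ x) (hh : x ≤ hi t i k)
    (r : ℕ) : lo t i r ≤ tog t i k x (i + 1) r ∧ tog t i k x (i + 1) r ≤ hi t i r := by
  have h1 := h.lo_le i r
  have h2 := h.le_hi i r
  rcases lt_trichotomy r k with hr | rfl | hr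
  · rw [tog_lt hr]; exact ⟨h1, h2⟩
  · rw [tog_self]; exact ⟨hl, hh⟩
  · rw [tog_gt hr]; omega

lemma IsChain.tog (h : IsChain n κ ν t) {i k x : ℕ} (hi1 : i + 1 < n) (hl : lo t i k ≤ x)
    (hh : x ≤ hi t i k) : IsChain n κ ν (tog t i k x) := by
  have key := h.tog_mem hl hh
  refine ⟨by rw [tog_of_ne (by omega), h.1], fun j hj => by
    rw [tog_of_ne (by omega), h.2.1 j hj], fun j r => ?_⟩
  rcases eq_or_ne j i with rfl | hj
  · rw [tog_of_ne (j := j) (by omega)]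
    refine ⟨(key (r + 1)).2.trans (min_le_right _ _), le_trans (le_max_right _ _) (key r).1⟩
  rcases eq_or_ne j (i + 1) with rfl | hj'
  · rw [tog_of_ne (j := i + 1 + 1) (by omega)]
    refine ⟨le_trans (le_max_left _ _) (key r).1, (key r).2.trans ?_⟩
    cases r with
    | zero => exact le_rfl
    | succ r => exact min_le_left _ _
  · rw [tog_of_ne (j := j) (by omega), tog_of_ne (j := j + 1) (by omega)]
    exact h.2.2 j r

lemma IsChain.tog_tog (h : IsChain n κ ν t) {i k x y : ℕ} (hy : y = t (i + 1) k) :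
    StableGL.tog (StableGL.tog t i k x) i k y = t := by
  funext j r
  rcases eq_or_ne j (i + 1) with rfl | hj
  · rcases lt_trichotomy r k with hr | rfl | hr
    · rw [tog_lt hr, tog_lt hr]
    · rw [tog_self, hy]
    · rw [tog_gt hr, tog_gt hr, lo_tog, hi_tog]
      have h1 := h.lo_le i r
      have h2 := h.le_hi i r
      omega
  · rw [tog_of_ne hj, tog_of_ne hj]

lemma lo_add_hi (t : ℕ → ℕ → ℕ) (i k : ℕ) : lo t i k + hi t i (k + 1) = t i k + t (i + 2) (k + 1) := by
  simp only [lo, hi]; omega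

lemma sum_lo_hi (t : ℕ → ℕ → ℕ) (i k d : ℕ) :
    (lo t i k : ℤ) + ∑ r ∈ Finset.range d, ((lo t i (k + 1 + r) : ℤ) + hi t i (k + 1 + r))
      = t i k + ∑ r ∈ Finset.range d, ((t i (k + 1 + r) : ℤ) + t (i + 2) (k + 1 + r))
        + (lo t i (k + d) - t i (k + d)) := by
  induction d with
  | zero => simp
  | succ d ih =>
    rw [Finset.sum_range_succ, Finset.sum_range_succ]
    have := lo_add_hi t i (k + d)
    rw [show k + 1 + d = k + d + 1 by ring, show k + (d + 1) = k + d + 1 by ring] at *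
    push_cast [← @Nat.cast_inj ℤ] at this
    linarith

lemma IsChain.mono (h : IsChain n κ ν t) {i j : ℕ} (hij : i ≤ j) (k : ℕ) : t i k ≤ t j k := by
  induction hij with
  | refl => exact le_rfl
  | step _ ih => exact ih.trans (h.2.2 _ k).2

lemma IsChain.le_top (h : IsChain n κ ν t) (i k : ℕ) : t i k ≤ ν k := by
  have := h.mono (le_max_left i n) k
  rwa [h.2.1 _ (le_max_right i n)] at this

lemma IsChain.eq_zero (h : IsChain n κ ν t) {L : ℕ} (hL : ∀ k, L ≤ k → ν k = 0) {i k : ℕ}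
    (hk : L ≤ k) : t i k = 0 := Nat.le_zero.1 ((h.le_top i k).trans (hL k hk).le)

lemma IsChain.finite {L : ℕ} (hL : ∀ k, L ≤ k → ν k = 0) : {t | IsChain n κ ν t}.Finite := by
  refine Set.Finite.of_finite_image (f := fun t (p : Fin n × Fin L) => (t p.1 p.2 : ℕ)) ?_ ?_
  · refine (Set.finite_Iic (fun p : Fin n × Fin L => ν p.2)).subset ?_
    rintro _ ⟨t, ht, rfl⟩ p
    exact IsChain.le_top ht _ _
  · intro t ht s hs hts
    funext i k
    rcases lt_or_ge i n with hi | hi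
    · rcases lt_or_ge k L with hk | hk
      · exact congrFun hts (⟨i, hi⟩, ⟨k, hk⟩)
      · rw [IsChain.eq_zero ht hL hk, IsChain.eq_zero hs hL hk]
    · rw [ht.2.1 i hi, hs.2.1 i hi]

lemma wt_tog_of_ne {L i k x j : ℕ} (h1 : j ≠ i) (h2 : j ≠ i + 1) :
    wt L (tog t i k x) j = wt L t j := by
  simp only [wt, tog_of_ne h2, tog_of_ne (j := j + 1) (t := t) (i := i) (by omega)]

lemma wt_tog_add {L i k x : ℕ} :
    wt L (tog t i k x) i + wt L (tog t i k x) (i + 1) = wt L t i + wt L t (i + 1) := by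
  simp only [wt, ← Finset.sum_add_distrib]
  refine Finset.sum_congr rfl fun r _ => ?_
  rw [tog_of_ne (j := i) (by omega), tog_of_ne (j := i + 1 + 1) (by omega)]
  ring

lemma IsChain.wt_tog (h : IsChain n κ ν t) {L : ℕ} (hL : ∀ k, L ≤ k → ν k = 0) {i k x : ℕ}
    (hk : k < L) :
    wt L (StableGL.tog t i k x) i = ∑ r ∈ Finset.range k, ((t (i + 1) r : ℤ) - t i r)
      + (x - lo t i k) + wt L t (i + 1)
      - ∑ r ∈ Finset.range (k + 1), ((t (i + 2) r : ℤ) - t (i + 1) r) := by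
  obtain ⟨d, rfl⟩ := Nat.exists_eq_add_of_lt hk
  have e : ∀ f : ℕ → ℤ, ∑ r ∈ Finset.range (k + d + 1), f r
      = ∑ r ∈ Finset.range k, f r + f k + ∑ r ∈ Finset.range d, f (k + 1 + r) := by
    intro f
    rw [show k + d + 1 = k + 1 + d by ring, Finset.sum_range_add, Finset.sum_range_succ]
  have hlo : (lo t i (k + d) : ℤ) = t i (k + d) := by
    simp [lo, h.eq_zero hL le_rfl]
  have s := sum_lo_hi t i k d
  simp only [wt, e, tog_of_ne (j := i) (t := t) (i := i) (by omega : i ≠ i + 1), tog_self]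
  rw [Finset.sum_congr rfl (fun r hr => by rw [tog_lt (Finset.mem_range.1 hr)] :
    ∀ r ∈ Finset.range k, ((StableGL.tog t i k x (i + 1) r : ℤ) - t i r)
      = (t (i + 1) r : ℤ) - t i r)]
  rw [Finset.sum_congr rfl (fun r _ => by
    rw [tog_gt (by omega), Nat.cast_sub, Nat.cast_add]
    have := h.lo_le i (k + 1 + r)
    have := h.le_hi i (k + 1 + r)
    omega :
    ∀ r ∈ Finset.range d, ((StableGL.tog t i k x (i + 1) (k + 1 + r) : ℤ) - t i (k + 1 + r))
      = (lo t i (k + 1 + r) : ℤ) + hi t i (k + 1 + r) - t (i + 1) (k + 1 + r) - t i (k + 1 + r))]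
  rw [Finset.sum_range_succ]
  simp only [Finset.sum_sub_distrib, Finset.sum_add_distrib] at s ⊢
  rw [show i + 1 + 1 = i + 2 by ring]
  linarith

end

/-- The quantity whose nonnegativity expresses that the word of a chain is dominant relative
to `m`. -/
def defect (m : ℕ → ℤ) (t : ℕ → ℕ → ℕ) (k i : ℕ) : ℤ :=
  m i - m (i + 1) + ∑ r ∈ Finset.range k, ((t (i + 1) r : ℤ) - t i r)
    - ∑ r ∈ Finset.range (k + 1), ((t (i + 2) r : ℤ) - t (i + 1) r)

def Good (n : ℕ) (m : ℕ → ℤ) (t : ℕ → ℕ → ℕ) : Prop :=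
  ∀ i k, i + 1 < n → 0 ≤ defect m t k i

/-- `(k, i)` is the distinguished violation of dominance: the first row, then the last index. -/
def IsBad (n : ℕ) (m : ℕ → ℤ) (t : ℕ → ℕ → ℕ) (p : ℕ × ℕ) : Prop :=
  p.2 + 1 < n ∧ defect m t p.1 p.2 < 0 ∧
    (∀ k < p.1, ∀ i, i + 1 < n → 0 ≤ defect m t k i) ∧
    ∀ i, p.2 < i → i + 1 < n → 0 ≤ defect m t p.1 i

section
variable {n : ℕ} {κ ν : ℕ → ℕ} {t : ℕ → ℕ → ℕ} {m : ℕ → ℤ}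

lemma IsBad.unique {p q : ℕ × ℕ} (hp : IsBad n m t p) (hq : IsBad n m t q) : p = q := by
  obtain ⟨k, i⟩ := p
  obtain ⟨k', i'⟩ := q
  obtain ⟨h1, h2, h3, h4⟩ := hp
  obtain ⟨g1, g2, g3, g4⟩ := hq
  simp only at *
  have hk : k = k' := by
    rcases lt_trichotomy k k' with h | h | h
    · exact absurd (g3 k h i h1) (not_le.2 h2)
    · exact h
    · exact absurd (h3 k' h i' g1) (not_le.2 g2)
  subst hk
  rcases lt_trichotomy i i' with h | h | h
  · exact absurd (h4 i' h g1) (not_le.2 g2)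
  · rw [h]
  · exact absurd (g4 i h h1) (not_le.2 h2)

lemma exists_isBad (h : ¬ Good n m t) : ∃ p, IsBad n m t p := by
  classical
  have h' : ∃ k i, i + 1 < n ∧ defect m t k i < 0 := by
    simp only [Good] at h; push Not at h
    obtain ⟨i, k, h1, h2⟩ := h
    exact ⟨k, i, h1, h2⟩
  set k := Nat.find h' with hk
  have hki : ∃ i, i + 1 < n ∧ defect m t k i < 0 := Nat.find_spec h'
  obtain ⟨i0, hi0⟩ := hki
  set i := Nat.findGreatest (fun i => i + 1 < n ∧ defect m t k i < 0) n with hi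
  have hs : i + 1 < n ∧ defect m t k i < 0 :=
    Nat.findGreatest_spec (P := fun i => i + 1 < n ∧ defect m t k i < 0) (by omega : i0 ≤ n) hi0
  refine ⟨(k, i), hs.1, hs.2, fun k' hk' i' hi' => ?_, fun i' hi' hin => ?_⟩
  · have := Nat.find_min h' hk'
    push Not at this
    exact this i' hi'
  · have := Nat.findGreatest_is_greatest hi' (by omega : i' ≤ n)
    simp only [not_and, not_lt] at this
    exact this hin

open Classical in
/-- The sign-reversing involution. -/
def flip (n : ℕ) (m : ℕ → ℤ) (t : ℕ → ℕ → ℕ) : ℕ → ℕ → ℕ :=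
  if h : ∃ p, IsBad n m t p then
    tog t h.choose.2 h.choose.1
      (lo t h.choose.2 h.choose.1 + (-defect m t h.choose.1 h.choose.2 - 1).toNat)
  else t

lemma flip_eq {p : ℕ × ℕ} (hp : IsBad n m t p) :
    flip n m t = tog t p.2 p.1 (lo t p.2 p.1 + (-defect m t p.1 p.2 - 1).toNat) := by
  have h : ∃ p, IsBad n m t p := ⟨p, hp⟩
  rw [flip, dif_pos h, h.choose_spec.unique hp]

/-- The value given to the toggled row is admissible. -/
lemma IsChain.bad_bound (h : IsChain n κ ν t) (hm : ∀ i, i + 1 < n → m (i + 1) ≤ m i)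
    {p : ℕ × ℕ} (hp : IsBad n m t p) :
    (t (p.2 + 1) p.1 : ℤ) - hi t p.2 p.1 ≤ defect m t p.1 p.2 := by
  obtain ⟨k, i⟩ := p
  obtain ⟨h1, h2, h3, h4⟩ := hp
  simp only at *
  cases k with
  | zero =>
    have := hm i h1
    simp only [defect, hi, Finset.sum_range_zero, zero_add, Finset.sum_range_one]
    linarith
  | succ k =>
    have g := h3 k (Nat.lt_succ_self k) i h1
    simp only [defect] at g ⊢
    rw [Finset.sum_range_succ _ k, Finset.sum_range_succ _ (k + 1)]
    have a1 := (h.2.2 (i + 1) k).1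
    have a2 := (h.2.2 i k).2
    simp only [hi]
    have a3 : ((min (t (i + 2) (k + 1)) (t i k) : ℕ) : ℤ)
        = (t (i + 2) (k + 1) : ℤ) + t i k - max (t (i + 2) (k + 1)) (t i k) := by
      push_cast
      linarith [min_add_max (t (i + 2) (k + 1) : ℤ) (t i k)]
    have a4 : (max (t (i + 2) (k + 1) : ℤ) (t i k) : ℤ) ≤ t (i + 1) k := by
      apply max_le <;> exact_mod_cast ‹_›
    rw [a3]
    push_cast
    linarith

lemma defect_tog_lt {k i x k' i' : ℕ} (hk : k' < k) :
    defect m (tog t i k x) k' i' = defect m t k' i' := by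
  have e : ∀ j r, r < k → tog t i k x j r = t j r := by
    intro j r hr
    rcases eq_or_ne j (i + 1) with rfl | hj
    · exact tog_lt hr
    · rw [tog_of_ne hj]
  simp only [defect]
  congr 1
  · congr 1
    exact Finset.sum_congr rfl fun r hr => by
      rw [e _ _ (by have := Finset.mem_range.1 hr; omega),
        e _ _ (by have := Finset.mem_range.1 hr; omega)]
  · exact Finset.sum_congr rfl fun r hr => by
      rw [e _ _ (by have := Finset.mem_range.1 hr; omega),
        e _ _ (by have := Finset.mem_range.1 hr; omega)]

lemma defect_tog_right {k i x i' : ℕ} (hi : i < i') :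
    defect m (tog t i k x) k i' = defect m t k i' := by
  simp only [defect]
  rw [tog_of_ne (j := i' + 1) (by omega), tog_of_ne (j := i' + 2) (by omega)]
  congr 2
  refine Finset.sum_congr rfl fun r hr => ?_
  rcases eq_or_ne i' (i + 1) with rfl | hj
  · rw [tog_lt (Finset.mem_range.1 hr)]
  · rw [tog_of_ne hj]

lemma defect_tog_self {k i x : ℕ} :
    defect m (tog t i k x) k i = defect m t k i + x - t (i + 1) k := by
  simp only [defect]
  rw [tog_of_ne (j := i) (by omega), tog_of_ne (j := i + 2) (by omega)]
  have e1 : ∑ r ∈ Finset.range k, ((tog t i k x (i + 1) r : ℤ) - t i r)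
      = ∑ r ∈ Finset.range k, ((t (i + 1) r : ℤ) - t i r) :=
    Finset.sum_congr rfl fun r hr => by rw [tog_lt (Finset.mem_range.1 hr)]
  have e2 : ∑ r ∈ Finset.range k, ((t (i + 2) r : ℤ) - tog t i k x (i + 1) r)
      = ∑ r ∈ Finset.range k, ((t (i + 2) r : ℤ) - t (i + 1) r) :=
    Finset.sum_congr rfl fun r hr => by rw [tog_lt (Finset.mem_range.1 hr)]
  rw [Finset.sum_range_succ, Finset.sum_range_succ, tog_self, e1, e2]
  ring

section
variable (h : IsChain n κ ν t) (hm : ∀ i, i + 1 < n → m (i + 1) ≤ m i) {p : ℕ × ℕ}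
  (hp : IsBad n m t p)
include h hm hp

lemma IsChain.flip : IsChain n κ ν (flip n m t) := by
  rw [flip_eq hp]
  have h1 := h.bad_bound hm hp
  have h2 := h.lo_le p.2 p.1
  have h3 := hp.2.1
  refine h.tog hp.1 (by omega) (by omega)

omit hm in
lemma IsChain.isBad_flip : IsBad n m (StableGL.flip n m t) p := by
  have h2 := h.lo_le p.2 p.1
  have h3 := hp.2.1
  rw [flip_eq hp]
  refine ⟨hp.1, ?_, fun k hk i hi => ?_, fun i hi hn => ?_⟩
  · rw [defect_tog_self]
    push_cast
    rw [Int.toNat_of_nonneg (by omega)]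
    omega
  · rw [defect_tog_lt hk]; exact hp.2.2.1 k hk i hi
  · rw [defect_tog_right hi]; exact hp.2.2.2 i hi hn

omit hm in
lemma IsChain.flip_flip : StableGL.flip n m (StableGL.flip n m t) = t := by
  rw [flip_eq (h.isBad_flip hp), flip_eq hp]
  have h2 := h.lo_le p.2 p.1
  have h3 := hp.2.1
  refine h.tog_tog ?_
  rw [defect_tog_self, lo_tog]
  push_cast
  rw [Int.toNat_of_nonneg (a := -defect m t p.1 p.2 - 1) (by omega)]
  omega

lemma IsChain.wt_flip {L : ℕ} (hL : ∀ k, L ≤ k → ν k = 0) :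
    m p.2 + wt L (StableGL.flip n m t) p.2 + 1 = m (p.2 + 1) + wt L t (p.2 + 1) ∧
    m p.2 + wt L t p.2 + 1 = m (p.2 + 1) + wt L (StableGL.flip n m t) (p.2 + 1) ∧
    ∀ j, j ≠ p.2 → j ≠ p.2 + 1 → wt L (StableGL.flip n m t) j = wt L t j := by
  have h2 := h.lo_le p.2 p.1
  have h3 := hp.2.1
  have h1 := h.bad_bound hm hp
  have hk : p.1 < L := by
    by_contra hk
    rw [not_lt] at hk
    have : hi t p.2 p.1 = 0 := by
      rcases p with ⟨k, i⟩
      cases k with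
      | zero => exact h.eq_zero hL hk
      | succ k => simp [hi, h.eq_zero hL hk]
    rw [this] at h1
    push_cast at h1
    omega
  have e : m p.2 + wt L (StableGL.flip n m t) p.2 + 1 = m (p.2 + 1) + wt L t (p.2 + 1) := by
    rw [flip_eq hp, h.wt_tog hL hk]
    push_cast
    rw [Int.toNat_of_nonneg (by omega)]
    simp only [defect]
    ring
  refine ⟨e, ?_, fun j h1 h2 => by rw [flip_eq hp, wt_tog_of_ne h1 h2]⟩
  have := wt_tog_add (L := L) (t := t) (i := p.2) (k := p.1)
    (x := lo t p.2 p.1 + (-defect m t p.1 p.2 - 1).toNat)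
  rw [← flip_eq hp] at this
  linarith

end

/-- The toggle realizing the symmetry of skew Schur polynomials. -/
def bk (t : ℕ → ℕ → ℕ) (i : ℕ) : ℕ → ℕ → ℕ := tog t i 0 (lo t i 0 + hi t i 0 - t (i + 1) 0)

lemma IsChain.bk (h : IsChain n κ ν t) {i : ℕ} (hi1 : i + 1 < n) : IsChain n κ ν (bk t i) := by
  have h1 := h.lo_le i 0
  have h2 := h.le_hi i 0
  exact h.tog hi1 (by omega) (by omega)

lemma IsChain.bk_bk (h : IsChain n κ ν t) (i : ℕ) : StableGL.bk (StableGL.bk t i) i = t := by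
  have h1 := h.lo_le i 0
  have h2 := h.le_hi i 0
  refine h.tog_tog ?_
  rw [StableGL.bk, tog_self, lo_tog, hi_tog]
  omega

lemma IsChain.wt_bk (h : IsChain n κ ν t) {L : ℕ} (hL : ∀ k, L ≤ k → ν k = 0) (hL0 : 0 < L)
    (i : ℕ) : wt L (StableGL.bk t i) i = wt L t (i + 1) ∧
      wt L (StableGL.bk t i) (i + 1) = wt L t i := by
  have h1 := h.lo_le i 0
  have h2 := h.le_hi i 0
  have e : wt L (StableGL.bk t i) i = wt L t (i + 1) := by
    rw [StableGL.bk, h.wt_tog hL hL0, Nat.cast_sub (by omega)]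
    simp only [Finset.sum_range_zero, zero_add, Finset.sum_range_one, hi]
    push_cast
    ring
  have := wt_tog_add (L := L) (t := t) (i := i) (k := 0) (x := lo t i 0 + hi t i 0 - t (i + 1) 0)
  rw [← StableGL.bk] at this
  exact ⟨e, by linarith⟩

end

/-- Laurent polynomials in `n` variables. -/
abbrev Lau (n : ℕ) : Type := AddMonoidAlgebra ℤ (Fin n → ℤ)

def mon {n : ℕ} (a : Fin n → ℤ) : Lau n := AddMonoidAlgebra.single a 1

section
variable {n : ℕ}

lemma mon_add (a b : Fin n → ℤ) : mon (a + b) = mon a * mon b := by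
  simp [mon, AddMonoidAlgebra.single_mul_single]

def permHom (σ : Equiv.Perm (Fin n)) : (Fin n → ℤ) →+ (Fin n → ℤ) where
  toFun a := a ∘ σ
  map_zero' := rfl
  map_add' _ _ := rfl

def act (σ : Equiv.Perm (Fin n)) : Lau n →+* Lau n :=
  AddMonoidAlgebra.mapDomainRingHom ℤ (permHom σ)

lemma act_mon (σ : Equiv.Perm (Fin n)) (a : Fin n → ℤ) : act σ (mon a) = mon (a ∘ σ) := by
  simp [act, mon, permHom]

lemma hom_ext_mon {S : Type*} [Ring S] {f g : Lau n →+* S} (h : ∀ a, f (mon a) = g (mon a)) :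
    f = g := by
  refine AddMonoidAlgebra.ringHom_ext (fun r => ?_) fun a => h a
  have : (AddMonoidAlgebra.single 0 r : Lau n) = r • 1 := by
    rw [AddMonoidAlgebra.one_def, AddMonoidAlgebra.smul_single]; simp
  rw [this, map_zsmul, map_zsmul, map_one, map_one]

lemma act_mul (σ τ : Equiv.Perm (Fin n)) (F : Lau n) : act (σ * τ) F = act τ (act σ F) := by
  rw [← RingHom.comp_apply]
  congr 1
  exact hom_ext_mon fun a => by simp [act_mon, Function.comp_assoc]

lemma act_one (F : Lau n) : act 1 F = F := by
  conv_rhs => rw [← RingHom.id_apply F]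
  congr 1
  exact hom_ext_mon fun a => by simp [act_mon]

def alt (a : Fin n → ℤ) : Lau n :=
  ∑ σ : Equiv.Perm (Fin n), (Equiv.Perm.sign σ : ℤ) • mon (a ∘ σ)

lemma alt_comp (a : Fin n → ℤ) (τ : Equiv.Perm (Fin n)) :
    alt (a ∘ τ) = (Equiv.Perm.sign τ : ℤ) • alt a := by
  simp only [alt, Finset.smul_sum]
  refine Fintype.sum_equiv (Equiv.mulLeft τ) _ _ fun σ => ?_
  simp only [Equiv.coe_mulLeft, Equiv.Perm.sign_mul, smul_smul, Function.comp_assoc,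
    Equiv.Perm.coe_mul]
  rw [Units.val_mul, ← mul_assoc, ← Units.val_mul, Int.units_mul_self, Units.val_one, one_mul]

lemma alt_eq_neg {a b : Fin n → ℤ} {i j : Fin n} (hij : i ≠ j) (h : b = a ∘ Equiv.swap i j) :
    alt b = -alt a := by
  rw [h, alt_comp, Equiv.Perm.sign_swap hij]; simp

def Symm (F : Lau n) : Prop := ∀ σ, act σ F = F

lemma Symm.mul {F G : Lau n} (hF : Symm F) (hG : Symm G) : Symm (F * G) := fun σ => by
  rw [map_mul, hF, hG]

lemma symm_of_swap {F : Lau n}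
    (h : ∀ i (hi : i + 1 < n), act (Equiv.swap ⟨i, by omega⟩ ⟨i + 1, hi⟩) F = F) : Symm F := by
  cases n with
  | zero => intro σ; rw [Subsingleton.elim σ 1, act_one]
  | succ n =>
    intro σ
    have hσ : σ ∈ Submonoid.closure (Set.range fun i : Fin n ↦ Equiv.swap i.castSucc i.succ) := by
      rw [Equiv.Perm.mclosure_swap_castSucc_succ]; trivial
    induction hσ using Submonoid.closure_induction with
    | mem x hx => obtain ⟨i, rfl⟩ := hx; exact h i (by omega)
    | one => exact act_one F
    | mul x y _ _ hx hy => rw [act_mul, hx, hy]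

lemma alt_mul_of_symm (a : Fin n → ℤ) {F : Lau n} (hF : Symm F) :
    alt a * F = ∑ σ : Equiv.Perm (Fin n), (Equiv.Perm.sign σ : ℤ) • act σ (mon a * F) := by
  simp only [alt, Finset.sum_mul, map_mul, hF _, act_mon, smul_mul_assoc]

lemma alt_mul_sum {ι : Type*} (s : Finset ι) (w : ι → Fin n → ℤ) (a : Fin n → ℤ)
    (hF : Symm (∑ t ∈ s, mon (w t))) :
    alt a * ∑ t ∈ s, mon (w t) = ∑ t ∈ s, alt (a + w t) := by
  rw [alt_mul_of_symm a hF]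
  simp only [Finset.mul_sum, ← mon_add, map_sum, act_mon, Finset.smul_sum]
  rw [Finset.sum_comm]
  rfl

open Classical in
def chains (n : ℕ) (κ ν : ℕ → ℕ) : Finset (ℕ → ℕ → ℕ) :=
  if h : {t | IsChain n κ ν t}.Finite then h.toFinset else ∅

def wtv (n L : ℕ) (t : ℕ → ℕ → ℕ) : Fin n → ℤ := fun i => wt L t i

/-- The skew Schur polynomial of `ν / κ` in `n` variables. -/
def skew (n L : ℕ) (κ ν : ℕ → ℕ) : Lau n := ∑ t ∈ chains n κ ν, mon (wtv n L t)

def rho (n : ℕ) : Fin n → ℤ := fun i => (n : ℤ) - 1 - i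

end

section
variable {n L : ℕ} {κ ν : ℕ → ℕ} (hL : ∀ k, L ≤ k → ν k = 0)
include hL

lemma mem_chains {t : ℕ → ℕ → ℕ} : t ∈ chains n κ ν ↔ IsChain n κ ν t := by
  rw [chains, dif_pos (IsChain.finite hL), Set.Finite.mem_toFinset]; rfl

lemma symm_skew (hL0 : 0 < L) : Symm (skew n L κ ν) := by
  refine symm_of_swap fun i hi => ?_
  simp only [skew, map_sum, act_mon]
  refine Finset.sum_nbij' (fun t => bk t i) (fun t => bk t i) ?_ ?_ ?_ ?_ ?_
  · intro t ht; rw [mem_chains hL] at *; exact ht.bk hi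
  · intro t ht; rw [mem_chains hL] at *; exact ht.bk hi
  · intro t ht; rw [mem_chains hL] at *; exact ht.bk_bk i
  · intro t ht; rw [mem_chains hL] at *; exact ht.bk_bk i
  · intro t ht
    rw [mem_chains hL] at ht
    congr 1
    funext j
    obtain ⟨e1, e2⟩ := ht.wt_bk hL hL0 i
    simp only [wtv, Function.comp]
    rcases eq_or_ne j ⟨i, by omega⟩ with rfl | h1
    · rw [Equiv.swap_apply_left]; exact e1.symm
    rcases eq_or_ne j ⟨i + 1, hi⟩ with rfl | h2
    · rw [Equiv.swap_apply_right]; exact e2.symm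
    rw [Equiv.swap_apply_of_ne_of_ne h1 h2, bk, wt_tog_of_ne]
    · exact fun h => h1 (Fin.ext h)
    · exact fun h => h2 (Fin.ext h)

open Classical in
theorem alt_mul_skew (hL0 : 0 < L) {m : ℕ → ℤ} (hm : ∀ i, i + 1 < n → m (i + 1) ≤ m i) :
    alt ((fun i : Fin n => m i) + rho n) * skew n L κ ν
      = ∑ t ∈ (chains n κ ν).filter (Good n m),
          alt ((fun i : Fin n => m i) + wtv n L t + rho n) := by
  rw [skew, alt_mul_sum _ _ _ (symm_skew hL hL0), ← Finset.sum_filter_add_sum_filter_not _ (Good n m)]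
  have key : ∀ t, IsChain n κ ν t → ¬ Good n m t →
      alt ((fun i : Fin n => m i) + rho n + wtv n L (flip n m t))
        = - alt ((fun i : Fin n => m i) + rho n + wtv n L t) := by
    intro t ht hg
    obtain ⟨p, hp⟩ := exists_isBad hg
    obtain ⟨e1, e2, e3⟩ := ht.wt_flip hm hp hL
    have hp1 := hp.1
    refine alt_eq_neg (i := ⟨p.2, by omega⟩) (j := ⟨p.2 + 1, hp.1⟩) (by simp [Fin.ext_iff]) ?_
    funext j
    simp only [Pi.add_apply, wtv, rho, Function.comp]
    rcases eq_or_ne j ⟨p.2, by omega⟩ with rfl | h1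
    · rw [Equiv.swap_apply_left]; push_cast; linarith
    rcases eq_or_ne j ⟨p.2 + 1, hp.1⟩ with rfl | h2
    · rw [Equiv.swap_apply_right]; push_cast; linarith
    rw [Equiv.swap_apply_of_ne_of_ne h1 h2, e3]
    · exact fun h => h1 (Fin.ext h)
    · exact fun h => h2 (Fin.ext h)
  have : ∑ t ∈ (chains n κ ν).filter (fun t => ¬ Good n m t),
      alt ((fun i : Fin n => m i) + rho n + wtv n L t) = 0 := by
    refine Finset.sum_involution (fun t _ => flip n m t) ?_ ?_ ?_ ?_
    · intro t ht
      rw [Finset.mem_filter, mem_chains hL] at ht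
      rw [key t ht.1 ht.2, add_neg_cancel]
    · intro t ht h0 hf
      rw [Finset.mem_filter, mem_chains hL] at ht
      have := key t ht.1 ht.2
      rw [hf, eq_neg_iff_add_eq_zero, ← two_zsmul] at this
      refine h0 ((smul_eq_zero.1 this).resolve_left two_ne_zero)
    · intro t ht
      rw [Finset.mem_filter, mem_chains hL] at *
      obtain ⟨p, hp⟩ := exists_isBad ht.2
      refine ⟨ht.1.flip hm hp, fun hg => ?_⟩
      have hb := ht.1.isBad_flip hp
      exact absurd (hg _ _ hb.1) (not_le.2 hb.2.1)
    · intro t ht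
      rw [Finset.mem_filter, mem_chains hL] at ht
      obtain ⟨p, hp⟩ := exists_isBad ht.2
      exact ht.1.flip_flip hp
  rw [this, add_zero]
  refine Finset.sum_congr rfl fun t _ => ?_
  rw [add_right_comm]

/-- A good chain leads to a dominant weight. -/
lemma IsChain.dominant {t : ℕ → ℕ → ℕ} (h : IsChain n κ ν t) {m : ℕ → ℤ} (hg : Good n m t) {i : ℕ}
    (hi : i + 1 < n) : m (i + 1) + wt L t (i + 1) ≤ m i + wt L t i := by
  have := hg i L hi
  simp only [defect] at this
  rw [Finset.sum_range_succ _ L, h.eq_zero hL le_rfl, h.eq_zero hL le_rfl] at this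
  simp only [wt, show i + 1 + 1 = i + 2 by ring]
  push_cast at this
  linarith

end

section
variable {n : ℕ}

lemma strictAnti_comp_perm {a : Fin n → ℤ} (ha : StrictAnti a) {σ : Equiv.Perm (Fin n)}
    (h : StrictAnti (a ∘ σ)) : σ = 1 := by
  have hs : StrictMono σ := fun i j hij => ha.lt_iff_gt.1 (h hij)
  have := Subsingleton.elim (hs.orderIsoOfSurjective σ σ.surjective) (OrderIso.refl (Fin n))
  ext i
  have := DFunLike.congr_fun this i
  simpa using congrArg Fin.val this

lemma coeff_alt {a b : Fin n → ℤ} (ha : StrictAnti a) (hb : StrictAnti b) :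
    (alt a).coeff b = if a = b then 1 else 0 := by
  classical
  simp only [alt, AddMonoidAlgebra.coeff_sum, Finsupp.finsetSum_apply,
    AddMonoidAlgebra.coeff_smul_apply, mon, AddMonoidAlgebra.coeff_single, Finsupp.single_apply]
  rw [Finset.sum_eq_single 1]
  · simp
  · intro σ _ hσ
    rw [if_neg, smul_zero]
    intro h
    exact hσ (strictAnti_comp_perm ha (h ▸ hb))
  · simp

end

section
variable {n : ℕ}

lemma coeff_act (σ : Equiv.Perm (Fin n)) (F : Lau n) (b : Fin n → ℤ) :
    (act σ F).coeff (b ∘ σ) = F.coeff b := by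
  have : Function.Injective (permHom σ) := fun x y h => by
    funext i
    simpa [permHom] using congrFun h (σ⁻¹ i)
  exact Finsupp.mapDomain_apply this F.coeff b

lemma Symm.coeff {F : Lau n} (hF : Symm F) (σ : Equiv.Perm (Fin n)) (b : Fin n → ℤ) :
    F.coeff (b ∘ σ) = F.coeff b := by
  conv_lhs => rw [← hF σ]
  exact coeff_act σ F b

/-- Antisymmetric Laurent polynomials. -/
def Anti (A : Lau n) : Prop := ∀ (σ : Equiv.Perm (Fin n)) (b : Fin n → ℤ),
  A.coeff (b ∘ σ) = (Equiv.Perm.sign σ : ℤ) * A.coeff b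

lemma act_alt (σ : Equiv.Perm (Fin n)) (a : Fin n → ℤ) :
    act σ (alt a) = (Equiv.Perm.sign σ : ℤ) • alt a := by
  simp only [alt, map_sum, map_zsmul, act_mon, Finset.smul_sum]
  refine Fintype.sum_equiv (Equiv.mulRight σ) _ _ fun τ => ?_
  simp only [Equiv.coe_mulRight, Equiv.Perm.sign_mul, smul_smul, Function.comp_assoc,
    Equiv.Perm.coe_mul, Units.val_mul]
  rw [mul_comm, mul_assoc, ← Units.val_mul, Int.units_mul_self, Units.val_one, mul_one]

lemma anti_alt_mul (a : Fin n → ℤ) {F : Lau n} (hF : Symm F) : Anti (alt a * F) := fun σ b => by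
  have h : act σ (alt a * F) = (Equiv.Perm.sign σ : ℤ) • (alt a * F) := by
    rw [map_mul, act_alt, hF, smul_mul_assoc]
  have h2 := coeff_act σ (alt a * F) b
  rw [h, AddMonoidAlgebra.coeff_smul_apply] at h2
  rw [← h2, smul_eq_mul, ← mul_assoc, ← Units.val_mul, Int.units_mul_self, Units.val_one, one_mul]

lemma Anti.eq_zero {A : Lau n} (hA : Anti A) (h : ∀ b, StrictAnti b → A.coeff b = 0) : A = 0 := by
  ext b
  rw [AddMonoidAlgebra.coeff_zero, Finsupp.zero_apply]
  by_cases hb : Function.Injective b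
  · have hs : StrictAnti (b ∘ Tuple.sort (fun i => - b i)) := by
      have hm := Tuple.monotone_sort (fun i => - b i)
      intro i j hij
      refine lt_of_le_of_ne (neg_le_neg_iff.1 (hm hij.le)) fun he => ?_
      exact hij.ne ((Tuple.sort _).injective (hb he.symm))
    have := h _ hs
    rw [hA] at this
    exact (mul_eq_zero.1 this).resolve_left (Units.ne_zero _)
  · simp only [Function.Injective, not_forall] at hb
    obtain ⟨i, j, hij, hne⟩ := hb
    have := hA (Equiv.swap i j) b
    rw [Equiv.Perm.sign_swap hne, show b ∘ Equiv.swap i j = b from ?_] at this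
    · push_cast at this; linarith
    · funext k
      rcases eq_or_ne k i with rfl | h1
      · simp [hij]
      rcases eq_or_ne k j with rfl | h2
      · simp [hij]
      simp [Equiv.swap_apply_of_ne_of_ne h1 h2]

lemma Anti.sub {A B : Lau n} (hA : Anti A) (hB : Anti B) : Anti (A - B) := fun σ b => by
  simp only [AddMonoidAlgebra.coeff_sub, Finsupp.sub_apply, hA σ b, hB σ b]; ring

lemma Anti.smul {A : Lau n} (c : ℤ) (hA : Anti A) : Anti (c • A) := fun σ b => by
  simp only [AddMonoidAlgebra.coeff_smul_apply, hA σ b, smul_eq_mul]; ring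

lemma Anti.sum {ι : Type*} (s : Finset ι) {A : ι → Lau n} (hA : ∀ i ∈ s, Anti (A i)) :
    Anti (∑ i ∈ s, A i) := fun σ b => by
  simp only [AddMonoidAlgebra.coeff_sum, Finsupp.finsetSum_apply, Finset.mul_sum]
  exact Finset.sum_congr rfl fun i hi => hA i hi σ b

lemma symm_one : Symm (1 : Lau n) := fun _ => map_one _

lemma anti_alt (a : Fin n → ℤ) : Anti (alt a) := by
  simpa using anti_alt_mul a symm_one

/-- Dominant weights. -/
abbrev Wt (n : ℕ) : Type := {a : Fin n → ℤ // Antitone a}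

lemma strictAnti_rho : StrictAnti (rho n) := fun i j h => by
  have : (i : ℕ) < j := h
  simp only [rho]; omega

lemma strictAnti_add_rho {a : Fin n → ℤ} (ha : Antitone a) : StrictAnti (a + rho n) :=
  fun _ _ h => add_lt_add_of_le_of_lt (ha h.le) (strictAnti_rho h)

lemma antitone_sub_rho {b : Fin n → ℤ} (hb : StrictAnti b) : Antitone (b - rho n) := by
  have key : ∀ d : ℕ, ∀ i j : Fin n, (i : ℕ) + d = j → b j + d ≤ b i := by
    intro d
    induction d with
    | zero =>
      intro i j h
      obtain rfl : i = j := Fin.ext h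
      simp
    | succ d ih =>
      intro i j h
      have h1 := ih i ⟨i + d, by omega⟩ rfl
      have h2 : b j < b ⟨i + d, by omega⟩ := hb (Fin.lt_def.2 (by simp; omega))
      push_cast; omega
  intro i j hij
  have hij' : (i : ℕ) ≤ j := hij
  have := key (j - i) i j (by omega)
  simp only [Pi.sub_apply, rho]
  omega

def mult (F : Lau n) (m l : Fin n → ℤ) : ℤ := (alt (m + rho n) * F).coeff (l + rho n)

lemma coeff_mon_mul (a b : Fin n → ℤ) (F : Lau n) : (mon a * F).coeff b = F.coeff (b - a) := by
  rw [mon, AddMonoidAlgebra.coeff_single_mul_apply, one_mul, neg_add_eq_sub]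

lemma mult_eq (F : Lau n) (m l : Fin n → ℤ) : mult F m l =
    ∑ σ : Equiv.Perm (Fin n), (Equiv.Perm.sign σ : ℤ) *
      F.coeff ((l + rho n) - (m + rho n) ∘ σ) := by
  simp only [mult, alt, Finset.sum_mul, smul_mul_assoc, AddMonoidAlgebra.coeff_sum,
    Finsupp.finsetSum_apply, AddMonoidAlgebra.coeff_smul_apply, coeff_mon_mul, smul_eq_mul]

lemma finite_mult (F : Lau n) (m : Fin n → ℤ) : {l : Wt n | mult F m l ≠ 0}.Finite := by
  refine Set.Finite.of_finite_image (f := fun l : Wt n => l.1 + rho n) ?_ ?_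
  · refine ((alt (m + rho n) * F).coeff.support.finite_toSet).subset ?_
    rintro _ ⟨l, hl, rfl⟩
    simpa [mult] using hl
  · intro a _ b _ h
    exact Subtype.ext (add_right_cancel h)

theorem alt_mul_eq_sum {F : Lau n} (hF : Symm F) (m : Fin n → ℤ) (S : Finset (Wt n))
    (hS : ∀ k : Wt n, mult F m k ≠ 0 → k ∈ S) :
    alt (m + rho n) * F = ∑ k ∈ S, mult F m k • alt (k.1 + rho n) := by
  rw [← sub_eq_zero]
  refine Anti.eq_zero ((anti_alt_mul _ hF).sub (Anti.sum _ fun k _ => (anti_alt _).smul _)) ?_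
  intro b hb
  set l : Wt n := ⟨b - rho n, antitone_sub_rho hb⟩ with hl
  have hbl : b = l.1 + rho n := by simp [hl]
  simp only [AddMonoidAlgebra.coeff_sub, Finsupp.sub_apply, AddMonoidAlgebra.coeff_sum,
    Finsupp.finsetSum_apply, AddMonoidAlgebra.coeff_smul_apply, smul_eq_mul]
  rw [hbl]
  have : ∀ k ∈ S, mult F m k * (alt (k.1 + rho n)).coeff (l.1 + rho n)
      = if k = l then mult F m k else 0 := by
    intro k _
    rw [coeff_alt (strictAnti_add_rho k.2) (strictAnti_add_rho l.2)]
    by_cases h : k = l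
    · simp [h]
    · rw [if_neg h, if_neg, mul_zero]
      exact fun h' => h (Subtype.ext (add_right_cancel h'))
  rw [Finset.sum_congr rfl this, Finset.sum_ite_eq']
  split_ifs with h
  · simp [mult]
  · by_contra h'
    exact h (hS l (by simpa [mult] using h'))

theorem mult_mul {F : Lau n} (hF : Symm F) (G : Lau n) (m l : Fin n → ℤ) (S : Finset (Wt n))
    (hS : ∀ k : Wt n, mult F m k ≠ 0 → k ∈ S) :
    mult (F * G) m l = ∑ k ∈ S, mult F m k * mult G k l := by
  rw [mult, ← mul_assoc, alt_mul_eq_sum hF m S hS]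
  simp only [Finset.sum_mul, smul_mul_assoc, AddMonoidAlgebra.coeff_sum,
    Finsupp.finsetSum_apply, AddMonoidAlgebra.coeff_smul_apply, smul_eq_mul]
  rfl

lemma alt_rho_ne_zero : alt (rho n) ≠ 0 := by
  intro h
  have := coeff_alt (strictAnti_rho (n := n)) strictAnti_rho
  rw [h] at this
  simp at this

/-- Expansion of a symmetric Laurent polynomial along a family of Schur functions. -/
theorem mult_expand {F : Lau n} (hF : Symm F) (s : Wt n → Lau n)
    (hs : ∀ k : Wt n, mult F 0 k ≠ 0 → alt (rho n) * s k = alt (k.1 + rho n)) (m l : Fin n → ℤ)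
    (S : Finset (Wt n)) (hS : ∀ k : Wt n, mult F 0 k ≠ 0 → k ∈ S) :
    mult F m l = ∑ k ∈ S, mult F 0 k * mult (s k) m l := by
  have h1 : F = ∑ k ∈ S, mult F 0 k • s k := by
    have h := alt_mul_eq_sum hF 0 S hS
    rw [zero_add] at h
    refine mul_left_cancel₀ alt_rho_ne_zero ?_
    rw [h, Finset.mul_sum]
    refine Finset.sum_congr rfl fun k _ => ?_
    by_cases hk : mult F 0 k = 0
    · rw [hk, zero_smul, zero_smul, mul_zero]
    · rw [mul_smul_comm, hs k hk]
  conv_lhs => rw [h1]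
  simp only [mult, Finset.mul_sum, mul_smul_comm, AddMonoidAlgebra.coeff_sum,
    Finsupp.finsetSum_apply, AddMonoidAlgebra.coeff_smul_apply, smul_eq_mul]

/-- The substitution inverting all variables. -/
def inv : Lau n →+* Lau n :=
  AddMonoidAlgebra.mapDomainRingHom ℤ (negAddMonoidHom : (Fin n → ℤ) →+ (Fin n → ℤ))

lemma coeff_inv (F : Lau n) (b : Fin n → ℤ) : (inv F).coeff b = F.coeff (-b) := by
  conv_lhs => rw [← neg_neg b]
  exact Finsupp.mapDomain_apply neg_injective F.coeff (-b)

lemma Symm.inv {F : Lau n} (hF : Symm F) : Symm (inv F) := fun σ => by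
  ext b
  obtain ⟨c, rfl⟩ : ∃ c : Fin n → ℤ, b = c ∘ σ := ⟨b ∘ σ.symm, by funext i; simp⟩
  rw [coeff_act, coeff_inv, coeff_inv, ← hF.coeff σ]
  rfl

theorem mult_inv {F : Lau n} (hF : Symm F) (m l : Fin n → ℤ) :
    mult (inv F) l m = mult F m l := by
  rw [mult_eq, mult_eq]
  refine Fintype.sum_equiv (Equiv.inv _) _ _ fun σ => ?_
  rw [Equiv.inv_apply, Equiv.Perm.sign_inv, coeff_inv, ← hF.coeff (σ⁻¹)]
  congr 2
  funext i
  simp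

/-- The dual weight. -/
def star (a : Fin n → ℤ) : Fin n → ℤ := fun i => - a i.rev

lemma star_star (a : Fin n → ℤ) : star (star a) = a := by
  funext i; simp [star]

theorem mult_star {F : Lau n} (hF : Symm F) (m l : Fin n → ℤ) :
    mult F (star m) (star l) = mult F l m := by
  rw [← mult_inv hF l m, mult_eq, mult_eq]
  refine Fintype.sum_equiv ((Equiv.mulLeft Fin.revPerm).trans (Equiv.mulRight Fin.revPerm))
    _ _ fun σ => ?_
  have hsign : (Equiv.Perm.sign (Fin.revPerm (n := n)) : ℤ) * Equiv.Perm.sign (Fin.revPerm (n := n))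
      = 1 := by
    rw [← Units.val_mul, Int.units_mul_self, Units.val_one]
  rw [coeff_inv, ← hF.coeff Fin.revPerm]
  simp only [Equiv.trans_apply, Equiv.coe_mulLeft, Equiv.coe_mulRight, Equiv.Perm.sign_mul,
    Units.val_mul]
  congr 1
  · linear_combination (-(Equiv.Perm.sign σ : ℤ)) * hsign
  · congr 1
    funext i
    simp [star, rho]
    ring

end

def res (n : ℕ) (m : ℕ → ℤ) : Fin n → ℤ := fun i => m i

lemma antitone_res {n : ℕ} {m : ℕ → ℤ} (hm : ∀ i, i + 1 < n → m (i + 1) ≤ m i) :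
    Antitone (res n m) := by
  have key : ∀ d i, i + d < n → m (i + d) ≤ m i := by
    intro d
    induction d with
    | zero => intro i _; exact le_rfl
    | succ d ih => intro i h; exact (hm (i + d) h).trans (ih i (by omega))
  intro i j hij
  have hij' : (i : ℕ) ≤ j := hij
  have := key (j - i) i (by omega)
  rwa [Nat.add_sub_cancel' hij'] at this

/-- Good chains from `κ` to `ν` that lead from the weight `m` to the weight `l`. -/
def GA (n L : ℕ) (κ ν : ℕ → ℕ) (m l : ℕ → ℤ) : Set (ℕ → ℕ → ℕ) :=
  {t | IsChain n κ ν t ∧ Good n m t ∧ ∀ i < n, m i + wt L t i = l i}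

lemma GA_finite {n L : ℕ} {κ ν : ℕ → ℕ} (hL : ∀ k, L ≤ k → ν k = 0) (m l : ℕ → ℤ) :
    (GA n L κ ν m l).Finite :=
  (IsChain.finite hL).subset fun _ h => h.1

theorem mult_skew {n L : ℕ} {κ ν : ℕ → ℕ} (hL : ∀ k, L ≤ k → ν k = 0) (hL0 : 0 < L) {m l : ℕ → ℤ}
    (hm : ∀ i, i + 1 < n → m (i + 1) ≤ m i) (hl : ∀ i, i + 1 < n → l (i + 1) ≤ l i) :
    mult (skew n L κ ν) (res n m) (res n l) = (GA n L κ ν m l).ncard := by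
  classical
  rw [mult, show res n m + rho n = (fun i : Fin n => m i) + rho n from rfl,
    alt_mul_skew hL hL0 hm]
  simp only [AddMonoidAlgebra.coeff_sum, Finsupp.finsetSum_apply]
  have : ∀ t ∈ (chains n κ ν).filter (Good n m),
      (alt ((fun i : Fin n => m i) + wtv n L t + rho n)).coeff (res n l + rho n)
        = if t ∈ GA n L κ ν m l then 1 else 0 := by
    intro t ht
    rw [Finset.mem_filter, mem_chains hL] at ht
    have hd : Antitone ((fun i : Fin n => m i) + wtv n L t) :=
      antitone_res (m := fun i => m i + wt L t i) fun i hi => ht.1.dominant hL ht.2 hi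
    rw [coeff_alt (strictAnti_add_rho hd) (strictAnti_add_rho (antitone_res hl))]
    congr 1
    rw [add_left_inj]
    simp only [GA, Set.mem_ofPred_eq, ht.1, ht.2, true_and, eq_iff_iff]
    constructor
    · intro h i hi
      exact congrFun h ⟨i, hi⟩
    · intro h
      funext i
      exact h i i.2
  rw [Finset.sum_congr rfl this, Finset.sum_boole, Set.ncard_eq_toFinset_card _ (GA_finite hL m l)]
  congr 2
  ext t
  rw [Finset.mem_filter, Finset.mem_filter, mem_chains hL, Set.Finite.mem_toFinset]
  exact ⟨fun h => h.2, fun h => ⟨⟨h.1, h.2.1⟩, h⟩⟩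

lemma wt_eq_of_le {n L L' : ℕ} {κ ν : ℕ → ℕ} {t : ℕ → ℕ → ℕ} (h : IsChain n κ ν t)
    (hL : ∀ k, L ≤ k → ν k = 0) (hLL : L ≤ L') (i : ℕ) : wt L' t i = wt L t i := by
  rw [wt, ← Finset.sum_range_add_sum_Ico _ hLL, wt, Finset.sum_eq_zero (s := Finset.Ico L L'),
    add_zero]
  intro k hk
  rw [h.eq_zero hL (Finset.mem_Ico.1 hk).1, h.eq_zero hL (Finset.mem_Ico.1 hk).1, sub_self]

lemma GA_eq_of_le {n L L' : ℕ} {κ ν : ℕ → ℕ} (hL : ∀ k, L ≤ k → ν k = 0) (hLL : L ≤ L')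
    (m l : ℕ → ℤ) : GA n L' κ ν m l = GA n L κ ν m l := by
  ext t
  refine and_congr_right fun ht => and_congr_right fun _ => ?_
  simp only [wt_eq_of_le ht hL hLL]

lemma wt_nonneg {n L : ℕ} {κ ν : ℕ → ℕ} {t : ℕ → ℕ → ℕ} (h : IsChain n κ ν t) (i : ℕ) :
    0 ≤ wt L t i :=
  Finset.sum_nonneg fun k _ => by have := (h.2.2 i k).2; simp; omega

/-- Exchange the roles of steps and rows in a chain. -/
def tr (m : ℕ → ℕ) (t : ℕ → ℕ → ℕ) : ℕ → ℕ → ℕ := fun k i =>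
  m i + ∑ r ∈ Finset.range k, (t (i + 1) r - t i r)

section
variable {n L : ℕ} {κ ν m l : ℕ → ℕ} {t : ℕ → ℕ → ℕ}

lemma tr_cast (h : IsChain n κ ν t) (k i : ℕ) :
    ((tr m t k i : ℕ) : ℤ) = m i + ∑ r ∈ Finset.range k, ((t (i + 1) r : ℤ) - t i r) := by
  rw [tr]
  push_cast
  congr 1
  exact Finset.sum_congr rfl fun r _ => by rw [Nat.cast_sub (h.2.2 i r).2]

lemma tr_succ_sub (h : IsChain n κ ν t) (k i : ℕ) :
    ((tr m t (k + 1) i : ℕ) : ℤ) - tr m t k i = (t (i + 1) k : ℤ) - t i k := by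
  rw [tr_cast h, tr_cast h, Finset.sum_range_succ]; ring

lemma sum_tr (h : IsChain n κ ν t) (k j : ℕ) :
    ∑ r ∈ Finset.range j, (((tr m t (k + 1) r : ℕ) : ℤ) - tr m t k r) = (t j k : ℤ) - κ k := by
  simp only [tr_succ_sub h]
  rw [Finset.sum_range_sub (fun i => (t i k : ℤ)), h.1]

lemma tr_tr (h : IsChain n κ ν t) : tr κ (tr m t) = t := by
  funext i k
  rw [tr]
  have := sum_tr (m := m) h k i
  have h2 : ∑ r ∈ Finset.range i, (tr m t (k + 1) r - tr m t k r)
      = ∑ r ∈ Finset.range i, (t (r + 1) k - t r k) :=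
    Finset.sum_congr rfl fun r _ => by
      rw [tr, tr, Finset.sum_range_succ]; omega
  rw [h2]
  have h3 : ((∑ r ∈ Finset.range i, (t (r + 1) k - t r k) : ℕ) : ℤ) = (t i k : ℤ) - κ k := by
    push_cast
    rw [← h.1, ← Finset.sum_range_sub (fun i => (t i k : ℤ))]
    exact Finset.sum_congr rfl fun r _ => by rw [Nat.cast_sub (h.2.2 r k).2]
  omega

theorem tr_mem (hν : ∀ k, L ≤ k → ν k = 0) (hm : ∀ i, n ≤ i → m i = 0) (hl : ∀ i, n ≤ i → l i = 0)
    (ht : t ∈ GA n L κ ν (fun i => m i) (fun i => l i)) :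
    tr m t ∈ GA L n m l (fun i => κ i) (fun i => ν i) := by
  obtain ⟨h, hg, hw⟩ := ht
  have hconst : ∀ i, n ≤ i → ∀ r, t (i + 1) r = t i r := fun i hi r => by
    rw [h.2.1 i hi, h.2.1 (i + 1) (by omega)]
  refine ⟨⟨?_, ?_, ?_⟩, ?_, ?_⟩
  · funext i; simp [tr]
  · intro k hk
    funext i
    have h1 := tr_cast (m := m) h k i
    rcases lt_or_ge i n with hi | hi
    · have h2 := hw i hi
      rw [← wt_eq_of_le h hν hk, wt] at h2
      simp only at h2
      omega
    · rw [Finset.sum_eq_zero fun r _ => by rw [hconst i hi, sub_self], hm i hi] at h1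
      rw [hl i hi]
      exact_mod_cast h1
  · intro k i
    refine ⟨?_, ?_⟩
    · rcases lt_or_ge (i + 1) n with hi | hi
      · have := hg i k hi
        rw [defect] at this
        have e1 := tr_cast (m := m) h (k + 1) (i + 1)
        have e2 := tr_cast (m := m) h k i
        rw [show i + 1 + 1 = i + 2 by ring] at e1
        omega
      · have e1 := tr_cast (m := m) h (k + 1) (i + 1)
        rw [Finset.sum_eq_zero fun r _ => by rw [hconst _ hi, sub_self], hm _ hi] at e1
        push_cast at e1
        omega
    · rw [tr, tr, Finset.sum_range_succ]; omega
  · intro k i _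
    rw [defect, sum_tr h, show k + 2 = (k + 1) + 1 by ring, sum_tr h]
    have := (h.2.2 i k).1
    omega
  · intro k _
    have h1 := sum_tr (m := m) h k n
    rw [h.2.1 n le_rfl] at h1
    rw [wt]
    dsimp only
    omega

theorem ncard_GA_tr (hκ : ∀ k, L ≤ k → κ k = 0) (hν : ∀ k, L ≤ k → ν k = 0)
    (hm : ∀ i, n ≤ i → m i = 0) (hl : ∀ i, n ≤ i → l i = 0) :
    (GA n L κ ν (fun i => m i) (fun i => l i)).ncard
      = (GA L n m l (fun i => κ i) (fun i => ν i)).ncard := by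
  refine Set.ncard_congr (fun t _ => tr m t) (fun t ht => tr_mem hν hm hl ht) ?_ ?_
  · intro t t' ht ht' he
    rw [← tr_tr (m := m) ht.1, he, tr_tr ht'.1]
  · intro t ht
    exact ⟨tr κ t, tr_mem hl hκ hν ht, tr_tr ht.1⟩

end

lemma ncard_rows (K : ℕ) (a b : ℕ → ℕ) :
    {p : ℕ × ℕ | p.1 < K ∧ a p.1 ≤ p.2 ∧ p.2 < b p.1}.ncard
      = ∑ k ∈ Finset.range K, (b k - a k) := by
  have : {p : ℕ × ℕ | p.1 < K ∧ a p.1 ≤ p.2 ∧ p.2 < b p.1}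
      = ((Finset.range K).sigma fun k => Finset.Ico (a k) (b k)).map
          (Equiv.sigmaEquivProd ℕ ℕ).toEmbedding := by
    ext ⟨x, y⟩
    simp
  rw [this, Set.ncard_coe_finset, Finset.card_map, Finset.card_sigma]
  simp

lemma IsChain.antitone {n : ℕ} {κ ν : ℕ → ℕ} {t : ℕ → ℕ → ℕ} (h : IsChain n κ ν t) (i : ℕ) :
    Antitone (t i) :=
  antitone_nat_of_succ_le fun k => (h.2.2 i (k + 1)).2.trans (h.2.2 i k).1

section
variable {n L : ℕ} {κ ν δ : ℕ → ℕ} {t T : ℕ → ℕ → ℕ}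

lemma entry_eq_iff (h0 : t 0 = κ) (hmono : ∀ i j k, i ≤ j → t i k ≤ t j k)
    (htop : ∀ i k, t i k ≤ ν k) (hT : ∀ k j, T k j ≠ 0 ↔ InSkew ν κ k j)
    (hrel : ∀ k j i, InSkew ν κ k j → (T k j ≤ i ↔ j < t i k)) (k j r : ℕ) :
    T k j = r + 1 ↔ t r k ≤ j ∧ j < t (r + 1) k := by
  constructor
  · intro h
    have hs : InSkew ν κ k j := (hT k j).1 (by omega)
    have h1 := hrel k j r hs
    have h2 := hrel k j (r + 1) hs
    omega
  · rintro ⟨h1, h2⟩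
    have hs : InSkew ν κ k j :=
      ⟨(h0 ▸ hmono 0 r k (Nat.zero_le _)).trans h1, h2.trans_le (htop _ _)⟩
    have h1 := hrel k j r hs
    have h2 := hrel k j (r + 1) hs
    omega

lemma ncard_entry (hL : ∀ k, L ≤ k → ν k = 0) (htop : ∀ i k, t i k ≤ ν k)
    (hkey : ∀ k j r, T k j = r + 1 ↔ t r k ≤ j ∧ j < t (r + 1) k) (r : ℕ) :
    {p : ℕ × ℕ | T p.1 p.2 = r + 1}.ncard = ∑ k ∈ Finset.range L, (t (r + 1) k - t r k) := by
  rw [← ncard_rows]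
  congr 1
  ext p
  simp only [Set.mem_ofPred_eq, hkey]
  refine ⟨fun h => ⟨?_, h⟩, fun h => h.2⟩
  by_contra hp
  have := htop (r + 1) p.1
  rw [hL _ (not_lt.1 hp)] at this
  omega

lemma cast_sum_sub (hmono : ∀ i j k, i ≤ j → t i k ≤ t j k) (r K : ℕ) :
    ((∑ k ∈ Finset.range K, (t (r + 1) k - t r k) : ℕ) : ℤ)
      = ∑ k ∈ Finset.range K, ((t (r + 1) k : ℤ) - t r k) := by
  push_cast
  exact Finset.sum_congr rfl fun k _ => by rw [Nat.cast_sub (hmono _ _ _ (Nat.le_succ r))]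

theorem isLRTableau_iff (hκ : Antitone κ) (hν : Antitone ν) (hL : ∀ k, L ≤ k → ν k = 0)
    (hδ : ∀ i, n ≤ i → δ i = 0)
    (h0 : t 0 = κ) (hmono : ∀ i j k, i ≤ j → t i k ≤ t j k)
    (hn : ∀ i, n ≤ i → t i = ν) (hT : ∀ k j, T k j ≠ 0 ↔ InSkew ν κ k j)
    (hrel : ∀ k j i, InSkew ν κ k j → (T k j ≤ i ↔ j < t i k)) :
    IsLRTableau ν κ δ T ↔ t ∈ GA n L κ ν (fun _ => 0) (fun i => δ i) := by
  have htop : ∀ i k, t i k ≤ ν k := fun i k => by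
    have := hmono i (max i n) k (le_max_left _ _)
    rwa [hn _ (le_max_right _ _)] at this
  have hkey := entry_eq_iff h0 hmono htop hT hrel
  have hfin : ∀ r, {p : ℕ × ℕ | T p.1 p.2 = r + 1}.Finite := fun r => by
    refine ((Finset.range L ×ˢ Finset.range (ν 0)).finite_toSet).subset fun p hp => ?_
    have := (hkey _ _ _).1 hp
    have h1 := htop (r + 1) p.1
    have h2 := hν (Nat.zero_le p.1)
    have h3 : p.1 < L := by
      by_contra h
      rw [hL _ (not_lt.1 h)] at h1
      omega
    simp only [Finset.coe_product, Set.mem_prod, Finset.coe_range, Set.mem_Iio]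
    omega
  have hcount := ncard_entry hL htop hkey
  constructor
  · rintro ⟨-, -, -, hcol, hcont, hlat⟩
    refine ⟨⟨h0, hn, fun i k => ⟨?_, hmono _ _ _ (Nat.le_succ i)⟩⟩, ?_, ?_⟩
    · by_contra! hlt
      have h1 : κ k ≤ t i k := h0 ▸ hmono 0 i k (Nat.zero_le i)
      have h2 := hκ (Nat.le_succ k)
      have h3 := hν (Nat.le_succ k)
      have h4 := htop (i + 1) (k + 1)
      simp only [Nat.succ_eq_add_one] at h2 h3
      have s1 : InSkew ν κ k (t i k) := ⟨h1, by omega⟩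
      have s2 : InSkew ν κ (k + 1) (t i k) := ⟨by omega, by omega⟩
      have h5 := hcol _ _ _ s1 s2 (Nat.lt_succ_self k)
      have h6 := hrel _ _ (i + 1) s2
      have h7 := hrel _ _ i s1
      omega
    · intro r k _
      rw [defect, ← cast_sum_sub hmono, show r + 2 = (r + 1) + 1 by ring, ← cast_sum_sub hmono,
        ← ncard_rows, ← ncard_rows]
      have h := hlat k (t (r + 1) k) r
      have e1 : {p : ℕ × ℕ | (p.1 < k ∨ p.1 = k ∧ t (r + 1) k ≤ p.2) ∧ T p.1 p.2 = r + 2}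
          = {p : ℕ × ℕ | p.1 < k + 1 ∧ t (r + 1) p.1 ≤ p.2 ∧ p.2 < t (r + 1 + 1) p.1} := by
        ext p
        simp only [Set.mem_ofPred_eq, hkey p.1 p.2 (r + 1), show r + 2 = (r + 1) + 1 by ring]
        constructor
        · rintro ⟨h | h, h'⟩
          · exact ⟨by omega, h'⟩
          · exact ⟨by omega, h'⟩
        · rintro ⟨h, h'⟩
          refine ⟨?_, h'⟩
          rcases Nat.lt_succ_iff_lt_or_eq.1 h with h | h
          · exact Or.inl h
          · exact Or.inr ⟨h, h ▸ h'.1⟩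
      have e2 : {p : ℕ × ℕ | (p.1 < k ∨ p.1 = k ∧ t (r + 1) k ≤ p.2) ∧ T p.1 p.2 = r + 1}
          = {p : ℕ × ℕ | p.1 < k ∧ t r p.1 ≤ p.2 ∧ p.2 < t (r + 1) p.1} := by
        ext p
        simp only [Set.mem_ofPred_eq, hkey p.1 p.2 r]
        constructor
        · rintro ⟨h | ⟨h, h2⟩, h'⟩
          · exact ⟨h, h'⟩
          · rw [h] at h'
            omega
        · rintro ⟨h, h'⟩
          exact ⟨Or.inl h, h'⟩
      rw [e1, e2] at h
      omega
    · intro r _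
      rw [zero_add, wt, ← cast_sum_sub hmono, ← hcount, hcont]
  · rintro ⟨hc, hg, hw⟩
    refine ⟨fun k => h0 ▸ htop 0 k, hT, ?_, ?_, ?_, ?_⟩
    · intro i j k h1 h2 hjk
      have e1 := hrel _ _ (T i k) h1
      have e2 := hrel _ _ (T i k) h2
      omega
    · intro i k j h1 h2 hik
      have hne := (hT _ _).2 h2
      obtain ⟨c, hc'⟩ : ∃ c, T k j = c + 1 := Nat.exists_eq_succ_of_ne_zero hne
      have e1 := (hrel _ _ (c + 1) h2).1 hc'.le
      have e2 := hrel _ _ c h1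
      have e3 := (hc.2.2 c (k - 1)).1
      rw [Nat.sub_add_cancel (by omega)] at e3
      have e4 := hc.antitone c (show i ≤ k - 1 by omega)
      omega
    · intro r
      rw [hcount]
      rcases lt_or_ge r n with hr | hr
      · have := hw r hr
        rw [zero_add, wt, ← cast_sum_sub hmono] at this
        exact Int.ofNat_inj.1 this
      · rw [hδ r hr, hn r hr, hn (r + 1) (by omega)]
        simp
    · intro i j r
      calc _ ≤ {p : ℕ × ℕ | p.1 < i + 1 ∧ t (r + 1) p.1 ≤ p.2 ∧ p.2 < t (r + 1 + 1) p.1}.ncard := by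
            refine Set.ncard_le_ncard (fun p hp => ?_) ((hfin (r + 1)).subset fun p hp => ?_)
            · have := (hkey _ _ _).1 hp.2
              refine ⟨?_, this⟩
              rcases hp.1 with h | h <;> omega
            · exact (hkey _ _ _).2 hp.2
        _ ≤ {p : ℕ × ℕ | p.1 < i ∧ t r p.1 ≤ p.2 ∧ p.2 < t (r + 1) p.1}.ncard := by
            rw [ncard_rows, ncard_rows]
            rcases lt_or_ge (r + 1) n with hr | hr
            · have := hg r i hr
              rw [defect, ← cast_sum_sub hmono, show r + 2 = (r + 1) + 1 by ring,
                ← cast_sum_sub hmono] at this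
              omega
            · rw [hn _ hr, hn (r + 1 + 1) (by omega)]
              simp
        _ ≤ _ := by
            refine Set.ncard_le_ncard (fun p hp => ?_) ((hfin r).subset fun p hp => hp.2)
            exact ⟨Or.inl hp.1, (hkey _ _ _).2 hp.2⟩

open Classical in
/-- The tableau recording at which step a box is added in a chain. -/
def toTab (κ ν : ℕ → ℕ) (t : ℕ → ℕ → ℕ) : ℕ → ℕ → ℕ := fun k j =>
  if InSkew ν κ k j then sInf {i | j < t i k} else 0

open Classical in
def ofTab (κ ν : ℕ → ℕ) (T : ℕ → ℕ → ℕ) : ℕ → ℕ → ℕ := fun i k =>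
  κ k + ((Finset.Ico (κ k) (ν k)).filter fun j => T k j ≤ i).card

lemma toTab_rel (hmono : ∀ i j k, i ≤ j → t i k ≤ t j k) (hn : ∀ i, n ≤ i → t i = ν) (k j i : ℕ)
    (hs : InSkew ν κ k j) : toTab κ ν t k j ≤ i ↔ j < t i k := by
  rw [toTab, if_pos hs]
  constructor
  · intro h
    have hne : {i | j < t i k}.Nonempty := ⟨n, by
      rw [Set.mem_ofPred_eq, hn n le_rfl]; exact hs.2⟩
    have := Nat.sInf_mem hne
    exact lt_of_lt_of_le this (hmono _ _ _ h)
  · intro h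
    exact Nat.sInf_le h

lemma toTab_ne_zero (h0 : t 0 = κ) (hmono : ∀ i j k, i ≤ j → t i k ≤ t j k)
    (hn : ∀ i, n ≤ i → t i = ν) (k j : ℕ) : toTab κ ν t k j ≠ 0 ↔ InSkew ν κ k j := by
  constructor
  · intro h
    by_contra hs
    exact h (by rw [toTab, if_neg hs])
  · intro hs h
    have := (toTab_rel hmono hn k j 0 hs).1 h.le
    rw [h0] at this
    exact absurd hs.1 (not_le.2 this)

lemma ofTab_rel (hrow : ∀ i j k, InSkew ν κ i j → InSkew ν κ i k → j ≤ k → T i j ≤ T i k)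
    (k j i : ℕ) (hs : InSkew ν κ k j) : T k j ≤ i ↔ j < ofTab κ ν T i k := by
  have h1 := hs.1
  have h2 := hs.2
  rw [ofTab]
  constructor
  · intro h
    have hsub : Finset.Ico (κ k) (j + 1) ⊆ (Finset.Ico (κ k) (ν k)).filter fun j => T k j ≤ i := by
      intro x hx
      rw [Finset.mem_Ico] at hx
      rw [Finset.mem_filter, Finset.mem_Ico]
      refine ⟨⟨hx.1, by omega⟩, (hrow k x j ⟨hx.1, by omega⟩ hs (by omega)).trans h⟩
    have := Finset.card_le_card hsub
    rw [Nat.card_Ico] at this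
    omega
  · intro h
    by_contra hlt
    have hsub : ((Finset.Ico (κ k) (ν k)).filter fun j => T k j ≤ i) ⊆ Finset.Ico (κ k) j := by
      intro x hx
      rw [Finset.mem_filter, Finset.mem_Ico] at hx
      rw [Finset.mem_Ico]
      refine ⟨hx.1.1, ?_⟩
      by_contra hxj
      exact hlt ((hrow k j x hs hx.1 (by omega)).trans hx.2)
    have := Finset.card_le_card hsub
    rw [Nat.card_Ico] at this
    omega

lemma ofTab_mono (i j k : ℕ) (h : i ≤ j) : ofTab κ ν T i k ≤ ofTab κ ν T j k := by
  rw [ofTab, ofTab]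
  gcongr

theorem lrCoeff_eq_skew (hκ : Antitone κ) (hν : Antitone ν) (hL : ∀ k, L ≤ k → ν k = 0)
    (hδ : ∀ i, n ≤ i → δ i = 0) :
    lrCoeff ν κ δ = (GA n L κ ν (fun _ => 0) (fun i => δ i)).ncard := by
  classical
  rw [lrCoeff]
  symm
  have hch : ∀ t, IsChain n κ ν t → ∀ i j k, i ≤ j → t i k ≤ t j k := fun t h i j k hij =>
    monotone_nat_of_le_succ (f := fun i => t i k) (fun i => (h.2.2 i k).2) hij
  refine Set.ncard_congr (fun t _ => toTab κ ν t) ?_ ?_ ?_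
  · intro t ht
    have hm := hch t ht.1
    exact (isLRTableau_iff hκ hν hL hδ ht.1.1 hm ht.1.2.1
      (toTab_ne_zero ht.1.1 hm ht.1.2.1) (toTab_rel hm ht.1.2.1)).2 ht
  · intro t t' ht ht' he
    have hm := hch t ht.1
    have hm' := hch t' ht'.1
    have key : ∀ s s', IsChain n κ ν s → IsChain n κ ν s' → toTab κ ν s = toTab κ ν s' →
        ∀ i k, s i k ≤ s' i k := by
      intro s s' h h' he i k
      by_contra! hlt
      have hs : InSkew ν κ k (s' i k) :=
        ⟨by rw [← h'.1]; exact hch s' h' 0 i k (Nat.zero_le _), by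
          have := hch s h i (max i n) k (le_max_left _ _)
          rw [h.2.1 _ (le_max_right _ _)] at this
          omega⟩
      have e1 := toTab_rel (hch s h) h.2.1 k _ i hs
      have e2 := toTab_rel (hch s' h') h'.2.1 k _ i hs
      rw [he] at e1
      omega
    funext i k
    exact le_antisymm (key t t' ht.1 ht'.1 he i k) (key t' t ht'.1 ht.1 he.symm i k)
  · intro T hT
    obtain ⟨hle, hne, hrow, -, hcont, -⟩ := id hT
    have hbound : ∀ k j, T k j ≤ n := by
      intro k j
      by_contra! hlt
      obtain ⟨r, hr⟩ : ∃ r, T k j = r + 1 := Nat.exists_eq_succ_of_ne_zero (by omega)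
      have h1 := hcont r
      have hf : {p : ℕ × ℕ | T p.1 p.2 = r + 1}.Finite := by
        refine ((Finset.range L ×ˢ Finset.range (ν 0)).finite_toSet).subset fun p hp => ?_
        rw [Set.mem_ofPred_eq] at hp
        have h2 := ((hne p.1 p.2).1 (by omega)).2
        have h3 := hν (Nat.zero_le p.1)
        have h4 : p.1 < L := by
          by_contra h
          rw [hL _ (not_lt.1 h)] at h2
          omega
        simp only [Finset.coe_product, Set.mem_prod, Finset.coe_range, Set.mem_Iio]
        omega
      rw [hδ r (by omega), Set.ncard_eq_zero hf] at h1
      exact Set.notMem_empty (k, j) (h1 ▸ hr)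
    have h0 : ofTab κ ν T 0 = κ := by
      funext k
      rw [ofTab, Finset.card_eq_zero.2, add_zero]
      rw [Finset.filter_eq_empty_iff]
      intro j hj
      rw [Finset.mem_Ico] at hj
      have := (hne k j).2 hj
      omega
    have hn : ∀ i, n ≤ i → ofTab κ ν T i = ν := by
      intro i hi
      funext k
      rw [ofTab, Finset.filter_true_of_mem fun j _ => (hbound k j).trans hi, Nat.card_Ico]
      have := hle k
      omega
    have hg := (isLRTableau_iff hκ hν hL hδ h0 ofTab_mono hn hne (ofTab_rel hrow)).1 hT
    refine ⟨ofTab κ ν T, hg, ?_⟩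
    funext k j
    by_cases hs : InSkew ν κ k j
    · refine le_antisymm ?_ ?_
      · rw [toTab_rel ofTab_mono hn _ _ _ hs, ← ofTab_rel hrow _ _ _ hs]
      · rw [ofTab_rel hrow _ _ _ hs, ← toTab_rel ofTab_mono hn _ _ _ hs]
    · rw [toTab, if_neg hs]
      by_contra h
      exact hs ((hne k j).1 (Ne.symm h))

end

/-- The second description of Littlewood-Richardson coefficients by good chains. -/
theorem lrCoeff_eq {n L : ℕ} {l m ν : ℕ → ℕ} (hl : Antitone l) (hm : Antitone m)
    (hl' : ∀ i, n ≤ i → l i = 0) (hm' : ∀ i, n ≤ i → m i = 0) (hL : ∀ k, L ≤ k → ν k = 0) :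
    lrCoeff l m ν = (GA n L (fun _ => 0) ν (fun i => m i) (fun i => l i)).ncard := by
  rw [lrCoeff_eq_skew hm hl hl' hL, ncard_GA_tr (fun _ _ => rfl) hL hm' hl']
  rfl

section
variable {n L : ℕ} {ν : ℕ → ℕ}

lemma IsChain.zero_of_le {t : ℕ → ℕ → ℕ} (h : IsChain n (fun _ => 0) ν t) :
    ∀ i k, i ≤ k → t i k = 0 := by
  intro i
  induction i with
  | zero => intro k _; rw [h.1]
  | succ i ih =>
    intro k hk
    obtain ⟨k, rfl⟩ : ∃ k', k = k' + 1 := ⟨k - 1, by omega⟩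
    have := (h.2.2 i k).1
    rw [ih k (by omega)] at this
    omega

lemma IsChain.top_zero {t : ℕ → ℕ → ℕ} (h : IsChain n (fun _ => 0) ν t) (k : ℕ) (hk : n ≤ k) :
    ν k = 0 := by
  rw [← h.2.1 n le_rfl]; exact h.zero_of_le n k hk

/-- The chain adding one full row at each step. -/
def rowChain (ν : ℕ → ℕ) : ℕ → ℕ → ℕ := fun i k => if k < i then ν k else 0

lemma isChain_rowChain (hν : Antitone ν) (hn : ∀ k, n ≤ k → ν k = 0) :
    IsChain n (fun _ => 0) ν (rowChain ν) := by
  refine ⟨by funext k; simp [rowChain], fun i hi => ?_, fun i k => ⟨?_, ?_⟩⟩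
  · funext k
    rw [rowChain]
    split_ifs with h
    · rfl
    · exact (hn k (by omega)).symm
  · rw [rowChain, rowChain]
    have := hν (Nat.le_succ k)
    simp only [Nat.succ_eq_add_one] at this
    split_ifs <;> omega
  · rw [rowChain, rowChain]
    split_ifs <;> omega

lemma rowChain_succ_sub (i k : ℕ) :
    ((rowChain ν (i + 1) k : ℕ) : ℤ) - rowChain ν i k = if k = i then (ν k : ℤ) else 0 := by
  rw [rowChain, rowChain]
  split_ifs <;> omega

lemma good_rowChain (hν : Antitone ν) : Good n (fun _ => 0) (rowChain ν) := by
  intro i k _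
  rw [defect]
  simp only [rowChain_succ_sub, show i + 2 = (i + 1) + 1 by ring, Finset.sum_ite_eq',
    Finset.mem_range]
  have := hν (Nat.le_succ i)
  simp only [Nat.succ_eq_add_one] at this
  split_ifs <;> omega

lemma eq_rowChain {t : ℕ → ℕ → ℕ} (h : IsChain n (fun _ => 0) ν t)
    (hg : Good n (fun _ => 0) t) : t = rowChain ν := by
  have key : ∀ i, i < n → ∑ r ∈ Finset.range i, ((t (i + 1) r : ℤ) - t i r) = 0 := by
    intro i
    induction i with
    | zero => simp
    | succ i ih =>
      intro hi
      have h1 := hg i i hi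
      rw [defect, ih (by omega)] at h1
      refine le_antisymm ?_ (Finset.sum_nonneg fun r _ => ?_)
      · rw [show i + 1 + 1 = i + 2 by ring]; linarith
      · have := (h.2.2 (i + 1) r).2
        omega
  have key2 : ∀ i k, k < i → t (i + 1) k = t i k := by
    intro i k hk
    rcases lt_or_ge i n with hi | hi
    · have := (Finset.sum_eq_zero_iff_of_nonneg fun r _ => by
        have := (h.2.2 i r).2
        omega).1 (key i hi) k (Finset.mem_range.2 hk)
      omega
    · rw [h.2.1 i hi, h.2.1 (i + 1) (by omega)]
  have key3 : ∀ d k, t (k + 1 + d) k = t (k + 1) k := by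
    intro d k
    induction d with
    | zero => rfl
    | succ d ih => rw [← ih, ← key2 (k + 1 + d) k (by omega)]; rfl
  funext i k
  rw [rowChain]
  split_ifs with hk
  · have e1 := key3 (i - (k + 1)) k
    have e2 := key3 (n + i) k
    rw [show k + 1 + (i - (k + 1)) = i by omega] at e1
    rw [e1, ← e2, h.2.1 _ (by omega)]
  · exact h.zero_of_le i k (by omega)

theorem alt_rho_mul_skew (hν : Antitone ν) (hn : ∀ k, n ≤ k → ν k = 0)
    (hL : ∀ k, L ≤ k → ν k = 0) (hL0 : 0 < L) :
    alt (rho n) * skew n L (fun _ => 0) ν = alt (res n (fun i => ν i) + rho n) := by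
  classical
  have h := alt_mul_skew (n := n) (κ := fun _ => 0) hL hL0 (m := fun _ => 0) fun _ _ => le_rfl
  have e : (fun _ : Fin n => (0 : ℤ)) + rho n = rho n := zero_add _
  rw [e] at h
  rw [h, Finset.sum_eq_single (rowChain ν)]
  · congr 1
    funext i
    simp only [Pi.add_apply, zero_add, wtv, wt, rowChain_succ_sub, res, Finset.sum_ite_eq',
      Finset.mem_range]
    split_ifs with hi
    · rfl
    · rw [hL i (by omega)]; rfl
  · intro t ht hne
    rw [Finset.mem_filter, mem_chains hL] at ht
    exact absurd (eq_rowChain ht.1 ht.2) hne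
  · intro hne
    rw [Finset.mem_filter, mem_chains hL] at hne
    exact absurd ⟨isChain_rowChain hν hn, good_rowChain hν⟩ hne

end

section
variable {n : ℕ}

/-- Multiplicities as extended non-negative reals. -/
def E (F : Lau n) (m l : Fin n → ℤ) : ENNReal := ((mult F m l).toNat : ENNReal)

/-- Symmetric Laurent polynomials with nonnegative multiplicities. -/
def Pos (F : Lau n) : Prop := Symm F ∧ ∀ m l : Wt n, 0 ≤ mult F m l

lemma cast_toNat_sum {ι : Type*} {S : Finset ι} {x : ι → ℤ} (hx : ∀ i ∈ S, 0 ≤ x i) :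
    (((∑ i ∈ S, x i).toNat : ℕ) : ENNReal) = ∑ i ∈ S, ((x i).toNat : ENNReal) := by
  rw [← Nat.cast_sum]
  congr 1
  zify
  rw [Int.toNat_of_nonneg (Finset.sum_nonneg hx)]
  exact Finset.sum_congr rfl fun i hi => (Int.toNat_of_nonneg (hx i hi)).symm

lemma E_mul {F G : Lau n} (hF : Pos F) (hG : Pos G) (m l : Wt n) :
    E (F * G) m l = ∑' k : Wt n, E F m k * E G k l := by
  have hS := finite_mult F m
  rw [E, mult_mul hF.1 G m l hS.toFinset fun k hk => by simpa using hk,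
    cast_toNat_sum fun k _ => mul_nonneg (hF.2 m k) (hG.2 k l),
    tsum_eq_sum (s := hS.toFinset)]
  · refine Finset.sum_congr rfl fun k _ => ?_
    rw [Int.toNat_mul (hF.2 m k) (hG.2 k l), Nat.cast_mul, E, E]
  · intro k hk
    have : mult F m k = 0 := by simpa using hk
    simp [E, this]

lemma Pos.mul {F G : Lau n} (hF : Pos F) (hG : Pos G) : Pos (F * G) := by
  refine ⟨hF.1.mul hG.1, fun m l => ?_⟩
  have hS := finite_mult F m
  rw [mult_mul hF.1 G m l hS.toFinset fun k hk => by simpa using hk]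
  exact Finset.sum_nonneg fun k _ => mul_nonneg (hF.2 m k) (hG.2 k l)

lemma Pos.inv {F : Lau n} (hF : Pos F) : Pos (inv F) :=
  ⟨hF.1.inv, fun m l => by rw [mult_inv hF.1]; exact hF.2 l m⟩

lemma E_inv {F : Lau n} (hF : Pos F) (m l : Fin n → ℤ) : E (inv F) m l = E F l m := by
  rw [E, E, mult_inv hF.1]

lemma E_star {F : Lau n} (hF : Pos F) (m l : Fin n → ℤ) : E F (star m) (star l) = E F l m := by
  rw [E, E, mult_star hF.1]

lemma antitone_zero : Antitone (0 : Fin n → ℤ) := fun _ _ _ => le_rfl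

lemma E_expand {F : Lau n} (hF : Pos F) (s : Wt n → Lau n)
    (hs : ∀ k : Wt n, mult F 0 k ≠ 0 → alt (rho n) * s k = alt (k.1 + rho n) ∧ Pos (s k))
    (m l : Wt n) : E F m l = ∑' k : Wt n, E F 0 k * E (s k) m l := by
  have hS := finite_mult F 0
  have hp : ∀ k : Wt n, 0 ≤ mult F 0 k := hF.2 ⟨0, antitone_zero⟩
  have hk : ∀ k ∈ hS.toFinset, 0 ≤ mult (s k) m l := fun k hk =>
    (hs k (by simpa using hk)).2.2 m l
  rw [E, mult_expand hF.1 s (fun k hk => (hs k hk).1) m l hS.toFinset fun k hk => by simpa using hk,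
    cast_toNat_sum fun k h => mul_nonneg (hp k) (hk k h), tsum_eq_sum (s := hS.toFinset)]
  · refine Finset.sum_congr rfl fun k h => ?_
    rw [Int.toNat_mul (hp k) (hk k h), Nat.cast_mul, E, E]
  · intro k hk
    have : mult F 0 k = 0 := by simpa using hk
    simp [E, this]

/-- Extension of a weight by zero. -/
def ext (a : Fin n → ℤ) : ℕ → ℤ := fun i => if h : i < n then a ⟨i, h⟩ else 0

lemma res_ext (a : Fin n → ℤ) : res n (ext a) = a := by
  funext i; simp [res, ext]

lemma ext_succ_le {a : Fin n → ℤ} (ha : Antitone a) (i : ℕ) (hi : i + 1 < n) :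
    ext a (i + 1) ≤ ext a i := by
  simp only [ext, hi, dif_pos, show i < n by omega]
  exact ha (Fin.le_def.2 (Nat.le_succ i))

lemma pos_skew {L : ℕ} {κ ν : ℕ → ℕ} (hL : ∀ k, L ≤ k → ν k = 0) (hL0 : 0 < L) :
    Pos (skew n L κ ν) := by
  refine ⟨symm_skew hL hL0, fun m l => ?_⟩
  rw [← res_ext m.1, ← res_ext l.1, mult_skew hL hL0 (ext_succ_le m.2) (ext_succ_le l.2)]
  exact Nat.cast_nonneg _

lemma E_skew {L : ℕ} {κ ν : ℕ → ℕ} (hL : ∀ k, L ≤ k → ν k = 0) (hL0 : 0 < L) {m l : ℕ → ℤ}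
    (hm : ∀ i, i + 1 < n → m (i + 1) ≤ m i) (hl : ∀ i, i + 1 < n → l (i + 1) ≤ l i) :
    E (skew n L κ ν) (res n m) (res n l) = ((GA n L κ ν m l).ncard : ENNReal) := by
  rw [E, mult_skew hL hL0 hm hl, Int.toNat_natCast]

end

lemma cast_ncard_eq_tsum {α : Type*} {S : Set α} (hS : S.Finite) :
    (S.ncard : ENNReal) = ∑' _ : S, 1 := by
  rw [ENNReal.tsum_set_one, ← hS.cast_ncard_eq]; rfl

def rest (N : ℕ) (t : ℕ → ℕ → ℕ) : ℕ → ℕ → ℕ := fun i => t (i + N)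

def upTo (N : ℕ) (t : ℕ → ℕ → ℕ) : ℕ → ℕ → ℕ := fun i => t (min i N)

def glue (N : ℕ) (t t' : ℕ → ℕ → ℕ) : ℕ → ℕ → ℕ := fun i => if i < N then t i else t' (i - N)

section
variable {N M L : ℕ} {κ γ ν : ℕ → ℕ} {m l : ℕ → ℤ} {t t' : ℕ → ℕ → ℕ}

lemma glue_lt {i : ℕ} (h : i < N) : glue N t t' i = t i := by simp [glue, h]

lemma glue_ge (i : ℕ) : glue N t t' (i + N) = t' i := by simp [glue]

lemma glue_le (h : IsChain N κ γ t) (h' : IsChain M γ ν t') {i : ℕ} (hi : i ≤ N) :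
    glue N t t' i = t i := by
  rcases hi.lt_or_eq with hi | rfl
  · exact glue_lt hi
  · rw [h.2.1 _ le_rfl, ← h'.1]
    simpa using glue_ge (N := i) (t := t) (t' := t') 0

lemma wt_congr {s s' : ℕ → ℕ → ℕ} {i j : ℕ} (h1 : s i = s' j) (h2 : s (i + 1) = s' (j + 1)) :
    wt L s i = wt L s' j := by
  rw [wt, wt, h1, h2]

lemma wt_glue_lt (h : IsChain N κ γ t) (h' : IsChain M γ ν t') {i : ℕ} (hi : i < N) :
    wt L (glue N t t') i = wt L t i :=
  wt_congr (glue_le h h' hi.le) (glue_le h h' hi)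

lemma wt_glue_ge (i : ℕ) : wt L (glue N t t') (i + N) = wt L t' i :=
  wt_congr (glue_ge i) (by
    rw [← glue_ge (N := N) (t := t) (t' := t') (i + 1)]; congr 1; omega)

lemma partial_le_wt (h : IsChain N κ ν t) (hν : ∀ k, L ≤ k → ν k = 0) (i k : ℕ) :
    ∑ r ∈ Finset.range k, ((t (i + 1) r : ℤ) - t i r) ≤ wt L t i := by
  rw [← wt_eq_of_le h hν (le_max_left L k), wt]
  refine Finset.sum_le_sum_of_subset_of_nonneg (by gcongr; exact le_max_right _ _) fun r _ _ => ?_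
  have := (h.2.2 i r).2
  omega

lemma glue_mem (hj : ∀ i, i + 1 = N → l (i + 1) ≤ m i) (hν : ∀ k, L ≤ k → ν k = 0)
    (ht : t ∈ GA N L κ γ m l)
    (ht' : t' ∈ GA M L γ ν (fun i => m (i + N)) (fun i => l (i + N))) :
    glue N t t' ∈ GA (N + M) L κ ν m l := by
  obtain ⟨h, hg, hw⟩ := ht
  obtain ⟨h', hg', hw'⟩ := ht'
  have hge : ∀ i, N ≤ i → glue N t t' i = t' (i - N) := fun i hi => by
    simp [glue, not_lt.2 hi]
  refine ⟨⟨?_, ?_, ?_⟩, ?_, ?_⟩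
  · rw [glue_le h h' (Nat.zero_le N), h.1]
  · intro i hi
    rw [hge i (by omega), h'.2.1 _ (by omega)]
  · intro i k
    rcases lt_or_ge i N with hi | hi
    · rw [glue_le h h' hi.le, glue_le h h' hi]
      exact h.2.2 i k
    · rw [hge i hi, hge (i + 1) (by omega), show i + 1 - N = (i - N) + 1 by omega]
      exact h'.2.2 (i - N) k
  · intro i k hi
    rcases lt_trichotomy (i + 1) N with h1 | h1 | h1
    · have := hg i k h1
      rw [defect] at this ⊢
      rwa [glue_le h h' h1.le, glue_le h h' (by omega : i ≤ N), glue_le h h' (by omega : i + 2 ≤ N)]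
    · rw [defect, glue_le h h' h1.le, glue_le h h' (by omega : i ≤ N), hge (i + 2) (by omega),
        h.2.1 _ h1.ge, show i + 2 - N = 0 + 1 by omega, ← h'.1]
      have e1 := partial_le_wt h' hν 0 (k + 1)
      have e2 := hw' 0 (by omega)
      have e3 := hj i h1
      have e4 : (0 : ℤ) ≤ ∑ r ∈ Finset.range k, ((t' 0 r : ℤ) - t i r) :=
        Finset.sum_nonneg fun r _ => by
          rw [h'.1, ← h.2.1 _ h1.ge]
          have := (h.2.2 i r).2
          omega
      simp only [zero_add] at e2 e1
      rw [h1] at e3 ⊢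
      rw [zero_add]
      linarith
    · have := hg' (i - N) k (by omega)
      rw [defect] at this ⊢
      rw [hge i (by omega), hge (i + 1) (by omega), hge (i + 2) (by omega),
        show i + 1 - N = i - N + 1 by omega, show i + 2 - N = i - N + 2 by omega]
      simp only [show i - N + N = i by omega, show i - N + 1 + N = i + 1 by omega] at this
      exact this
  · intro i hi
    rcases lt_or_ge i N with h1 | h1
    · rw [wt_glue_lt h h' h1]; exact hw i h1
    · obtain ⟨j, rfl⟩ : ∃ j, i = j + N := ⟨i - N, by omega⟩
      rw [wt_glue_ge]; exact hw' j (by omega)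

lemma upTo_mem (ht : t ∈ GA (N + M) L κ ν m l) : upTo N t ∈ GA N L κ (t N) m l := by
  obtain ⟨h, hg, hw⟩ := ht
  have e : ∀ i, i ≤ N → upTo N t i = t i := fun i hi => by rw [upTo, min_eq_left hi]
  refine ⟨⟨by rw [e 0 (Nat.zero_le _), h.1], fun i hi => by rw [upTo, min_eq_right hi],
    fun i k => ?_⟩, ?_, ?_⟩
  · rcases lt_or_ge i N with hi | hi
    · rw [e i hi.le, e (i + 1) hi]; exact h.2.2 i k
    · simp only [upTo, min_eq_right hi, min_eq_right (show N ≤ i + 1 by omega)]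
      exact ⟨h.antitone N (Nat.le_succ k), le_rfl⟩
  · intro i k hi
    have := hg i k (by omega)
    rw [defect] at this ⊢
    rwa [e i (by omega), e (i + 1) (by omega), e (i + 2) (by omega)]
  · intro i hi
    rw [wt_congr (e i hi.le) (e (i + 1) hi)]
    exact hw i (by omega)

lemma rest_mem (ht : t ∈ GA (N + M) L κ ν m l) :
    rest N t ∈ GA M L (t N) ν (fun i => m (i + N)) (fun i => l (i + N)) := by
  obtain ⟨h, hg, hw⟩ := ht
  have e : ∀ i j, rest N t (i + j) = t (i + N + j) := fun i j => by rw [rest]; congr 1; omega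
  refine ⟨⟨by rw [rest, zero_add], fun i hi => h.2.1 _ (by omega), fun i k => ?_⟩, ?_, ?_⟩
  · rw [e i 1]
    exact h.2.2 (i + N) k
  · intro i k hi
    have := hg (i + N) k (by omega)
    rw [defect] at this ⊢
    simp only [e, show i + 1 + N = i + N + 1 by omega]
    exact this
  · intro i hi
    rw [wt_congr (s := rest N t) (s' := t) (i := i) (j := i + N) rfl (e i 1)]
    exact hw (i + N) (by omega)

lemma isPartition_level (h : IsChain N κ ν t) (hν : ∀ k, L ≤ k → ν k = 0) (i : ℕ) :
    IsPartition (t i) :=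
  ⟨fun _ _ hij => h.antitone i hij, L, h.eq_zero hν le_rfl⟩

theorem ncard_GA_cut (hj : ∀ i, i + 1 = N → l (i + 1) ≤ m i) (hν : ∀ k, L ≤ k → ν k = 0) :
    ((GA (N + M) L κ ν m l).ncard : ENNReal) = ∑' γ : Ptn, ((GA N L κ γ.1 m l).ncard : ENNReal) *
      ((GA M L γ.1 ν (fun i => m (i + N)) (fun i => l (i + N))).ncard : ENNReal) := by
  rw [cast_ncard_eq_tsum (GA_finite hν m l)]
  let f : GA (N + M) L κ ν m l → Ptn := fun t => ⟨t.1 N, isPartition_level t.2.1 hν N⟩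
  rw [← (Equiv.sigmaFiberEquiv f).tsum_eq,
    ENNReal.tsum_sigma (fun (γ : Ptn) (_ : {x // f x = γ}) => (1 : ENNReal))]
  refine tsum_congr fun γ => ?_
  by_cases hγ : (GA M L γ.1 ν (fun i => m (i + N)) (fun i => l (i + N))).Nonempty
  · have hγL : ∀ k, L ≤ k → γ.1 k = 0 := by
      obtain ⟨t, ht⟩ := hγ
      intro k hk
      rw [← ht.1.1]
      exact ht.1.eq_zero hν hk
    rw [cast_ncard_eq_tsum (GA_finite hν _ _), cast_ncard_eq_tsum (GA_finite hγL _ _),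
      ← ENNReal.tsum_mul_right]
    simp only [one_mul]
    rw [← ENNReal.tsum_prod (f := fun (_ : GA N L κ γ.1 m l)
      (_ : GA M L γ.1 ν (fun i => m (i + N)) (fun i => l (i + N))) => (1 : ENNReal))]
    let e : {x // f x = γ} ≃ (GA N L κ γ.1 m l) ×
        (GA M L γ.1 ν (fun i => m (i + N)) (fun i => l (i + N))) :=
      { toFun := fun t => ⟨⟨upTo N t.1.1, by
            have := upTo_mem t.1.2
            rwa [show t.1.1 N = γ.1 from congrArg Subtype.val t.2] at this⟩,
          ⟨rest N t.1.1, by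
            have := rest_mem t.1.2
            rwa [show t.1.1 N = γ.1 from congrArg Subtype.val t.2] at this⟩⟩
        invFun := fun p => ⟨⟨glue N p.1.1 p.2.1, glue_mem hj hν p.1.2 p.2.2⟩, by
          refine Subtype.ext ?_
          change glue N p.1.1 p.2.1 N = γ.1
          rw [glue_le p.1.2.1 p.2.2.1 le_rfl, p.1.2.1.2.1 _ le_rfl]⟩
        left_inv := fun t => by
          refine Subtype.ext (Subtype.ext ?_)
          funext i
          change glue N (upTo N t.1.1) (rest N t.1.1) i = t.1.1 i
          rw [glue]
          split_ifs with h
          · rw [upTo, min_eq_left h.le]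
          · rw [rest, Nat.sub_add_cancel (not_lt.1 h)]
        right_inv := fun p => by
          refine Prod.ext (Subtype.ext ?_) (Subtype.ext ?_)
          · funext i
            change upTo N (glue N p.1.1 p.2.1) i = p.1.1 i
            rw [upTo, glue_le p.1.2.1 p.2.2.1 (min_le_right _ _)]
            rcases le_total i N with h | h
            · rw [min_eq_left h]
            · rw [min_eq_right h, p.1.2.1.2.1 _ le_rfl, p.1.2.1.2.1 _ h]
          · funext i
            exact glue_ge i }
    exact e.tsum_eq (fun _ => (1 : ENNReal))
  · rw [Set.not_nonempty_iff_eq_empty.1 hγ, Set.ncard_empty, Nat.cast_zero, mul_zero]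
    rw [ENNReal.tsum_eq_zero]
    rintro ⟨t, ht⟩
    refine absurd ⟨rest N t.1, ?_⟩ hγ
    have := rest_mem t.2
    rwa [show t.1 N = γ.1 from congrArg Subtype.val ht] at this

end

/-- The number of rows of `l` is at most `n`. -/
def Supp (n : ℕ) (l : Ptn) : Prop := ∀ k, n ≤ k → l.1 k = 0

lemma _root_.Ptn.anti (l : Ptn) : Antitone l.1 := l.2.1

lemma exists_supp (l : Ptn) : ∃ n, Supp n l := by
  obtain ⟨N, hN⟩ := l.2.2
  exact ⟨N, fun k hk => Nat.le_zero.1 (hN ▸ l.anti hk)⟩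

lemma Supp.mono {n m : ℕ} {l : Ptn} (h : Supp n l) (hnm : n ≤ m) : Supp m l :=
  fun k hk => h k (hnm.trans hk)

lemma supp_plen (l : Ptn) : Supp (plen l.1) l := by
  intro k hk
  have : l.1 (plen l.1) = 0 := Nat.sInf_mem l.2.2
  exact Nat.le_zero.1 (this ▸ l.anti hk)

def c (l m ν : Ptn) : ENNReal := (lrCoeff l.1 m.1 ν.1 : ENNReal)

def pw (n : ℕ) (l : Ptn) : Fin n → ℤ := res n fun i => l.1 i

lemma cast_anti (l : Ptn) (i : ℕ) : ((l.1 (i + 1) : ℕ) : ℤ) ≤ l.1 i := by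
  exact_mod_cast l.anti (Nat.le_succ i)

/-- Schur polynomials. -/
def sch (n : ℕ) (ν : Ptn) : Lau n := skew n (plen ν.1 + 1) (fun _ => 0) ν.1

section
variable {n L : ℕ}

lemma skew_eq_of_le {L' : ℕ} {κ ν : ℕ → ℕ} (hL : ∀ k, L ≤ k → ν k = 0) (hLL : L ≤ L') :
    skew n L' κ ν = skew n L κ ν := by
  rw [skew, skew]
  refine Finset.sum_congr rfl fun t ht => ?_
  rw [mem_chains hL] at ht
  congr 1
  funext i
  exact wt_eq_of_le ht hL hLL i

lemma skew_eq_sch {ν : Ptn} (hL : Supp L ν) : skew n L (fun _ => 0) ν.1 = sch n ν := by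
  rw [sch, ← skew_eq_of_le hL (le_max_left L (plen ν.1 + 1)),
    skew_eq_of_le ((supp_plen ν).mono (Nat.le_succ _)) (le_max_right L (plen ν.1 + 1))]

lemma pos_sch (ν : Ptn) : Pos (sch n ν) :=
  pos_skew ((supp_plen ν).mono (Nat.le_succ _)) (Nat.succ_pos _)

lemma c_eq_E {l m : Ptn} (ν : Ptn) (hl : Supp n l) (hm : Supp n m) :
    c l m ν = E (sch n ν) (pw n m) (pw n l) := by
  have h := (supp_plen ν).mono (Nat.le_succ _)
  rw [pw, pw, sch, E_skew h (Nat.succ_pos _) (fun i _ => cast_anti m i) fun i _ => cast_anti l i,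
    c, lrCoeff_eq l.anti m.anti hl hm h]

lemma c_eq_E_skew {ν κ δ : Ptn} (hL : Supp L ν) (hL0 : 0 < L) (hδ : Supp n δ) :
    c ν κ δ = E (skew n L κ.1 ν.1) 0 (pw n δ) := by
  rw [pw, show (0 : Fin n → ℤ) = res n (fun _ => 0) from rfl,
    E_skew hL hL0 (fun i _ => le_rfl) fun i _ => cast_anti δ i,
    c, lrCoeff_eq_skew κ.anti ν.anti hL hδ]

lemma lrCoeff_ne_zero {l m ν : ℕ → ℕ} (h : lrCoeff l m ν ≠ 0) : ∀ i, m i ≤ l i := by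
  obtain ⟨T, hT⟩ := Set.nonempty_of_ncard_ne_zero h
  exact hT.1

lemma c_ne_zero {l m ν : Ptn} (h : c l m ν ≠ 0) (hl : Supp n l) : Supp n m ∧ Supp n ν := by
  have h' : lrCoeff l.1 m.1 ν.1 ≠ 0 := by simpa [c] using h
  have hm : Supp n m := fun k hk => Nat.le_zero.1 (hl k hk ▸ lrCoeff_ne_zero h' k)
  refine ⟨hm, fun k hk => ?_⟩
  rw [lrCoeff_eq l.anti m.anti hl hm (supp_plen ν)] at h'
  obtain ⟨t, ht⟩ := Set.nonempty_of_ncard_ne_zero h'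
  exact ht.1.top_zero k hk

lemma alt_mul_sch {ν : Ptn} (h : Supp n ν) :
    alt (rho n) * sch n ν = alt (pw n ν + rho n) :=
  alt_rho_mul_skew ν.anti h ((supp_plen ν).mono (Nat.le_succ _)) (Nat.succ_pos _)

lemma antitone_pw (l : Ptn) : Antitone (pw n l) := antitone_res fun i _ => cast_anti l i

lemma c_comm (l m ν : Ptn) : c l m ν = c l ν m := by
  obtain ⟨a, ha⟩ := exists_supp l
  by_cases h : Supp a m ∧ Supp a ν
  · rw [c_eq_E ν ha h.1, c_eq_E m ha h.2, E, E, mult, mult, ← alt_mul_sch h.1, ← alt_mul_sch h.2]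
    congr 4
    ring
  · have h1 : c l m ν = 0 := by
      by_contra h1
      exact h (c_ne_zero h1 ha)
    have h2 : c l ν m = 0 := by
      by_contra h2
      exact h (c_ne_zero h2 ha).symm
    rw [h1, h2]

/-- Sums over nonnegative dominant weights are sums over partitions. -/
lemma tsum_wt {f : Wt n → ENNReal} {g : Ptn → ENNReal}
    (h1 : ∀ δ : Ptn, Supp n δ → f ⟨pw n δ, antitone_pw δ⟩ = g δ)
    (h2 : ∀ δ, g δ ≠ 0 → Supp n δ) (h3 : ∀ w, f w ≠ 0 → ∀ i, 0 ≤ w.1 i) :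
    ∑' w, f w = ∑' δ, g δ := by
  refine tsum_eq_tsum_of_ne_zero_bij
    (fun δ : Function.support g => (⟨pw n δ.1, antitone_pw δ.1⟩ : Wt n)) ?_ ?_ ?_
  · intro δ δ' h
    refine Subtype.ext (Subtype.ext ?_)
    funext i
    rcases lt_or_ge i n with hi | hi
    · have := congrFun (congrArg Subtype.val h) ⟨i, hi⟩
      exact Int.ofNat_inj.1 this
    · rw [h2 _ δ.2 i hi, h2 _ δ'.2 i hi]
  · intro w hw
    have hw0 := h3 w hw
    have he : ∀ i, 0 ≤ ext w.1 i := fun i => by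
      rw [ext]; split_ifs
      · exact hw0 _
      · exact le_rfl
    let δ : Ptn := ⟨fun i => (ext w.1 i).toNat, fun i j hij => by
      refine Int.toNat_le_toNat ?_
      simp only [ext]
      split_ifs with h h'
      · exact w.2 hij
      · omega
      · exact hw0 _
      · exact le_rfl, n, by simp [ext]⟩
    have hδ : Supp n δ := fun k hk => by
      change (ext w.1 k).toNat = 0
      rw [ext, dif_neg (not_lt.2 hk)]; rfl
    have e : (⟨pw n δ, antitone_pw δ⟩ : Wt n) = w := by
      refine Subtype.ext ?_
      rw [← res_ext w.1]
      funext i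
      exact Int.toNat_of_nonneg (he i)
    refine ⟨⟨δ, ?_⟩, e⟩
    rw [Function.mem_support, ← h1 δ hδ, e]
    exact hw
  · intro δ
    exact h1 _ (h2 _ δ.2)

lemma E_skew_nonneg {κ ν : ℕ → ℕ} (hL : ∀ k, L ≤ k → ν k = 0) (hL0 : 0 < L)
    {m l : Wt n} (h : E (skew n L κ ν) m l ≠ 0) (i : Fin n) : m.1 i ≤ l.1 i := by
  rw [← res_ext m.1, ← res_ext l.1, E_skew hL hL0 (ext_succ_le m.2) (ext_succ_le l.2)] at h
  obtain ⟨t, ht⟩ := Set.nonempty_of_ncard_ne_zero (by simpa using h)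
  have h1 := ht.2.2 i i.2
  have h2 := wt_nonneg (L := L) ht.1 i
  simp only [ext, i.2, dif_pos] at h1
  have h3 : m.1 i + wt L t i = l.1 i := h1
  linarith

open Classical in
theorem E_skew_expand {ν κ : Ptn} (hL : Supp L ν) (hL0 : 0 < L) (m l : Wt n) :
    E (skew n L κ.1 ν.1) m l = ∑' δ : Ptn, c ν κ δ * (if Supp n δ then E (sch n δ) m l else 0) := by
  let s : Wt n → Lau n := fun w =>
    if h : ∃ δ : Ptn, Supp n δ ∧ pw n δ = w.1 then sch n h.choose else 0
  have hs : ∀ δ : Ptn, Supp n δ → s ⟨pw n δ, antitone_pw δ⟩ = sch n δ := by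
    intro δ hδ
    have h : ∃ δ' : Ptn, Supp n δ' ∧ pw n δ' = pw n δ := ⟨δ, hδ, rfl⟩
    have e : s ⟨pw n δ, antitone_pw δ⟩ = sch n h.choose := dif_pos h
    have e2 := h.choose_spec
    rw [e]
    refine mul_left_cancel₀ alt_rho_ne_zero ?_
    rw [alt_mul_sch e2.1, alt_mul_sch hδ, e2.2]
  have hnn : ∀ w : Wt n, mult (skew n L κ.1 ν.1) 0 w ≠ 0 → ∀ i, 0 ≤ w.1 i := by
    intro w hw i
    have hp := (pos_skew (n := n) (κ := κ.1) hL hL0).2 ⟨0, antitone_zero⟩ w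
    refine E_skew_nonneg (κ := κ.1) hL hL0 (m := ⟨0, antitone_zero⟩) (l := w) ?_ i
    rw [E]
    have : mult (skew n L κ.1 ν.1) 0 w = ((mult (skew n L κ.1 ν.1) 0 w).toNat : ℤ) :=
      (Int.toNat_of_nonneg hp).symm
    rw [this] at hw
    exact_mod_cast hw
  rw [E_expand (pos_skew hL hL0) s]
  · refine tsum_wt ?_ ?_ ?_
    · intro δ hδ
      rw [if_pos hδ, hs δ hδ, c_eq_E_skew hL hL0 hδ]
    · intro δ h
      by_contra hδ
      rw [if_neg hδ, mul_zero] at h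
      exact h rfl
    · intro w h
      refine hnn w fun h0 => h ?_
      rw [E, h0]
      simp
  · intro w hw
    have h := hnn w hw
    obtain ⟨δ, hδ, e⟩ : ∃ δ : Ptn, Supp n δ ∧ (⟨pw n δ, antitone_pw δ⟩ : Wt n) = w := by
      have h0 : ∀ i, 0 ≤ ext w.1 i := fun i => by
        rw [ext]; split_ifs
        · exact h _
        · exact le_rfl
      refine ⟨⟨fun i => (ext w.1 i).toNat, fun i j hij => ?_, n, by simp [ext]⟩, fun k hk => ?_,
        Subtype.ext ?_⟩
      · refine Int.toNat_le_toNat ?_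
        simp only [ext]
        split_ifs with h1 h'
        · exact w.2 hij
        · omega
        · exact h _
        · exact le_rfl
      · change (ext w.1 k).toNat = 0
        rw [ext, dif_neg (not_lt.2 hk)]; rfl
      · conv_rhs => rw [← res_ext w.1]
        funext i
        exact Int.toNat_of_nonneg (h0 i)
    rw [← e, hs δ hδ]
    exact ⟨alt_mul_sch hδ, pos_sch δ⟩

end

def rat (n : ℕ) (a b : Ptn) : Fin n → ℤ := ratWeight n a.1 b.1

lemma antitone_rat (n : ℕ) (a b : Ptn) : Antitone (rat n a b) := fun i j h => by
  have h1 : a.1 j ≤ a.1 i := a.anti h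
  have h2 : b.1 (n - 1 - i) ≤ b.1 (n - 1 - j) := b.anti (by have : (i : ℕ) ≤ j := h; omega)
  simp only [rat, ratWeight]
  omega

lemma star_rat (n : ℕ) (a b : Ptn) : star (rat n a b) = rat n b a := by
  funext i
  simp only [star, rat, ratWeight, Fin.val_rev]
  rw [show n - (↑i + 1) = n - 1 - (i : ℕ) by omega,
    show n - 1 - (n - 1 - (i : ℕ)) = i by have := i.2; omega]
  ring

/-- The weight `rat n a b` as a dominant weight. -/
def ratW (n : ℕ) (a b : Ptn) : Wt n := ⟨rat n a b, antitone_rat n a b⟩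

section
variable {n N M x y z : ℕ}

lemma chain_le_top {κ ν : ℕ → ℕ} {t : ℕ → ℕ → ℕ} (h : IsChain n κ ν t) (k : ℕ) :
    κ k ≤ ν k := by
  rw [← h.1, ← h.2.1 n le_rfl]
  exact monotone_nat_of_le_succ (f := fun i => t i k) (fun i => (h.2.2 i k).2) (Nat.zero_le n)

lemma res_rat_left {a b : Ptn} (hb : Supp M b) :
    res N (fun i => (a.1 i : ℤ) - b.1 (N + M - 1 - i)) = pw N a := by
  funext i
  have := i.2
  simp only [res, pw]
  rw [hb _ (by omega)]
  simp

lemma res_rat_right {a b : Ptn} (ha : Supp N a) :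
    res M (fun i => (a.1 (i + N) : ℤ) - b.1 (N + M - 1 - (i + N))) = star (pw M b) := by
  funext i
  have := i.2
  simp only [res, pw, star, Fin.val_rev]
  rw [ha _ (by omega), show N + M - 1 - (↑i + N) = M - (↑i + 1) by omega]
  simp

/-- The matrix of multiplication by a Schur polynomial on stable rational weights. -/
def K (ν a b a' b' : Ptn) : ENNReal := ∑' γ : Ptn, ∑' δ : Ptn, c a' a γ * c ν γ δ * c b b' δ

theorem E_sch_rat {a b a' b' : Ptn} (ν : Ptn) (ha : Supp N a) (ha' : Supp N a') (hb : Supp M b)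
    (hb' : Supp M b') (hn : N + M = n) :
    E (sch n ν) (rat n a b) (rat n a' b') = K ν a b a' b' := by
  subst hn
  set L := plen ν.1 + 1 with hL
  have hLν : Supp L ν := (supp_plen ν).mono (Nat.le_succ _)
  have hL0 : 0 < L := Nat.succ_pos _
  have hanti : ∀ a b : Ptn, ∀ i : ℕ, (a.1 (i + 1) : ℤ) - b.1 (N + M - 1 - (i + 1))
      ≤ (a.1 i : ℤ) - b.1 (N + M - 1 - i) := fun a b i => by
    have h1 := cast_anti a i
    have h2 : b.1 (N + M - 1 - i) ≤ b.1 (N + M - 1 - (i + 1)) := b.anti (by omega)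
    omega
  have e1 : ∀ a b : Ptn, rat (N + M) a b = res (N + M)
    (fun i => (a.1 i : ℤ) - b.1 (N + M - 1 - i)) := fun _ _ => rfl
  rw [sch, e1, e1, E_skew hLν hL0 (fun i _ => hanti _ _ i) (fun i _ => hanti _ _ i),
    ncard_GA_cut (fun i hi => ?_) hLν, K]
  swap
  · rw [ha' _ (by omega), hb (N + M - 1 - i) (by omega)]
    have : (0 : ℤ) ≤ b'.1 (N + M - 1 - (i + 1)) := Int.natCast_nonneg _
    have : (0 : ℤ) ≤ a.1 i := Int.natCast_nonneg _
    simp only [Nat.cast_zero]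
    omega
  refine tsum_congr fun γ => ?_
  by_cases hγ : Supp L γ
  · rw [← E_skew hγ hL0 (fun i _ => hanti _ _ i) (fun i _ => hanti _ _ i),
      ← E_skew (n := M) hLν hL0 (fun i _ => ?_) (fun i _ => ?_), res_rat_left hb, res_rat_left hb',
      res_rat_right ha, res_rat_right ha', skew_eq_sch hγ, ← c_eq_E γ ha' ha,
      E_star (pos_skew hLν hL0)]
    · simp only [mul_assoc, ENNReal.tsum_mul_left]
      congr 1
      have := E_skew_expand (n := M) (κ := γ) hLν hL0 ⟨_, antitone_pw b'⟩ ⟨_, antitone_pw b⟩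
      refine this.trans (tsum_congr fun δ => ?_)
      congr 1
      split_ifs with hδ
      · exact (c_eq_E δ hb hb').symm
      · by_contra h0
        exact hδ (c_ne_zero (Ne.symm h0) hb).2
    · have := hanti a b (i + N)
      rwa [show i + N + 1 = i + 1 + N by omega] at this
    · have := hanti a' b' (i + N)
      rwa [show i + N + 1 = i + 1 + N by omega] at this
  · have hγ' : ¬ ∀ k, γ.1 k ≤ ν.1 k := fun h => hγ fun k hk => Nat.le_zero.1 (hLν k hk ▸ h k)
    have h1 : ∀ δ, c ν γ δ = 0 := fun δ => by
      by_contra h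
      exact hγ' (lrCoeff_ne_zero (by simpa [c] using h))
    have h2 : GA M L γ.1 ν.1 (fun i => (a.1 (i + N) : ℤ) - b.1 (N + M - 1 - (i + N)))
      (fun i => (a'.1 (i + N) : ℤ) - b'.1 (N + M - 1 - (i + N))) = ∅ := by
      refine Set.eq_empty_of_forall_notMem fun t ht => hγ' fun k => ?_
      exact chain_le_top ht.1 k
    rw [h2]
    simp [h1]

lemma GA_bound {L : ℕ} {κ ν : ℕ → ℕ} {m l : ℕ → ℤ} {t : ℕ → ℕ → ℕ} (h : t ∈ GA n L κ ν m l)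
    {i : ℕ} (hi : i + L < n) : l (i + L) ≤ m i := by
  have key : ∀ k, i + k < n →
      m (i + k) + ∑ r ∈ Finset.range k, ((t (i + k + 1) r : ℤ) - t (i + k) r) ≤ m i := by
    intro k
    induction k with
    | zero => intro _; simp
    | succ k ih =>
      intro hk
      have h1 := h.2.1 (i + k) k hk
      have h2 := ih (by omega)
      rw [defect] at h1
      rw [show i + (k + 1) = i + k + 1 by omega]
      linarith
  rw [← h.2.2 _ hi]
  exact key L hi

lemma E_sch_bound {ν : Ptn} (hν : Supp y ν) {m l : Wt n} (h : E (sch n ν) m l ≠ 0) :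
    (∀ i, m.1 i ≤ l.1 i) ∧ ∀ i j : Fin n, (i : ℕ) + y = j → l.1 j ≤ m.1 i := by
  have hy : Supp (y + 1) ν := hν.mono (Nat.le_succ _)
  rw [← skew_eq_sch hy] at h
  refine ⟨E_skew_nonneg hy (Nat.succ_pos _) h, fun i j hij => ?_⟩
  rw [← res_ext m.1, ← res_ext l.1,
    E_skew hy (Nat.succ_pos _) (ext_succ_le m.2) (ext_succ_le l.2)] at h
  rw [GA_eq_of_le hν (Nat.le_succ y)] at h
  obtain ⟨t, ht⟩ := Set.nonempty_of_ncard_ne_zero (by simpa using h)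
  have := GA_bound ht (i := i) (by omega)
  simpa [ext, i.2, hij, j.2] using this

lemma exists_rat (l : Wt n) (h1 : ∀ i : Fin n, x ≤ (i : ℕ) → l.1 i ≤ 0)
    (h2 : ∀ i : Fin n, (i : ℕ) + z < n → 0 ≤ l.1 i) :
    ∃ a b : Ptn, Supp x a ∧ Supp z b ∧ ratW n a b = l := by
  have hl := l.2
  refine ⟨⟨fun i => if h : i < n then (l.1 ⟨i, h⟩).toNat else 0, fun i j hij => ?_, n, by simp⟩,
    ⟨fun i => if h : n - 1 - i < n ∧ i < n then (- l.1 ⟨n - 1 - i, h.1⟩).toNat else 0,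
      fun i j hij => ?_, n, by simp⟩, fun k hk => ?_, fun k hk => ?_, Subtype.ext (funext fun i => ?_)⟩
  · simp only
    split_ifs with h h'
    · exact Int.toNat_le_toNat (hl hij)
    · omega
    · exact Nat.zero_le _
    · exact le_rfl
  · simp only
    split_ifs with h h'
    · refine Int.toNat_le_toNat (neg_le_neg (hl ?_))
      simp only [Fin.mk_le_mk]; omega
    · omega
    · exact Nat.zero_le _
    · exact le_rfl
  · change (if h : k < n then (l.1 ⟨k, h⟩).toNat else 0) = 0
    split_ifs with h
    · have := h1 ⟨k, h⟩ hk; omega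
    · rfl
  · change (if h : n - 1 - k < n ∧ k < n then (- l.1 ⟨n - 1 - k, h.1⟩).toNat else 0) = 0
    split_ifs with h
    · have := h2 ⟨n - 1 - k, h.1⟩ (by simp only; omega); omega
    · rfl
  · have hi := i.2
    simp only [ratW, rat, ratWeight, hi, dif_pos]
    rw [dif_pos (by omega)]
    have : (⟨n - 1 - (n - 1 - ↑i), by omega⟩ : Fin n) = i := Fin.ext (by simp only; omega)
    simp only [this, Fin.eta]
    omega

lemma ratW_inj {a b a' b' : Ptn} (hxz : x + z ≤ n) (ha : Supp x a) (hb : Supp z b) (ha' : Supp x a')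
    (hb' : Supp z b') (h : ratW n a b = ratW n a' b') : a = a' ∧ b = b' := by
  have h : ∀ i : ℕ, i < n → (a.1 i : ℤ) - b.1 (n - 1 - i) = (a'.1 i : ℤ) - b'.1 (n - 1 - i) :=
    fun i hi => congrFun (congrArg Subtype.val h) ⟨i, hi⟩
  constructor
  · refine Subtype.ext (funext fun i => ?_)
    by_cases hi : x ≤ i
    · rw [ha i hi, ha' i hi]
    · have := h i (by omega)
      rw [hb _ (by omega), hb' _ (by omega)] at this
      simpa using this
  · refine Subtype.ext (funext fun i => ?_)
    by_cases hi : z ≤ i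
    · rw [hb i hi, hb' i hi]
    · have := h (n - 1 - i) (by omega)
      rw [ha _ (by omega), ha' _ (by omega), show n - 1 - (n - 1 - i) = i by omega] at this
      simpa using this

lemma tsum_rat (hxz : x + z ≤ n) {f : Wt n → ENNReal} {g : Ptn → Ptn → ENNReal}
    (h1 : ∀ a b : Ptn, Supp x a → Supp z b → f (ratW n a b) = g a b)
    (h2 : ∀ a b, g a b ≠ 0 → Supp x a ∧ Supp z b)
    (h3 : ∀ w, f w ≠ 0 → ∃ a b, Supp x a ∧ Supp z b ∧ ratW n a b = w) :
    ∑' w, f w = ∑' a, ∑' b, g a b := by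
  rw [← ENNReal.tsum_prod (f := g)]
  refine tsum_eq_tsum_of_ne_zero_bij
    (fun d : Function.support (fun p : Ptn × Ptn => g p.1 p.2) => ratW n d.1.1 d.1.2) ?_ ?_ ?_
  · intro d d' h
    have hd := h2 _ _ d.2
    have hd' := h2 _ _ d'.2
    have := ratW_inj hxz hd.1 hd.2 hd'.1 hd'.2 h
    exact Subtype.ext (Prod.ext this.1 this.2)
  · intro w hw
    obtain ⟨a, b, ha, hb, e⟩ := h3 w hw
    refine ⟨⟨(a, b), ?_⟩, e⟩
    rw [Function.mem_support, ← h1 a b ha hb, e]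
    exact hw
  · intro d
    have hd := h2 _ _ d.2
    exact h1 _ _ hd.1 hd.2

lemma supp_of_c {l m ν : Ptn} (h : c l m ν ≠ 0) (hm : Supp x m) (hν : Supp y ν) :
    Supp (x + y) l := by
  obtain ⟨n, hn⟩ := exists_supp l
  intro k hk
  by_cases hkn : n ≤ k
  · exact hn k hkn
  have hmn := (c_ne_zero h hn).1
  rw [c_eq_E ν hn hmn] at h
  have := (E_sch_bound hν (m := ⟨_, antitone_pw m⟩) (l := ⟨_, antitone_pw l⟩) h).2
    ⟨k - y, by omega⟩ ⟨k, by omega⟩ (by simp only; omega)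
  simp only [pw, res] at this
  rw [hm (k - y) (by omega)] at this
  exact Nat.le_zero.1 (by exact_mod_cast this)

lemma K_ne_zero {ν a b a' b' : Ptn} (h : K ν a b a' b' ≠ 0) (ha : Supp x a) (hν : Supp y ν)
    (hb : Supp z b) : Supp (x + y) a' ∧ Supp z b' := by
  rw [K, Ne, ENNReal.tsum_eq_zero] at h
  push Not at h
  obtain ⟨γ, h⟩ := h
  rw [Ne, ENNReal.tsum_eq_zero] at h
  push Not at h
  obtain ⟨δ, h⟩ := h
  have h1 := left_ne_zero_of_mul (left_ne_zero_of_mul h)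
  have h2 := right_ne_zero_of_mul (left_ne_zero_of_mul h)
  exact ⟨supp_of_c h1 ha (c_ne_zero h2 hν).1, (c_ne_zero (right_ne_zero_of_mul h) hb).1⟩

lemma E_sch_support {ν a b : Ptn} (ha : Supp x a) (hν : Supp y ν) (hb : Supp z b)
    {l : Wt n} (h : E (sch n ν) (ratW n a b).1 l ≠ 0) :
    ∃ a' b', Supp (x + y) a' ∧ Supp z b' ∧ ratW n a' b' = l := by
  have h' := E_sch_bound hν h
  refine exists_rat l (fun i hi => ?_) fun i hi => ?_
  · refine (h'.2 ⟨i - y, by omega⟩ i (by simp only; omega)).trans ?_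
    simp only [ratW, rat, ratWeight]
    rw [ha _ (by omega)]
    simp
  · refine le_trans ?_ (h'.1 i)
    simp only [ratW, rat, ratWeight]
    rw [hb _ (by omega)]
    simp

lemma E_sch_mul {ν a b : Ptn} (ha : Supp x a) (hν : Supp y ν) (hb : Supp z b) (hn : x + y + z ≤ n)
    {G : Lau n} (hG : Pos G) (l : Wt n) :
    E (sch n ν * G) (rat n a b) l = ∑' a', ∑' b', K ν a b a' b' * E G (rat n a' b') l := by
  refine (E_mul (pos_sch ν) hG (ratW n a b) l).trans (tsum_rat hn ?_ ?_ ?_)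
  · intro a' b' ha' hb'
    have e : (x + y) + (n - (x + y)) = n := by omega
    have := E_sch_rat ν (ha.mono (Nat.le_add_right x y)) ha' (hb.mono (by omega)) (hb'.mono
      (by omega)) e
    simp only [ratW]
    rw [this]
  · intro a' b' h
    exact K_ne_zero (left_ne_zero_of_mul h) ha hν hb
  · intro w h
    exact E_sch_support ha hν hb (left_ne_zero_of_mul h)

lemma E_inv_sch {ν : Ptn} (m l : Fin n → ℤ) :
    E (inv (sch n ν)) m l = E (sch n ν) (star m) (star l) := by
  rw [E_inv (pos_sch ν), E_star (pos_sch ν)]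

lemma antitone_star {a : Fin n → ℤ} (ha : Antitone a) : Antitone (star a) := fun _ _ h =>
  neg_le_neg (ha (Fin.rev_le_rev.2 h))

lemma E_inv_sch_support {ν a b : Ptn} (ha : Supp x a) (hν : Supp y ν) (hb : Supp z b)
    {l : Wt n} (h : E (inv (sch n ν)) (ratW n a b).1 l ≠ 0) :
    ∃ a' b', Supp x a' ∧ Supp (z + y) b' ∧ ratW n a' b' = l := by
  rw [E_inv_sch, ratW, star_rat] at h
  obtain ⟨b', a', hb', ha', e⟩ := E_sch_support (l := ⟨star l.1, antitone_star l.2⟩) hb hν ha h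
  refine ⟨a', b', ha', hb', Subtype.ext ?_⟩
  have := congrArg star (congrArg Subtype.val e)
  simpa only [ratW, star_rat, star_star] using this

lemma E_inv_sch_rat {a b a' b' : Ptn} (ν : Ptn) (ha : Supp N a) (ha' : Supp N a') (hb : Supp M b)
    (hb' : Supp M b') (hn : N + M = n) :
    E (inv (sch n ν)) (rat n a b) (rat n a' b') = K ν b a b' a' := by
  rw [E_inv_sch, star_rat, star_rat, E_sch_rat ν hb hb' ha ha' (by omega)]

lemma E_inv_sch_mul {ν a b : Ptn} (ha : Supp x a) (hν : Supp y ν) (hb : Supp z b)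
    (hn : x + y + z ≤ n) {G : Lau n} (hG : Pos G) (l : Wt n) :
    E (inv (sch n ν) * G) (rat n a b) l
      = ∑' a', ∑' b', K ν b a b' a' * E G (rat n a' b') l := by
  refine (E_mul (pos_sch ν).inv hG (ratW n a b) l).trans
    (tsum_rat (x := x) (z := z + y) (by omega) ?_ ?_ ?_)
  · intro a' b' ha' hb'
    have e : (n - (z + y)) + (z + y) = n := by omega
    have := E_inv_sch_rat ν (ha.mono (by omega)) (ha'.mono (by omega)) (hb.mono
      (Nat.le_add_right z y)) hb' e
    simp only [ratW]
    rw [this]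
  · intro a' b' h
    exact (K_ne_zero (left_ne_zero_of_mul h) hb hν ha).symm
  · intro w h
    exact E_inv_sch_support ha hν hb (left_ne_zero_of_mul h)

end

/-- The empty partition. -/
def emp : Ptn := ⟨fun _ => 0, fun _ _ _ => le_rfl, 0, rfl⟩

section
variable {n x y z w : ℕ}

lemma supp_emp (n : ℕ) : Supp n emp := fun _ _ => rfl

lemma pw_emp : pw n emp = 0 := rfl

lemma exists_supp₂ (a b : Ptn) : ∃ n, Supp n a ∧ Supp n b := by
  obtain ⟨x, hx⟩ := exists_supp a
  obtain ⟨y, hy⟩ := exists_supp b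
  exact ⟨max x y, hx.mono (le_max_left _ _), hy.mono (le_max_right _ _)⟩

lemma eq_of_pw_eq {a b : Ptn} (ha : Supp n a) (hb : Supp n b) (h : pw n a = pw n b) : a = b := by
  refine Subtype.ext (funext fun i => ?_)
  rcases lt_or_ge i n with hi | hi
  · exact Int.ofNat_inj.1 (congrFun h ⟨i, hi⟩)
  · rw [ha i hi, hb i hi]

open Classical in
lemma c_emp_mid (l ν : Ptn) : c l emp ν = if l = ν then 1 else 0 := by
  obtain ⟨n, hl, hν⟩ := exists_supp₂ l ν
  rw [c_eq_E ν hl (supp_emp n), E, mult, pw_emp, zero_add, alt_mul_sch hν,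
    coeff_alt (strictAnti_add_rho (antitone_pw ν)) (strictAnti_add_rho (antitone_pw l))]
  by_cases h : l = ν
  · subst h; simp
  · rw [if_neg h, if_neg]
    · simp
    · intro h'
      first
        | exact h (eq_of_pw_eq hl hν (add_right_cancel h'))
        | exact h (eq_of_pw_eq hl hν (add_right_cancel h').symm)

open Classical in
lemma c_emp_right (l m : Ptn) : c l m emp = if l = m then 1 else 0 := by
  rw [c_comm, c_emp_mid]

lemma eq_emp {m : Ptn} (h : Supp 0 m) : m = emp := Subtype.ext (funext fun i => h i (Nat.zero_le i))

open Classical in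
lemma c_emp_top (m ν : Ptn) : c emp m ν = if m = emp ∧ ν = emp then 1 else 0 := by
  split_ifs with h
  · rw [h.1, h.2, c_emp_mid, if_pos rfl]
  · by_contra h0
    have := c_ne_zero h0 (supp_emp 0)
    exact h ⟨eq_emp this.1, eq_emp this.2⟩

lemma K_emp_left (ν b a' b' : Ptn) : K ν emp b a' b' = ∑' δ, c ν a' δ * c b b' δ := by
  classical
  simp only [K, c_emp_mid]
  rw [tsum_eq_single a']
  · simp
  · intro γ hγ
    simp [hγ.symm]

open Classical in
lemma K_emp_right (ν a a' b' : Ptn) : K ν a emp a' b' = if b' = emp then c a' a ν else 0 := by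
  simp only [K]
  split_ifs with h
  · rw [tsum_eq_single ν, tsum_eq_single emp]
    · rw [h, c_emp_mid, c_emp_right]; simp
    · intro δ hδ
      rw [c_emp_top, if_neg fun h' => hδ h'.2, mul_zero]
    · intro γ hγ
      refine ENNReal.tsum_eq_zero.2 fun δ => ?_
      by_cases hδ : δ = emp
      · rw [hδ, c_emp_right, if_neg hγ.symm]; simp
      · rw [c_emp_top, if_neg fun h' => hδ h'.2, mul_zero]
  · refine ENNReal.tsum_eq_zero.2 fun γ => ENNReal.tsum_eq_zero.2 fun δ => ?_
    rw [c_emp_top, if_neg fun h' => h h'.1, mul_zero]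

lemma K_emp_bot (ν a b a' : Ptn) : K ν a b a' emp = ∑' γ, c a' a γ * c ν γ b := by
  classical
  simp only [K, c_emp_mid]
  refine tsum_congr fun γ => ?_
  rw [tsum_eq_single b]
  · simp
  · intro δ hδ
    simp [hδ.symm]

lemma E_sch_inv_sch {ν δ a b l m : Ptn} (ha : Supp x a) (hν : Supp y ν) (hb : Supp z b)
    (hl : Supp (x + y) l) (hm : Supp (z + w) m) (hn : x + y + z + w ≤ n) :
    E (sch n ν * inv (sch n δ)) (rat n a b) (rat n l m)
      = ∑' a', ∑' b', K ν a b a' b' * K δ b' a' m l := by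
  refine (E_sch_mul ha hν hb (by omega) (pos_sch δ).inv (ratW n l m)).trans
    (tsum_congr fun a' => tsum_congr fun b' => ?_)
  by_cases h : K ν a b a' b' = 0
  · rw [h, zero_mul, zero_mul]
  · have h' := K_ne_zero h ha hν hb
    have e : (x + y) + (n - (x + y)) = n := by omega
    rw [ratW, E_inv_sch_rat δ h'.1 hl (h'.2.mono (by omega)) (hm.mono (by omega)) e]

lemma E_inv_sch_sch {ν δ a b l m : Ptn} (ha : Supp x a) (hb : Supp z b)
    (hδ : Supp w δ) (hl : Supp (x + y) l) (hm : Supp (z + w) m) (hn : x + y + z + w ≤ n) :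
    E (inv (sch n δ) * sch n ν) (rat n a b) (rat n l m)
      = ∑' a', ∑' b', K δ b a b' a' * K ν a' b' l m := by
  refine (E_inv_sch_mul ha hδ hb (by omega) (pos_sch ν) (ratW n l m)).trans
    (tsum_congr fun a' => tsum_congr fun b' => ?_)
  by_cases h : K δ b a b' a' = 0
  · rw [h, zero_mul, zero_mul]
  · have h' := K_ne_zero h hb hδ ha
    have e : (n - (z + w)) + (z + w) = n := by omega
    rw [ratW, E_sch_rat ν (h'.2.mono (by omega)) (hl.mono (by omega)) h'.1 hm e]

/-- Compatibility of the product and coproduct of symmetric functions. -/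
theorem hopf (α l μ δ : Ptn) : ∑' η, c η α μ * c η l δ =
    ∑' a, ∑' b, (∑' d, c δ b d * c α a d) * ∑' g, c l a g * c μ g b := by
  classical
  obtain ⟨x, hα, hl⟩ := exists_supp₂ α l
  obtain ⟨y, hμ, hδ⟩ := exists_supp₂ μ δ
  have h1 := E_sch_inv_sch (n := x + y + 0 + y) (δ := δ) hα hμ (supp_emp 0)
    (hl.mono (Nat.le_add_right x y)) (supp_emp (0 + y)) le_rfl
  have h2 := E_inv_sch_sch (n := x + y + 0 + y) (ν := μ) hα (supp_emp 0) hδ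
    (hl.mono (Nat.le_add_right x y)) (supp_emp _) le_rfl
  rw [mul_comm, h2] at h1
  simp only [K_emp_left, K_emp_bot, K_emp_right] at h1
  rw [h1]
  refine tsum_congr fun η => ?_
  rw [tsum_eq_single emp]
  · rw [if_pos rfl, K_emp_left, tsum_eq_single δ]
    · rw [c_emp_mid, if_pos rfl, one_mul]
    · intro d hd
      rw [c_emp_mid, if_neg hd.symm, zero_mul]
  · intro b hb
    rw [if_neg hb, zero_mul]

lemma pw_eq_rat (a : Ptn) : pw n a = rat n a emp := by
  funext i
  simp [pw, rat, ratWeight, res, emp]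

lemma E_sch_start {ν : Ptn} (hν : Supp n ν) (G : Lau n) (l : Fin n → ℤ) :
    E (sch n ν * G) 0 l = E G (pw n ν) l := by
  rw [E, mult, zero_add, ← mul_assoc, alt_mul_sch hν]
  rfl

lemma E_sch_sch {g δ a l : Ptn} (hl : Supp n l) (ha : Supp n a) :
    E (sch n g * sch n δ) (pw n a) (pw n l) = ∑' τ, c τ a g * c l τ δ := by
  refine (E_mul (pos_sch g) (pos_sch δ) ⟨_, antitone_pw a⟩ ⟨_, antitone_pw l⟩).trans
    (tsum_wt ?_ ?_ ?_)
  · intro τ hτ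
    rw [c_eq_E g hτ ha, c_eq_E δ hl hτ]
  · intro τ h
    exact (c_ne_zero (right_ne_zero_of_mul h) hl).1
  · intro k h i
    refine le_trans ?_ ((E_sch_bound (supp_plen g) (left_ne_zero_of_mul h)).1 i)
    exact Int.natCast_nonneg _

theorem assoc (ν δ y g : Ptn) : ∑' τ, c ν τ δ * c τ y g = ∑' σ, c ν y σ * c σ g δ := by
  obtain ⟨n, hν⟩ := exists_supp ν
  by_cases h : Supp n y ∧ Supp n g
  · have h1 := E_sch_sch (g := g) (δ := δ) hν h.1
    have h2 := E_sch_sch (g := δ) (δ := y) hν h.2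
    have e : E (sch n g * sch n δ) (pw n y) (pw n ν) = E (sch n δ * sch n y) (pw n g) (pw n ν) := by
      rw [← E_sch_start h.1, ← E_sch_start h.2]
      congr 1
      ring
    rw [h1, h2] at e
    simp only [fun τ => mul_comm (c ν τ δ), e]
    refine tsum_congr fun σ => ?_
    rw [mul_comm, c_comm ν]
  · have h1 : ∀ τ, c ν τ δ * c τ y g = 0 := fun τ => by
      by_contra h0
      exact h (c_ne_zero (right_ne_zero_of_mul h0) (c_ne_zero (left_ne_zero_of_mul h0) hν).1)
    have h2 : ∀ σ, c ν y σ * c σ g δ = 0 := fun τ => by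
      by_contra h0
      have := c_ne_zero (left_ne_zero_of_mul h0) hν
      exact h ⟨this.1, (c_ne_zero (right_ne_zero_of_mul h0) this.2).1⟩
    simp only [h1, h2]

end

/-- The stable tensor product multiplicity, as a sum of products of Littlewood-Richardson
coefficients. -/
def R (lp lm mp mm np nm : Ptn) : ENNReal :=
  ∑' a1, ∑' a2, ∑' b1, ∑' b2, ∑' c1, ∑' c2,
    c lp a2 a1 * c mp a1 c1 * c nm c1 b2 * c lm b2 b1 * c mm b1 c2 * c np c2 a2

section
variable {α : Type*}

lemma tsum_six (f : α → α → α → α → α → α → ENNReal) :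
    ∑' a, ∑' b, ∑' c, ∑' d, ∑' e, ∑' g, f a b c d e g
      = ∑' p : α × α × α × α × α × α,
          f p.1 p.2.1 p.2.2.1 p.2.2.2.1 p.2.2.2.2.1 p.2.2.2.2.2 := by
  simp only [ENNReal.tsum_prod']

lemma tsum_nine (f : α → α → α → α → α → α → α → α → α → ENNReal) :
    ∑' a, ∑' b, ∑' c, ∑' d, ∑' e, ∑' g, ∑' h, ∑' i, ∑' j, f a b c d e g h i j
      = ∑' p : α × α × α × α × α × α × α × α × α,
          f p.1 p.2.1 p.2.2.1 p.2.2.2.1 p.2.2.2.2.1 p.2.2.2.2.2.1 p.2.2.2.2.2.2.1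
            p.2.2.2.2.2.2.2.1 p.2.2.2.2.2.2.2.2 := by
  simp only [ENNReal.tsum_prod']

end

/-- The common form of both sides. -/
def Z (lp lm mp mm np nm : Ptn) : ENNReal :=
  ∑' c2, ∑' b1, ∑' b2, ∑' a1, ∑' κ, ∑' c1, ∑' a2,
    c lp a2 a1 * c mp a1 c1 * c lm b2 b1 * c mm b1 c2 *
      ((∑' a, c np a κ * c a c2 a2) * ∑' b, c nm b κ * c b c1 b2)

lemma tsum_K_K (lp lm mp mm np nm : Ptn) :
    ∑' a, ∑' b, K np mp mm a b * K nm b a lm lp = Z lp lm mp mm np nm := by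
  have h1 : ∑' a, ∑' b, K np mp mm a b * K nm b a lm lp =
      ∑' d, ∑' b, ∑' g', ∑' g, ∑' d', ∑' a, c a mp g * c np g d * c mm b d *
        (c lm b g' * c nm g' d' * c a lp d') := by
    simp only [K, ← ENNReal.tsum_mul_left, ← ENNReal.tsum_mul_right]
    rw [tsum_six, tsum_six]
    let e : (Ptn × Ptn × Ptn × Ptn × Ptn × Ptn) ≃ (Ptn × Ptn × Ptn × Ptn × Ptn × Ptn) :=
      { toFun := fun p => ⟨p.2.2.2.2.2, p.2.1, p.2.2.1, p.2.2.2.2.1, p.2.2.2.1, p.1⟩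
        invFun := fun p => ⟨p.2.2.2.2.2, p.2.1, p.2.2.1, p.2.2.2.2.1, p.2.2.2.1, p.1⟩
        left_inv := fun _ => rfl
        right_inv := fun _ => rfl }
    rw [← e.tsum_eq]
    rfl
  rw [h1, Z]
  refine tsum_congr fun d => tsum_congr fun b => tsum_congr fun g' => ?_
  have h2 : ∀ g d', ∑' a, c a mp g * c np g d * c mm b d * (c lm b g' * c nm g' d' * c a lp d')
      = c np g d * c mm b d * (c lm b g' * c nm g' d') *
        ∑' a, ∑' k, (∑' e, c d' k e * c mp a e) * ∑' h, c lp a h * c g h k := fun g d' => by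
    rw [← hopf, ← ENNReal.tsum_mul_left]
    exact tsum_congr fun a => by ring
  simp only [h2]
  have h3 : ∀ κ a2, ∑' a, c np a κ * c a d a2 = ∑' g, c np g d * c g a2 κ := fun κ a2 => by
    rw [assoc]
    exact tsum_congr fun a => by rw [c_comm np]
  have h4 : ∀ κ c1, ∑' a, c nm a κ * c a c1 g' = ∑' e, c nm g' e * c e κ c1 := fun κ c1 => by
    simp only [c_comm _ c1 g']
    rw [assoc]
    exact tsum_congr fun a => by rw [c_comm a]
  simp only [h3, h4]
  simp only [← ENNReal.tsum_mul_left, ← ENNReal.tsum_mul_right]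
  rw [tsum_six, tsum_six]
  let e : (Ptn × Ptn × Ptn × Ptn × Ptn × Ptn) ≃ (Ptn × Ptn × Ptn × Ptn × Ptn × Ptn) :=
    { toFun := fun p => ⟨p.2.2.2.2.2, p.2.2.2.2.1, p.1, p.2.1, p.2.2.2.1, p.2.2.1⟩
      invFun := fun p => ⟨p.2.2.1, p.2.2.2.1, p.2.2.2.2.2, p.2.2.2.2.1, p.2.1, p.1⟩
      left_inv := fun _ => rfl
      right_inv := fun _ => rfl }
  rw [← e.tsum_eq]
  refine tsum_congr fun p => ?_
  simp only [e, Equiv.coe_fn_mk]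
  rw [c_comm lm b, c_comm lp p.1]
  ring

lemma tsum_R (lp lm mp mm np nm : Ptn) :
    ∑' a, ∑' b, (∑' κ, c nm b κ * c np a κ) * R lp lm mp mm a b = Z lp lm mp mm np nm := by
  simp only [R, Z, ← ENNReal.tsum_mul_left, ← ENNReal.tsum_mul_right]
  rw [tsum_nine, tsum_nine]
  let e : (Ptn × Ptn × Ptn × Ptn × Ptn × Ptn × Ptn × Ptn × Ptn) ≃
      (Ptn × Ptn × Ptn × Ptn × Ptn × Ptn × Ptn × Ptn × Ptn) :=
    { toFun := fun p => ⟨p.2.2.2.2.2.2.2.2, p.2.2.2.2.2.2.2.1, p.2.2.2.1, p.2.2.2.2.2.2.1, p.2.1, p.2.2.1, p.2.2.2.2.2.1, p.1, p.2.2.2.2.1⟩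
      invFun := fun p => ⟨p.2.2.2.2.2.2.2.1, p.2.2.2.2.1, p.2.2.2.2.2.1, p.2.2.1, p.2.2.2.2.2.2.2.2, p.2.2.2.2.2.2.1, p.2.2.2.1, p.2.1, p.1⟩
      left_inv := fun _ => rfl
      right_inv := fun _ => rfl }
  rw [← e.tsum_eq]
  refine tsum_congr fun p => ?_
  simp only [e, Equiv.coe_fn_mk]
  ring

section
variable {n p q r s : ℕ}

open Classical in
/-- The character of the irreducible representation with highest weight `w`. -/
def chi (w : Fin n → ℤ) : Lau n :=
  if h : ∃ F : Lau n, alt (rho n) * F = alt (w + rho n) then h.choose else 0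

lemma alt_mul_mon (a : Fin n → ℤ) (C : ℤ) :
    alt a * mon (fun _ => C) = alt (a + fun _ => C) := by
  simp only [alt, Finset.sum_mul, smul_mul_assoc]
  refine Finset.sum_congr rfl fun σ _ => ?_
  rw [mon, mon, mon, AddMonoidAlgebra.single_mul_single, mul_one]
  rfl

lemma exists_shift (w : Wt n) : ∃ (C : ℕ) (b : Ptn), Supp n b ∧ pw n b = w.1 + fun _ => (C : ℤ) := by
  obtain ⟨C, hC⟩ : ∃ C : ℕ, ∀ i, - w.1 i ≤ C :=
    ⟨∑ i, (w.1 i).natAbs, fun i => by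
      have : (w.1 i).natAbs ≤ ∑ i, (w.1 i).natAbs :=
        Finset.single_le_sum (f := fun i => (w.1 i).natAbs) (fun _ _ => Nat.zero_le _)
          (Finset.mem_univ i)
      omega⟩
  obtain ⟨b, b', hb, hb', e⟩ := exists_rat (x := n) (z := 0)
    (⟨w.1 + fun _ => (C : ℤ), fun i j h => add_le_add_left (w.2 h) _⟩ : Wt n)
    (fun i hi => absurd i.2 (not_lt.2 hi))
    (fun i _ => by have := hC i; simp only [Pi.add_apply]; omega)
  refine ⟨C, b, hb, ?_⟩
  rw [pw_eq_rat, ← eq_emp hb']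
  exact congrArg Subtype.val e

lemma mult_mon_mul (F : Lau n) (C : ℤ) (m l : Fin n → ℤ) :
    mult (mon (fun _ => C) * F) m l = mult F (m + fun _ => C) l := by
  rw [mult, ← mul_assoc, alt_mul_mon, mult]
  rw [add_right_comm]

lemma chi_spec (w : Wt n) : alt (rho n) * chi w.1 = alt (w.1 + rho n) ∧ Pos (chi w.1) := by
  obtain ⟨C, b, hb, e⟩ := exists_shift w
  have h0 : alt (rho n) * (mon (fun _ => - (C : ℤ)) * sch n b) = alt (w.1 + rho n) := by
    rw [mul_left_comm, alt_mul_sch hb, mul_comm, alt_mul_mon, e]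
    congr 1
    funext i
    simp only [Pi.add_apply]
    ring
  have h : ∃ F : Lau n, alt (rho n) * F = alt (w.1 + rho n) := ⟨_, h0⟩
  have h1 : alt (rho n) * chi w.1 = alt (w.1 + rho n) := by
    rw [chi, dif_pos h]
    exact h.choose_spec
  refine ⟨h1, ?_⟩
  have h2 : chi w.1 = mon (fun _ => - (C : ℤ)) * sch n b :=
    mul_left_cancel₀ alt_rho_ne_zero (h1.trans h0.symm)
  rw [h2]
  refine ⟨Symm.mul (fun σ => ?_) (pos_sch b).1, fun m l => ?_⟩
  · rw [act_mon]
    rfl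
  · rw [mult_mon_mul]
    exact (pos_sch b).2 ⟨m.1 + fun _ => - (C : ℤ), fun i j h => add_le_add_left (m.2 h) _⟩ l

lemma E_expand_chi {np nm : Ptn} (hr : Supp r np) (hs : Supp s nm) (hrs : r + s ≤ n) (m l : Wt n) :
    E (sch n np * inv (sch n nm)) m l
      = ∑' a, ∑' b, (∑' κ, c nm b κ * c np a κ) * E (chi (rat n a b)) m l := by
  have hE : ∀ k, E (sch n np * inv (sch n nm)) 0 k = E (inv (sch n nm)) (rat n np emp) k := fun k => by
    rw [E_sch_start (hr.mono (by omega)), pw_eq_rat]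
  refine (E_expand ((pos_sch np).mul (pos_sch nm).inv) (fun k => chi k.1)
    (fun k _ => chi_spec k) m l).trans (tsum_rat hrs ?_ ?_ ?_)
  · intro a b ha hb
    have e : (n - s) + s = n := by omega
    simp only [ratW]
    rw [hE, E_inv_sch_rat nm (hr.mono (by omega)) (ha.mono (by omega)) (supp_emp _) hb e,
      K_emp_left]
  · intro a b h
    have := left_ne_zero_of_mul h
    rw [Ne, ENNReal.tsum_eq_zero] at this
    push Not at this
    obtain ⟨κ, h⟩ := this
    exact ⟨(c_ne_zero (right_ne_zero_of_mul h) hr).1, (c_ne_zero (left_ne_zero_of_mul h) hs).1⟩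
  · intro w h
    have h' := left_ne_zero_of_mul h
    rw [hE] at h'
    obtain ⟨a, b, ha, hb, e⟩ := E_inv_sch_support (b := emp) hr hs (supp_emp 0) h'
    exact ⟨a, b, ha, by simpa using hb, e⟩

lemma sum_eq_of_c {l m ν : Ptn} (h : c l m ν ≠ 0) (hl : Supp n l) :
    ∑ i ∈ Finset.range n, l.1 i
      = ∑ i ∈ Finset.range n, m.1 i + ∑ i ∈ Finset.range n, ν.1 i := by
  have hmν := c_ne_zero h hl
  have h' : lrCoeff l.1 m.1 ν.1 ≠ 0 := by simpa [c] using h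
  rw [lrCoeff_eq l.anti m.anti hl hmν.1 hmν.2] at h'
  obtain ⟨t, ht⟩ := Set.nonempty_of_ncard_ne_zero h'
  zify
  rw [Finset.sum_congr rfl fun i hi => (ht.2.2 i (Finset.mem_range.1 hi)).symm,
    Finset.sum_add_distrib]
  congr 1
  simp only [wt]
  rw [Finset.sum_comm]
  refine Finset.sum_congr rfl fun k _ => ?_
  rw [Finset.sum_range_sub (fun i => (t i k : ℤ)), ht.1.1, ht.1.2.1 n le_rfl]
  simp

lemma E_ne_top (F : Lau n) (m l : Fin n → ℤ) : E F m l ≠ ⊤ := ENNReal.natCast_ne_top _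

open Classical in
lemma tsum_split (np nm : Ptn) (X : Ptn → Ptn → ENNReal) :
    ∑' a, ∑' b, (∑' κ, c nm b κ * c np a κ) * X a b = X np nm + ∑' κ,
      if κ = emp then 0 else ∑' a, ∑' b, c nm b κ * c np a κ * X a b := by
  have e : ∑' a, ∑' b, (∑' κ, c nm b κ * c np a κ) * X a b
      = ∑' κ, ∑' a, ∑' b, c nm b κ * c np a κ * X a b := by
    simp only [← ENNReal.tsum_mul_right]
    symm
    refine Eq.trans (ENNReal.tsum_comm (f := fun κ a => ∑' b, c nm b κ * c np a κ * X a b)) ?_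
    refine tsum_congr fun a => ?_
    exact ENNReal.tsum_comm (f := fun κ b => c nm b κ * c np a κ * X a b)
  have e2 : ∑' a, ∑' b, c nm b emp * c np a emp * X a b = X np nm := by
    rw [tsum_eq_single np, tsum_eq_single nm]
    · simp only [c_emp_right]; simp
    · intro b hb; rw [c_emp_right, if_neg hb.symm, zero_mul, zero_mul]
    · intro a ha
      refine ENNReal.tsum_eq_zero.2 fun b => ?_
      rw [c_emp_right np, if_neg ha.symm, mul_zero, zero_mul]
  refine e.trans ((ENNReal.tsum_eq_add_tsum_ite (f := fun κ => ∑' a, ∑' b,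
    c nm b κ * c np a κ * X a b) emp).trans ?_)
  rw [e2]

theorem E_chi_rat {lp lm mp mm np nm : Ptn} (hn : p + q + r + s ≤ n)
    (hlp : Supp (p + r) lp) (hlm : Supp (q + s) lm) (hmp : Supp p mp) (hmm : Supp q mm)
    (hnp : Supp r np) (hnm : Supp s nm) :
    E (chi (rat n np nm)) (rat n mp mm) (rat n lp lm) = R lp lm mp mm np nm := by
  classical
  induction hN : ∑ i ∈ Finset.range s, nm.1 i using Nat.strong_induction_on generalizing np nm with
  | _ N ih =>
  have h1 := E_expand_chi hnp hnm (by omega) (ratW n mp mm) (ratW n lp lm)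
  have h2 := E_sch_inv_sch (n := n) (l := lp) (δ := nm) hmp hnp hmm hlp hlm (by omega)
  rw [tsum_K_K, ← tsum_R] at h2
  simp only [ratW] at h1
  rw [h1] at h2
  have hfin : (∑' κ, if κ = emp then 0 else ∑' a, ∑' b, c nm b κ * c np a κ *
      E (chi (rat n a b)) (rat n mp mm) (rat n lp lm)) ≠ ⊤ :=
    ne_top_of_le_ne_top (E_ne_top _ _ _)
      (le_add_self.trans_eq ((tsum_split _ _ _).symm.trans h1.symm))
  rw [tsum_split, tsum_split] at h2
  have h3 : ∀ κ, (if κ = emp then 0 else ∑' a, ∑' b, c nm b κ * c np a κ *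
      E (chi (rat n a b)) (rat n mp mm) (rat n lp lm)) = if κ = emp then 0 else
        ∑' a, ∑' b, c nm b κ * c np a κ * R lp lm mp mm a b := by
    intro κ
    split_ifs with hκ
    · rfl
    refine tsum_congr fun a => tsum_congr fun b => ?_
    by_cases h0 : c nm b κ * c np a κ = 0
    · rw [h0, zero_mul, zero_mul]
    have hb := left_ne_zero_of_mul h0
    have hb' := c_ne_zero hb hnm
    rw [ih _ ?_ (c_ne_zero (right_ne_zero_of_mul h0) hnp).1 hb'.1 rfl]
    rw [← hN, sum_eq_of_c hb hnm]
    refine Nat.lt_add_of_pos_right (Nat.pos_of_ne_zero fun hz => hκ ?_)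
    rw [Finset.sum_eq_zero_iff] at hz
    refine Subtype.ext (funext fun i => ?_)
    by_cases hi : i < s
    · exact hz i (Finset.mem_range.2 hi)
    · exact hb'.2 i (not_lt.1 hi)
  rw [tsum_congr h3] at h2 hfin
  exact (ENNReal.add_left_inj hfin).1 h2

end

section
variable {n : ℕ}

/-- The transvection `1 + c E_{ij}` as an element of `GL_n`. -/
def tv (i j : Fin n) (h : i ≠ j) (c : ℂ) : GL (Fin n) ℂ :=
  ⟨transvection i j c, transvection i j (-c),
    by rw [transvection_mul_transvection_same i j h, add_neg_cancel, transvection_zero],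
    by rw [transvection_mul_transvection_same i j h, neg_add_cancel, transvection_zero]⟩

/-- A diagonal element of `GL_n`. -/
def dg (d : Fin n → ℂˣ) : GL (Fin n) ℂ :=
  ⟨diagonal fun i => (d i : ℂ), diagonal fun i => ((d i)⁻¹ : ℂˣ),
    by rw [diagonal_mul_diagonal]; simp, by rw [diagonal_mul_diagonal]; simp⟩

@[simp] lemma coe_tv (i j : Fin n) (h : i ≠ j) (c : ℂ) :
    (tv i j h c : Matrix (Fin n) (Fin n) ℂ) = transvection i j c := rfl

@[simp] lemma coe_dg (d : Fin n → ℂˣ) :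
    (dg d : Matrix (Fin n) (Fin n) ℂ) = diagonal fun i => (d i : ℂ) := rfl

lemma tv_mul_tv {i j : Fin n} (h : i ≠ j) (c d : ℂ) : tv i j h c * tv i j h d = tv i j h (c + d) :=
  Units.ext (transvection_mul_transvection_same i j h c d)

lemma tv_zero {i j : Fin n} (h : i ≠ j) : tv i j h 0 = 1 := Units.ext (transvection_zero i j)

lemma tv_inv {i j : Fin n} (h : i ≠ j) (c : ℂ) : (tv i j h c)⁻¹ = tv i j h (-c) :=
  inv_eq_of_mul_eq_one_right (by rw [tv_mul_tv, add_neg_cancel, tv_zero])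

lemma tv_pow {i j : Fin n} (h : i ≠ j) (c : ℂ) (k : ℕ) : tv i j h c ^ k = tv i j h (k * c) := by
  induction k with
  | zero => simp [tv_zero]
  | succ k ih => rw [pow_succ, ih, tv_mul_tv]; push_cast; ring_nf

lemma gl_induction {p : GL (Fin n) ℂ → Prop} (hd : ∀ d, p (dg d))
    (ht : ∀ i j h c, p (tv i j h c)) (hm : ∀ g h, p g → p h → p (g * h)) (g : GL (Fin n) ℂ) : p g := by
  have key : ∀ M : Matrix (Fin n) (Fin n) ℂ, M.det ≠ 0 → ∀ g : GL (Fin n) ℂ, (g : Matrix _ _ ℂ) = M → p g := by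
    intro M hM
    refine diagonal_transvection_induction_of_det_ne_zero
      (fun M => ∀ g : GL (Fin n) ℂ, (g : Matrix _ _ ℂ) = M → p g) M hM ?_ ?_ ?_
    · intro D hD g hg
      rw [det_diagonal, Finset.prod_ne_zero_iff] at hD
      have : g = dg fun i => Units.mk0 (D i) (hD i (Finset.mem_univ i)) := Units.ext (by simp [hg])
      rw [this]; exact hd _
    · intro t g hg
      have : g = tv t.i t.j t.hij t.c := Units.ext hg
      rw [this]; exact ht _ _ _ _
    · intro A C hA hC ihA ihC g hg
      have : g = GeneralLinearGroup.mkOfDetNeZero A hA * GeneralLinearGroup.mkOfDetNeZero C hC :=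
        Units.ext hg
      rw [this]
      exact hm _ _ (ihA _ rfl) (ihC _ rfl)
  refine key g ?_ g rfl
  exact ((isUnit_iff_isUnit_det _).1 g.isUnit).ne_zero

lemma tv_comm {i k j : Fin n} (hik : i ≠ k) (hkj : k ≠ j) (hij : i ≠ j) (c : ℂ) :
    tv i k hik c * tv k j hkj 1 * tv i k hik (-c) * tv k j hkj (-1) = tv i j hij c := by
  refine Units.ext ?_
  simp only [Units.val_mul, coe_tv, transvection, mul_add, add_mul, mul_one, one_mul]
  simp [single_mul_single_of_ne, hik.symm, hkj.symm, hij.symm]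
  simp only [← single_neg]
  abel

/-- `GL_n` is generated by diagonal matrices, lower transvections and simple upper transvections. -/
lemma gl_induction_simple {p : GL (Fin n) ℂ → Prop} (hd : ∀ d, p (dg d))
    (hl : ∀ (i j : Fin n) (h : j < i) c, p (tv i j h.ne' c))
    (hs : ∀ (i j : Fin n) (h : i < j) c, (j : ℕ) = i + 1 → p (tv i j h.ne c))
    (hm : ∀ g h, p g → p h → p (g * h)) (g : GL (Fin n) ℂ) : p g := by
  have key : ∀ m : ℕ, ∀ (i j : Fin n) (h : i < j) c, (j : ℕ) = i + 1 + m → p (tv i j h.ne c) := by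
    intro m
    induction m with
    | zero => exact fun i j h c hm => hs i j h c hm
    | succ m ih =>
      intro i j h c hj
      let k : Fin n := ⟨i + 1 + m, by omega⟩
      have hik : i < k := Fin.lt_def.2 (by simp only [k]; omega)
      have hkj : k < j := Fin.lt_def.2 (by simp only [k]; omega)
      rw [← tv_comm hik.ne hkj.ne h.ne c]
      have h1 := fun c => ih i k hik c rfl
      have h2 := fun c => hs k j hkj c (by simp only [k]; omega)
      exact hm _ _ (hm _ _ (hm _ _ (h1 _) (h2 _)) (h1 _)) (h2 _)
  refine gl_induction hd (fun i j h c => ?_) hm g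
  rcases lt_or_gt_of_ne h with h' | h'
  · exact key (j - i - 1) i j h' c (by have := Fin.lt_def.1 h'; omega)
  · exact hl i j h' c

/-- Lower triangular unipotent matrices. -/
def IsLow (u : Matrix (Fin n) (Fin n) ℂ) : Prop :=
  (∀ i, u i i = 1) ∧ ∀ i j, i < j → u i j = 0

lemma IsLow.mul {u w : Matrix (Fin n) (Fin n) ℂ} (hu : IsLow u) (hw : IsLow w) : IsLow (u * w) := by
  constructor
  · intro i
    rw [mul_apply, Finset.sum_eq_single i _ (by simp), hu.1, hw.1, one_mul]
    intro k _ hk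
    rcases lt_or_gt_of_ne hk with h | h
    · rw [hw.2 k i h, mul_zero]
    · rw [hu.2 i k h, zero_mul]
  · intro i j hij
    rw [mul_apply]
    refine Finset.sum_eq_zero fun k _ => ?_
    rcases lt_or_ge i k with h | h
    · rw [hu.2 i k h, zero_mul]
    · rw [hw.2 k j (h.trans_lt hij), mul_zero]

lemma isLow_transvection {i j : Fin n} (h : j < i) (c : ℂ) : IsLow (transvection i j c) := by
  refine ⟨fun k => ?_, fun k l hkl => ?_⟩
  · simp only [transvection, Matrix.add_apply, one_apply_eq, Matrix.single_apply]
    rw [if_neg (by rintro ⟨rfl, rfl⟩; exact h.false), add_zero]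
  · simp only [transvection, Matrix.add_apply, one_apply_ne hkl.ne, Matrix.single_apply]
    rw [if_neg (by rintro ⟨rfl, rfl⟩; exact h.not_gt hkl), add_zero]

lemma IsLow.conj_dg {u : Matrix (Fin n) (Fin n) ℂ} (hu : IsLow u) (d : Fin n → ℂˣ) :
    IsLow ((dg d : Matrix (Fin n) (Fin n) ℂ) * u * ((dg d)⁻¹ : GL (Fin n) ℂ).val) := by
  have : ((dg d)⁻¹ : GL (Fin n) ℂ) = dg (fun i => (d i)⁻¹) :=
    inv_eq_of_mul_eq_one_right (Units.ext (by simp))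
  rw [this, coe_dg, coe_dg]
  refine ⟨fun i => ?_, fun i j h => ?_⟩
  · simp [hu.1]
  · simp [hu.2 i j h]

lemma IsLow.conj_simple {m : Matrix (Fin n) (Fin n) ℂ} (hm : IsLow m) {i j : Fin n}
    (hij : (j : ℕ) = i + 1) (h0 : m j i = 0) (c : ℂ) :
    IsLow (transvection i j c * m * transvection i j (-c)) := by
  have hlt : i < j := Fin.lt_def.2 (by omega)
  have key : ∀ a b, (transvection i j c * m * transvection i j (-c)) a b =
      m a b + (if a = i then c * m j b else 0) - (if b = j then c * m a i else 0) := by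
    intro a b
    have h1 : ∀ b, (transvection i j c * m) a b = m a b + (if a = i then c * m j b else 0) := by
      intro b
      split_ifs with h
      · rw [h, transvection_mul_apply_same]
      · rw [transvection_mul_apply_of_ne _ _ _ _ h, add_zero]
    by_cases hb : b = j
    · rw [hb, mul_transvection_apply_same, h1, h1, h0, if_pos rfl]; simp; ring
    · rw [mul_transvection_apply_of_ne _ _ _ _ hb, h1, if_neg hb, sub_zero]
  refine ⟨fun a => ?_, fun a b hab => ?_⟩
  · rw [key, hm.1]
    by_cases ha : a = i
    · subst ha; rw [if_neg hlt.ne, if_pos rfl, h0]; simp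
    · rw [if_neg ha]
      by_cases hb : a = j
      · subst hb; rw [if_pos rfl, h0]; simp
      · rw [if_neg hb]; simp
  · rw [key, hm.2 a b hab]
    by_cases ha : a = i
    · subst ha
      rw [if_pos rfl, hm.1]
      by_cases hb : b = j
      · subst hb; rw [if_pos rfl, hm.1]; ring
      · have : j < b := by
          rw [Fin.lt_def] at *
          have : (b : ℕ) ≠ j := fun h => hb (Fin.ext h)
          omega
        rw [if_neg hb, hm.2 j b this]; ring
    · rw [if_neg ha]
      by_cases hb : b = j
      · subst hb
        have : a < i := by
          rw [Fin.lt_def] at *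
          have : (a : ℕ) ≠ i := fun h => ha (Fin.ext h)
          omega
        rw [if_pos rfl, hm.2 a i this]; ring
      · rw [if_neg hb]; ring

lemma IsLow.mul_tv {u : Matrix (Fin n) (Fin n) ℂ} (hu : IsLow u) (i j : Fin n) :
    (u * transvection j i (-u j i)) j i = 0 := by
  rw [mul_transvection_apply_same, hu.1]; ring

lemma sl_two {i j : Fin n} (h : i < j) {c d : ℂ} (e : ℂˣ) (he : (e : ℂ) = 1 + c * d) :
    tv i j h.ne c * tv j i h.ne' d =
      tv j i h.ne' (d * (e⁻¹ : ℂˣ)) * dg (Function.update (Function.update 1 i e) j e⁻¹) *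
        tv i j h.ne (c * (e⁻¹ : ℂˣ)) := by
  have hd : (diagonal fun a => ((Function.update (Function.update 1 i e) j e⁻¹ : Fin n → ℂˣ) a : ℂ)) =
      1 + ((e : ℂ) - 1) • single i i (1 : ℂ) + ((e⁻¹ : ℂˣ) - 1 : ℂ) • single j j (1 : ℂ) := by
    ext a b
    by_cases hab : a = b
    · subst hab
      by_cases ha : a = j
      · subst ha; simp [h.ne]
      · by_cases hb : a = i
        · subst hb; simp [h.ne, h.ne']
        · simp [ha, hb, Ne.symm ha, Ne.symm hb]
    · simp only [diagonal_apply_ne _ hab, Matrix.add_apply, one_apply_ne hab, Matrix.smul_apply, Matrix.single_apply]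
      rw [if_neg (by rintro ⟨rfl, rfl⟩; exact hab rfl), if_neg (by rintro ⟨rfl, rfl⟩; exact hab rfl)]
      simp
  have hs : ∀ (a b : Fin n) (c : ℂ), single a b c = c • single a b (1 : ℂ) := fun a b c => by simp
  have h1 : (e : ℂ) * (e⁻¹ : ℂˣ) = 1 := e.mul_inv
  refine Units.ext ?_
  simp only [Units.val_mul, coe_tv, coe_dg, transvection, hd]
  rw [hs i j c, hs j i d, hs j i (d * _), hs i j (c * _)]
  simp only [mul_add, add_mul, mul_one, one_mul, smul_mul_assoc, mul_smul_comm,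
    single_mul_single_same, single_mul_single_of_ne _ _ _ _ h.ne,
    single_mul_single_of_ne _ _ _ _ h.ne', smul_zero, add_zero]
  ext a b
  simp only [Matrix.add_apply, Matrix.smul_apply, smul_eq_mul]
  have h2 : ((e⁻¹ : ℂˣ) : ℂ) * (c * d) = 1 - (e⁻¹ : ℂˣ) := by
    have : ((e⁻¹ : ℂˣ) : ℂ) * (1 + c * d) = 1 := by rw [← he]; exact e.inv_mul
    linear_combination this
  generalize ((e⁻¹ : ℂˣ) : ℂ) = f at *
  generalize (e : ℂ) = e' at *
  generalize single i i (1 : ℂ) a b = X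
  generalize single i j (1 : ℂ) a b = Y
  generalize single j i (1 : ℂ) a b = Z
  generalize single j j (1 : ℂ) a b = U
  subst he
  grind

end

section
variable {n : ℕ} {V : Type*} [AddCommGroup V] [Module ℂ V]

lemma mem_span_pow_succ [FiniteDimensional ℂ V] (f : V →ₗ[ℂ] V) (hf : Function.Injective f) (v : V) :
    v ∈ Submodule.span ℂ (Set.range fun k : ℕ => (f ^ (k + 1)) v) := by
  set S := Submodule.span ℂ (Set.range fun k : ℕ => (f ^ k) v) with hS
  have h1 : Submodule.span ℂ (Set.range fun k : ℕ => (f ^ (k + 1)) v) = S.map f := by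
    rw [hS, Submodule.map_span, ← Set.range_comp]
    congr 2
    funext k
    simp [pow_succ']
  have h2 : S.map f ≤ S := by
    rw [← h1, Submodule.span_le]
    rintro _ ⟨k, rfl⟩
    exact Submodule.subset_span ⟨k + 1, rfl⟩
  have h3 : S.map f = S :=
    Submodule.eq_of_le_of_finrank_eq h2 (Submodule.equivMapOfInjective f hf S).finrank_eq.symm
  rw [h1, h3]
  exact Submodule.subset_span ⟨0, rfl⟩

/-- If `v` is fixed by upper transvections and an eigenvector of the torus, the span of the orbit
of `v` under lower unipotents is stable. -/
theorem span_low_stable [FiniteDimensional ℂ V] (ρ : Representation ℂ (GL (Fin n) ℂ) V) {v : V}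
    (hv : ∀ i j (h : i < j) c, ρ (tv i j h.ne c) v = v)
    (hT : ∀ d, ∃ c : ℂ, ρ (dg d) v = c • v) :
    IsSubrep ρ (Submodule.span ℂ {x | ∃ u : GL (Fin n) ℂ, IsLow (u : Matrix (Fin n) (Fin n) ℂ) ∧ ρ u v = x}) := by
  set S := Submodule.span ℂ {x | ∃ u : GL (Fin n) ℂ, IsLow (u : Matrix (Fin n) (Fin n) ℂ) ∧ ρ u v = x} with hS
  have mem : ∀ u : GL (Fin n) ℂ, IsLow (u : Matrix (Fin n) (Fin n) ℂ) → ρ u v ∈ S := fun u hu =>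
    Submodule.subset_span ⟨u, hu, rfl⟩
  have red : ∀ g, (∀ u : GL (Fin n) ℂ, IsLow (u : Matrix (Fin n) (Fin n) ℂ) → ρ g (ρ u v) ∈ S) →
      ∀ x ∈ S, ρ g x ∈ S := by
    intro g hg x hx
    have : S ≤ S.comap (ρ g) := by
      conv_lhs => rw [hS]
      rw [Submodule.span_le]
      rintro _ ⟨u, hu, rfl⟩
      exact hg u hu
    exact this hx
  intro g
  refine gl_induction_simple (p := fun g => ∀ x ∈ S, ρ g x ∈ S) ?_ ?_ ?_ ?_ g
  · intro d
    refine red _ fun u hu => ?_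
    obtain ⟨c, hc⟩ := hT d
    have : ρ (dg d) (ρ u v) = c • ρ (dg d * u * (dg d)⁻¹) v := by
      rw [← map_smul, ← hc, ← Module.End.mul_apply, ← Module.End.mul_apply, ← map_mul, ← map_mul]
      simp
    rw [this]
    exact S.smul_mem _ (mem _ (hu.conj_dg d))
  · intro i j h c
    refine red _ fun u hu => ?_
    rw [← Module.End.mul_apply, ← map_mul]
    exact mem _ ((isLow_transvection h c).mul hu)
  · intro i j h c hij
    have claim1 : ∀ c d : ℂ, 1 + c * d ≠ 0 → ρ (tv i j h.ne c) (ρ (tv j i h.ne' d) v) ∈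
        Submodule.span ℂ (Set.range fun d => ρ (tv j i h.ne' d) v) := by
      intro c d hcd
      rw [← Module.End.mul_apply, ← map_mul, sl_two h (Units.mk0 _ hcd) rfl, map_mul, map_mul,
        Module.End.mul_apply, Module.End.mul_apply, hv i j h]
      obtain ⟨a, ha⟩ := hT (Function.update (Function.update 1 i (Units.mk0 _ hcd)) j (Units.mk0 _ hcd)⁻¹)
      rw [ha, map_smul]
      exact Submodule.smul_mem _ _ (Submodule.subset_span ⟨_, rfl⟩)
    have claim2 : ∀ d : ℂ, ρ (tv i j h.ne c) (ρ (tv j i h.ne' d) v) ∈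
        Submodule.span ℂ (Set.range fun d => ρ (tv j i h.ne' d) v) := by
      intro d
      by_cases hcd : 1 + c * d = 0
      · have h1 := mem_span_pow_succ (ρ (tv j i h.ne' d)) (fun x y hxy => by
          have := congrArg (ρ (tv j i h.ne' d)⁻¹) hxy
          rwa [← Module.End.mul_apply, ← Module.End.mul_apply, ← map_mul, inv_mul_cancel, map_one] at this)
          (ρ (tv j i h.ne' d) v)
        have : Submodule.span ℂ (Set.range fun k : ℕ =>
            (ρ (tv j i h.ne' d) ^ (k + 1)) (ρ (tv j i h.ne' d) v)) ≤
            (Submodule.span ℂ (Set.range fun d => ρ (tv j i h.ne' d) v)).comap (ρ (tv i j h.ne c)) := by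
          rw [Submodule.span_le]
          rintro _ ⟨k, rfl⟩
          have e : (ρ (tv j i h.ne' d) ^ (k + 1)) (ρ (tv j i h.ne' d) v) =
              ρ (tv j i h.ne' (((k + 1 : ℕ) : ℂ) * d + d)) v := by
            rw [← tv_mul_tv, ← tv_pow, map_mul, map_pow, Module.End.mul_apply]
          rw [SetLike.mem_coe, Submodule.mem_comap]
          beta_reduce
          rw [e]
          apply claim1
          have : 1 + c * (((k + 1 : ℕ) : ℂ) * d + d) = -((k + 1 : ℕ) : ℂ) := by
            push_cast
            linear_combination ((k : ℂ) + 2) * hcd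
          rw [this, neg_ne_zero, Nat.cast_ne_zero]
          omega
        exact this h1
      · exact claim1 c d hcd
    refine red _ fun u hu => ?_
    set d := (u : Matrix _ _ ℂ) j i with hd
    have hm : IsLow (((u * tv j i h.ne' (-d) : GL (Fin n) ℂ)) : Matrix (Fin n) (Fin n) ℂ) :=
      hu.mul (isLow_transvection h _)
    have hm' := hm.conj_simple hij (hu.mul_tv i j) c
    have e1 : ρ (tv i j h.ne c) (ρ u v) =
        ρ (tv i j h.ne c * (u * tv j i h.ne' (-d)) * tv i j h.ne (-c))
          (ρ (tv i j h.ne c) (ρ (tv j i h.ne' d) v)) := by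
      simp only [← Module.End.mul_apply, ← map_mul]
      congr 2
      rw [← tv_inv, ← tv_inv]
      group
    rw [e1]
    have : Submodule.span ℂ (Set.range fun d => ρ (tv j i h.ne' d) v) ≤
        S.comap (ρ (tv i j h.ne c * (u * tv j i h.ne' (-d)) * tv i j h.ne (-c))) := by
      rw [Submodule.span_le]
      rintro _ ⟨d', rfl⟩
      rw [SetLike.mem_coe, Submodule.mem_comap, ← Module.End.mul_apply, ← map_mul]
      exact mem _ (hm'.mul (isLow_transvection h d'))
    exact this (claim2 d)
  · intro g k hg hk x hx
    rw [map_mul, Module.End.mul_apply]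
    exact hg _ (hk x hx)

end

section
variable {n : ℕ} {V : Type*} [AddCommGroup V] [Module ℂ V] [FiniteDimensional ℂ V]

lemma exists_common_eigenvector {κ : Type*} (A : κ → V →ₗ[ℂ] V) (hA : ∀ k l x, A k (A l x) = A l (A k x)) :
    ∀ (m : ℕ) (U : Submodule ℂ V), Module.finrank ℂ U ≤ m → U ≠ ⊥ → (∀ k, ∀ x ∈ U, A k x ∈ U) →
      ∃ w ∈ U, w ≠ 0 ∧ ∀ k, ∃ c : ℂ, A k w = c • w := by
  intro m
  induction m with
  | zero =>
    intro U hU hU0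
    exact absurd (Submodule.finrank_eq_zero.1 (Nat.le_zero.1 hU)) hU0
  | succ m ih =>
    intro U hU hU0 hst
    by_cases hs : ∀ k, ∃ c : ℂ, ∀ x ∈ U, A k x = c • x
    · obtain ⟨w, hw, hw0⟩ := (Submodule.ne_bot_iff U).1 hU0
      exact ⟨w, hw, hw0, fun k => (hs k).imp fun c hc => hc w hw⟩
    · push Not at hs
      obtain ⟨k, hk⟩ := hs
      have : Nontrivial U := (Submodule.nontrivial_iff_ne_bot).2 hU0
      obtain ⟨c, hc⟩ := Module.End.exists_eigenvalue ((A k).restrict (hst k))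
      obtain ⟨x, hx⟩ := hc.exists_hasEigenvector
      have hx1 : A k x.1 = c • x.1 := congrArg Subtype.val hx.apply_eq_smul
      set U' := U ⊓ LinearMap.ker (A k - c • LinearMap.id) with hU'
      have mem : ∀ y, y ∈ U' ↔ y ∈ U ∧ A k y = c • y := fun y => by
        simp [hU', sub_eq_zero]
      obtain ⟨y, hy, hyc⟩ := hk c
      have hlt : U' < U := lt_of_le_of_ne inf_le_left fun h => hyc ((mem y).1 (h ▸ hy)).2
      obtain ⟨w, hw, h⟩ := ih U' (by have := Submodule.finrank_lt_finrank_of_lt hlt; omega)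
        ((Submodule.ne_bot_iff _).2 ⟨x.1, (mem _).2 ⟨x.2, hx1⟩, fun h => hx.2 (Subtype.ext h)⟩)
        (fun l z hz => (mem _).2 ⟨hst l z ((mem z).1 hz).1, by
          rw [hA, ((mem z).1 hz).2, map_smul]⟩)
      exact ⟨w, ((mem w).1 hw).1, h⟩

lemma eq_one_of_finite (f : Multiplicative ℂ →* ℂ) (hf : (Set.range f).Finite) (s : Multiplicative ℂ) :
    f s = 1 := by
  have h1 : (Set.range f.toHomUnits).Finite := by
    refine Set.Finite.of_finite_image (f := Units.val) (hf.subset ?_) Units.val_injective.injOn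
    rintro _ ⟨_, ⟨x, rfl⟩, rfl⟩
    exact ⟨x, rfl⟩
  have : Finite f.toHomUnits.range := h1
  set m := Nat.card f.toHomUnits.range with hm
  have hm0 : (m : ℂ) ≠ 0 := Nat.cast_ne_zero.2 Nat.card_pos.ne'
  let t : Multiplicative ℂ := Multiplicative.ofAdd (Multiplicative.toAdd s / m)
  have hst : s = t ^ m := by
    refine Multiplicative.toAdd.injective ?_
    rw [toAdd_pow, nsmul_eq_mul]
    simp only [t, toAdd_ofAdd]
    field_simp
  have h2 : (⟨f.toHomUnits t, t, rfl⟩ : f.toHomUnits.range) ^ m = 1 := pow_card_eq_one'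
  have h3 := congrArg Units.val (congrArg Subtype.val h2)
  rw [hst, map_pow]
  simpa using h3

lemma dg_conj_tv {i j : Fin n} (h : i ≠ j) (s : ℂˣ) :
    dg (Function.update 1 i s) * tv i j h 1 * (dg (Function.update 1 i s))⁻¹ = tv i j h s := by
  rw [mul_inv_eq_iff_eq_mul]
  refine Units.ext ?_
  ext a b
  simp only [Units.val_mul, coe_dg, coe_tv]
  rw [diagonal_mul, mul_diagonal]
  simp only [transvection, Matrix.add_apply, Matrix.single_apply, Matrix.one_apply]
  by_cases hab : a = b
  · subst hab
    have : ¬ (i = a ∧ j = a) := by rintro ⟨rfl, rfl⟩; exact h rfl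
    simp [this]
  · by_cases hij : i = a ∧ j = b
    · obtain ⟨rfl, rfl⟩ := hij
      simp [hab, Ne.symm hab]
    · simp [hab, hij]

lemma eigenvalue_tv (ρ : Representation ℂ (GL (Fin n) ℂ) V) {i j : Fin n} (h : i ≠ j) {w : V} (hw : w ≠ 0)
    (hc : ∀ s, ∃ c : ℂ, ρ (tv i j h s) w = c • w) (s : ℂ) : ρ (tv i j h s) w = w := by
  choose χ hχ using hc
  have inj : ∀ {a b : ℂ}, a • w = b • w → a = b := fun {a b} hab => smul_left_injective ℂ hw hab
  let f : Multiplicative ℂ →* ℂ :=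
    { toFun := fun s => χ (Multiplicative.toAdd s)
      map_one' := inj (by rw [toAdd_one, ← hχ, tv_zero, map_one, one_smul]; rfl)
      map_mul' := fun a b => inj (by
        rw [toAdd_mul, ← hχ, ← tv_mul_tv, map_mul, Module.End.mul_apply, hχ, map_smul, hχ, smul_smul,
          mul_comm]) }
  have hfin : (Set.range f).Finite := by
    refine ((Module.End.finite_hasEigenvalue (ρ (tv i j h 1))).insert 1).subset ?_
    rintro _ ⟨a, rfl⟩
    by_cases ha : Multiplicative.toAdd a = 0
    · left
      have : a = 1 := ha
      rw [this, map_one]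
    · right
      let g := dg (Function.update 1 i (Units.mk0 _ ha))
      have hg : ρ (tv i j h (Multiplicative.toAdd a)) = ρ g * ρ (tv i j h 1) * ρ g⁻¹ := by
        rw [← map_mul, ← map_mul, dg_conj_tv]; rfl
      have hgg : ∀ x, ρ g (ρ g⁻¹ x) = x := fun x => by
        rw [← Module.End.mul_apply, ← map_mul, mul_inv_cancel, map_one]; rfl
      have hgg' : ∀ x, ρ g⁻¹ (ρ g x) = x := fun x => by
        rw [← Module.End.mul_apply, ← map_mul, inv_mul_cancel, map_one]; rfl
      refine Module.End.hasEigenvalue_of_hasEigenvector (x := ρ g⁻¹ w) ⟨?_, fun h0 => hw ?_⟩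
      · rw [Module.End.mem_eigenspace_iff]
        have := hχ (Multiplicative.toAdd a)
        rw [hg, Module.End.mul_apply, Module.End.mul_apply] at this
        rw [← hgg' (ρ (tv i j h 1) _), this, map_smul]
        rfl
      · rw [← hgg w, h0, map_zero]
  have := eq_one_of_finite f hfin (Multiplicative.ofAdd s)
  have h1 : χ s = 1 := this
  rw [hχ, h1, one_smul]

lemma tv_commute {i j k l : Fin n} (hij : i ≠ j) (hkl : k ≠ l) (hjk : j ≠ k) (hli : l ≠ i) (c d : ℂ) :
    tv i j hij c * tv k l hkl d = tv k l hkl d * tv i j hij c := by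
  refine Units.ext ?_
  simp only [Units.val_mul, coe_tv, transvection, mul_add, add_mul, mul_one, one_mul,
    single_mul_single_of_ne _ _ _ _ hjk, single_mul_single_of_ne _ _ _ _ hli]
  abel

lemma tv_shift {i j k : Fin n} (hij : i ≠ j) (hjk : j ≠ k) (hik : i ≠ k) (c d : ℂ) :
    tv j k hjk d * tv i j hij c = tv i j hij c * (tv j k hjk d * tv i k hik (-(c * d))) := by
  refine Units.ext ?_
  simp only [Units.val_mul, coe_tv, transvection, mul_add, add_mul, mul_one, one_mul,
    single_mul_single_of_ne _ _ _ _ hik.symm, single_mul_single_of_ne _ _ _ _ hij.symm,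
    single_mul_single_same, add_zero]
  have : single i k (c * d) + single i k (-(c * d)) = 0 := by rw [← single_add, add_neg_cancel, single_zero]
  rw [add_assoc (1 + _), add_add_add_comm, add_comm (single i j c) (single i k _), ← add_assoc, ← add_assoc,
    add_assoc (1 + _) (single i k _), this, add_zero]

/-- A nonzero finite-dimensional representation of `GL_n` has a nonzero vector fixed by the upper
transvections. -/
theorem exists_fixed_vector [Nontrivial V] (ρ : Representation ℂ (GL (Fin n) ℂ) V) :
    ∃ v : V, v ≠ 0 ∧ ∀ (i j : Fin n) (h : i < j) c, ρ (tv i j h.ne c) v = v := by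
  have key : ∀ m : ℕ, ∃ v : V, v ≠ 0 ∧
      ∀ (i j : Fin n) (h : i < j) c, n ≤ j + m → ρ (tv i j h.ne c) v = v := by
    intro m
    induction m with
    | zero =>
      obtain ⟨v, hv⟩ := exists_ne (0 : V)
      exact ⟨v, hv, fun i j h c hj => absurd j.2 (by omega)⟩
    | succ m ih =>
      obtain ⟨v, hv0, hv⟩ := ih
      by_cases hm : m + 1 ≤ n
      swap
      · exact ⟨v, hv0, fun i j h c _ => hv i j h c (by omega)⟩
      let j : Fin n := ⟨n - (m + 1), by omega⟩
      let U : Submodule ℂ V := ⨅ (p : {p : Fin n × Fin n // p.1 < p.2 ∧ n ≤ p.2 + m}), ⨅ (c : ℂ),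
        LinearMap.ker (ρ (tv p.1.1 p.1.2 p.2.1.ne c) - LinearMap.id)
      have mem : ∀ x, x ∈ U ↔ ∀ (i k : Fin n) (h : i < k) c, n ≤ k + m → ρ (tv i k h.ne c) x = x := by
        intro x
        simp only [U, Submodule.mem_iInf, LinearMap.mem_ker, LinearMap.sub_apply, LinearMap.id_apply,
          sub_eq_zero, Subtype.forall, Prod.forall]
        exact ⟨fun H i k h c hk => H i k ⟨h, hk⟩ c, fun H i k h c => H i k h.1 c h.2⟩
      let A : (Set.Iio j) × ℂ → V →ₗ[ℂ] V := fun p => ρ (tv p.1.1 j p.1.2.ne p.2)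
      obtain ⟨w, hwU, hw0, hw⟩ := exists_common_eigenvector A (by
        rintro ⟨⟨i, hi⟩, c⟩ ⟨⟨k, hk⟩, d⟩ x
        simp only [A, ← Module.End.mul_apply, ← map_mul]
        have hi' : i < j := hi
        have hk' : k < j := hk
        rw [tv_commute _ _ hk'.ne' hi'.ne']) _ U le_rfl
        ((Submodule.ne_bot_iff _).2 ⟨v, (mem v).2 hv, hv0⟩) (by
        rintro ⟨⟨i, hi⟩, c⟩ x hx
        have hi' : i < j := hi
        rw [mem] at hx ⊢
        intro k l h d hl
        have hjl : j < l := Fin.lt_def.2 (by simp only [j]; omega)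
        simp only [A]
        by_cases hkj : k = j
        · subst hkj
          rw [← Module.End.mul_apply, ← map_mul, tv_shift hi'.ne h.ne (hi'.trans h).ne, map_mul, map_mul,
            Module.End.mul_apply, Module.End.mul_apply, hx i l (hi'.trans h) _ hl, hx _ l h _ hl]
        · rw [← Module.End.mul_apply, ← map_mul, tv_commute _ _ (hi'.trans hjl).ne' (Ne.symm hkj),
            map_mul, Module.End.mul_apply, hx k l h _ hl])
      refine ⟨w, hw0, fun i k h c hk => ?_⟩
      by_cases hkj : k = j
      · subst hkj
        exact eigenvalue_tv ρ h.ne hw0 (fun s => hw (⟨i, h⟩, s)) c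
      · refine (mem w).1 hwU i k h c ?_
        have : (k : ℕ) ≠ n - (m + 1) := fun h => hkj (Fin.ext h)
        omega
  obtain ⟨v, hv0, hv⟩ := key n
  exact ⟨v, hv0, fun i j h c => hv i j h c (by omega)⟩

end

section
variable {n : ℕ} {ι : Type} [Fintype ι]

/-- The tensor power `A ⊗ ⋯ ⊗ A` indexed by `ι`. -/
def tpow (ι : Type) [Fintype ι] (A : Matrix (Fin n) (Fin n) ℂ) : Matrix (ι → Fin n) (ι → Fin n) ℂ :=
  Matrix.of fun f f' => ∏ b, A (f b) (f' b)

lemma prod_one_apply (f f' : ι → Fin n) :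
    ∏ b, (1 : Matrix (Fin n) (Fin n) ℂ) (f b) (f' b) = if f = f' then 1 else 0 := by
  by_cases h : f = f'
  · rw [if_pos h]
    exact Finset.prod_eq_one fun b _ => by rw [h, Matrix.one_apply_eq]
  · obtain ⟨b, hb⟩ := Function.ne_iff.1 h
    rw [if_neg h]
    exact Finset.prod_eq_zero (Finset.mem_univ b) (Matrix.one_apply_ne hb)

lemma tpow_one : tpow ι (1 : Matrix (Fin n) (Fin n) ℂ) = 1 := by
  ext f f'
  rw [tpow, Matrix.of_apply, prod_one_apply, Matrix.one_apply]

lemma tpow_conjTranspose (A : Matrix (Fin n) (Fin n) ℂ) : tpow ι Aᴴ = (tpow ι A)ᴴ := by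
  ext f f'
  simp [tpow, conjTranspose_apply]

variable [DecidableEq ι]

lemma tpow_mul (A C : Matrix (Fin n) (Fin n) ℂ) : tpow ι (A * C) = tpow ι A * tpow ι C := by
  ext f f'
  simp only [tpow, Matrix.of_apply, Matrix.mul_apply, ← Finset.prod_mul_distrib]
  rw [Finset.prod_univ_sum, Fintype.piFinset_univ]

/-- The tensor power representation of `GL_n`. -/
def ten (ι : Type) [Fintype ι] [DecidableEq ι] (n : ℕ) :
    Representation ℂ (GL (Fin n) ℂ) ((ι → Fin n) → ℂ) where
  toFun g := (tpow ι (g : Matrix (Fin n) (Fin n) ℂ)).mulVecLin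
  map_one' := by rw [Units.val_one, tpow_one, mulVecLin_one]; rfl
  map_mul' g h := by rw [Units.val_mul, tpow_mul, mulVecLin_mul]; rfl

lemma ten_apply (g : GL (Fin n) ℂ) (x : (ι → Fin n) → ℂ) :
    ten ι n g x = tpow ι (g : Matrix (Fin n) (Fin n) ℂ) *ᵥ x := rfl

/-- Orthogonal projections commuting with `GL_n`. -/
structure IsProj (P : Matrix (ι → Fin n) (ι → Fin n) ℂ) : Prop where
  mul_self : P * P = P
  herm : Pᴴ = P
  comm : ∀ g : GL (Fin n) ℂ, P * tpow ι (g : Matrix (Fin n) (Fin n) ℂ) = tpow ι (g : Matrix (Fin n) (Fin n) ℂ) * P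

lemma exists_isProj (X : Submodule ℂ ((ι → Fin n) → ℂ)) (hX : IsSubrep (ten ι n) X) :
    ∃ P, IsProj P ∧ ∀ x, P *ᵥ x = x ↔ x ∈ X := by
  let K : Submodule ℂ (EuclideanSpace ℂ (ι → Fin n)) :=
    X.comap (WithLp.linearEquiv 2 ℂ ((ι → Fin n) → ℂ)).toLinearMap
  let P : Matrix (ι → Fin n) (ι → Fin n) ℂ := Matrix.toEuclideanLin.symm K.starProjection.toLinearMap
  have hP : ∀ x, P *ᵥ x = WithLp.ofLp (K.starProjection (WithLp.toLp 2 x)) := fun x => by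
    have h1 := toLpLin_toLp 2 2 P x
    rw [LinearEquiv.apply_symm_apply] at h1
    exact (congrArg WithLp.ofLp h1).symm
  have hm : ∀ x, WithLp.toLp 2 x ∈ K ↔ x ∈ X := fun x => Iff.rfl
  have mem : ∀ x, P *ᵥ x = x ↔ x ∈ X := fun x => by
    rw [← hm, ← Submodule.starProjection_eq_self_iff, hP]
    exact ⟨fun h => congrArg (WithLp.toLp 2) h, fun h => congrArg WithLp.ofLp h⟩
  have mem' : ∀ x, P *ᵥ x ∈ X := fun x => by
    rw [← hm, hP]
    exact K.starProjection_apply_mem _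
  have mul_self : P * P = P := Matrix.ext_of_mulVec_single fun i => by
    rw [← Matrix.mulVec_mulVec]; exact (mem _).2 (mem' _)
  have herm : Pᴴ = P := by
    refine isSymmetric_toEuclideanLin_iff.1 ?_
    rw [LinearEquiv.apply_symm_apply]
    exact K.starProjection_isSymmetric
  refine ⟨P, ⟨mul_self, herm, fun g => ?_⟩, mem⟩
  have h1 : ∀ g : GL (Fin n) ℂ, P * (tpow ι (g : Matrix (Fin n) (Fin n) ℂ) * P)
      = tpow ι (g : Matrix (Fin n) (Fin n) ℂ) * P := fun g =>
    Matrix.ext_of_mulVec_single fun i => by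
      rw [← Matrix.mulVec_mulVec, ← Matrix.mulVec_mulVec]; exact (mem _).2 (hX g _ (mem' _))
  have h2 := congrArg conjTranspose (h1 (Star.star g))
  simp only [conjTranspose_mul, herm] at h2
  have h3 : (tpow ι ((Star.star g : GL (Fin n) ℂ) : Matrix (Fin n) (Fin n) ℂ))ᴴ
      = tpow ι (g : Matrix (Fin n) (Fin n) ℂ) := by
    rw [← tpow_conjTranspose, Units.coe_star, star_eq_conjTranspose, conjTranspose_conjTranspose]
  rw [h3, mul_assoc, h1] at h2
  exact h2.symm

end

section
variable {n : ℕ} {ι : Type} [Fintype ι]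

/-- The content of an index of the tensor power. -/
def ct (f : ι → Fin n) : Fin n → ℤ := fun i => ((Finset.univ.filter fun b => f b = i).card : ℤ)

lemma prod_eq_ct (d : Fin n → ℂˣ) (f : ι → Fin n) : ∏ b, (d (f b) : ℂ) = ∏ i, (d i : ℂ) ^ ct f i := by
  simp only [ct, zpow_natCast]
  rw [← Finset.prod_fiberwise_of_maps_to (g := f) (t := Finset.univ) (fun b _ => Finset.mem_univ _)]
  refine Finset.prod_congr rfl fun i _ => ?_
  rw [Finset.prod_congr rfl fun b hb => by rw [(Finset.mem_filter.1 hb).2], Finset.prod_const]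

lemma sum_ct (d : Fin n → ℤ) (f : ι → Fin n) : ∑ i, d i * ct f i = ∑ b, d (f b) := by
  rw [← Finset.sum_fiberwise_of_maps_to (g := f) (t := Finset.univ) (fun b _ => Finset.mem_univ _)]
  refine Finset.sum_congr rfl fun i _ => ?_
  rw [Finset.sum_congr rfl fun b hb => by rw [(Finset.mem_filter.1 hb).2], Finset.sum_const, ct,
    nsmul_eq_mul, mul_comm]

lemma eq_of_zpow {a b : Fin n → ℤ} (h : ∀ d : Fin n → ℂˣ, ∏ i, (d i : ℂ) ^ a i = ∏ i, (d i : ℂ) ^ b i) :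
    a = b := by
  funext i
  have := h (Function.update 1 i (Units.mk0 2 two_ne_zero))
  rw [Finset.prod_eq_single i (fun j _ hj => by simp [hj]) (by simp),
    Finset.prod_eq_single i (fun j _ hj => by simp [hj]) (by simp)] at this
  simp only [Function.update_self, Units.val_mk0] at this
  have h2 : ((2 : ℝ) ^ a i) = (2 : ℝ) ^ b i := by simpa using congrArg norm this
  exact zpow_right_injective₀ (by norm_num) (by norm_num) h2

lemma tpow_dg (d : Fin n → ℂˣ) [DecidableEq ι] : tpow ι (dg d : Matrix (Fin n) (Fin n) ℂ)
    = diagonal fun f => ∏ i, (d i : ℂ) ^ ct f i := by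
  ext f f'
  rw [tpow, Matrix.of_apply, coe_dg]
  by_cases h : f = f'
  · subst h
    rw [diagonal_apply_eq, ← prod_eq_ct]
    exact Finset.prod_congr rfl fun b _ => diagonal_apply_eq _ _
  · rw [diagonal_apply_ne _ h]
    obtain ⟨b, hb⟩ := Function.ne_iff.1 h
    exact Finset.prod_eq_zero (Finset.mem_univ b) (diagonal_apply_ne _ hb)

variable [DecidableEq ι]

lemma ten_dg (d : Fin n → ℂˣ) (x : (ι → Fin n) → ℂ) (f : ι → Fin n) :
    ten ι n (dg d) x f = (∏ i, (d i : ℂ) ^ ct f i) * x f := by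
  rw [ten_apply, tpow_dg, mulVec_diagonal]

lemma IsProj.apply_eq_zero {P : Matrix (ι → Fin n) (ι → Fin n) ℂ} (hP : IsProj P) {f f' : ι → Fin n}
    (h : P f f' ≠ 0) : ct f = ct f' := by
  refine eq_of_zpow fun d => ?_
  have := congrFun (congrFun (hP.comm (dg d)) f) f'
  rw [tpow_dg, mul_diagonal, diagonal_mul, mul_comm] at this
  exact (mul_right_cancel₀ h this).symm

lemma weight_support {x : (ι → Fin n) → ℂ} {a : Fin n → ℤ}
    (hx : ∀ d, ten ι n (dg d) x = (∏ i, (d i : ℂ) ^ a i) • x) {f : ι → Fin n} (h : x f ≠ 0) : ct f = a := by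
  refine eq_of_zpow fun d => ?_
  have := congrFun (hx d) f
  rw [ten_dg, Pi.smul_apply, smul_eq_mul] at this
  exact mul_right_cancel₀ h this

lemma ten_dg_eq {x : (ι → Fin n) → ℂ} {a : Fin n → ℤ} (hx : ∀ f, x f ≠ 0 → ct f = a) (d : Fin n → ℂˣ) :
    ten ι n (dg d) x = (∏ i, (d i : ℂ) ^ a i) • x := by
  funext f
  rw [ten_dg, Pi.smul_apply, smul_eq_mul]
  by_cases h : x f = 0
  · simp [h]
  · rw [hx f h]

/-- The action of the elementary matrix `E_{ij}`. -/
def el (i j : Fin n) (x : (ι → Fin n) → ℂ) : (ι → Fin n) → ℂ :=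
  fun f => ∑ b, if f b = i then x (Function.update f b j) else 0

lemma hasDerivAt_ten {i j : Fin n} (h : i ≠ j) (x : (ι → Fin n) → ℂ) (f : ι → Fin n) :
    HasDerivAt (fun s => ten ι n (tv i j h s) x f) (el i j x f) 0 := by
  have h1 : ∀ f' : ι → Fin n, ∀ b, HasDerivAt (fun s => transvection i j s (f b) (f' b))
      (if i = f b ∧ j = f' b then 1 else 0 : ℂ) 0 := by
    intro f' b
    simp only [transvection, Matrix.add_apply, Matrix.single_apply]
    split_ifs with hb
    · simpa using (hasDerivAt_id (0 : ℂ)).const_add ((1 : Matrix (Fin n) (Fin n) ℂ) (f b) (f' b))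
    · exact hasDerivAt_const _ _
  have h2 : ∀ f' : ι → Fin n, HasDerivAt (fun s => ∏ b, transvection i j s (f b) (f' b))
      (∑ b, if f b = i ∧ f' = Function.update f b j then (1 : ℂ) else 0) 0 := by
    intro f'
    have := HasDerivAt.fun_finsetProd (u := Finset.univ) fun b _ => h1 f' b
    refine this.congr_deriv (Finset.sum_congr rfl fun b _ => ?_)
    simp only [transvection_zero, smul_eq_mul, mul_ite, mul_one, mul_zero]
    by_cases hu : f' = Function.update f b j
    · have : ∏ b' ∈ Finset.univ.erase b, (1 : Matrix (Fin n) (Fin n) ℂ) (f b') (f' b') = 1 :=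
        Finset.prod_eq_one fun b' hb' => by
          rw [hu, Function.update_of_ne (Finset.ne_of_mem_erase hb'), Matrix.one_apply_eq]
      rw [this]
      simp [hu, eq_comm]
    · have hn : ¬(f b = i ∧ f' = Function.update f b j) := fun h => hu h.2
      rw [if_neg hn]
      split_ifs with hb
      · by_contra h0
        refine hu (funext fun b' => ?_)
        rcases eq_or_ne b' b with rfl | hb'
        · simp [hb.2]
        · rw [Function.update_of_ne hb']
          by_contra hne
          exact h0 (Finset.prod_eq_zero (Finset.mem_erase.2 ⟨hb', Finset.mem_univ _⟩)
            (Matrix.one_apply_ne fun e => hne e.symm))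
      · rfl
  have h3 := HasDerivAt.fun_sum (u := Finset.univ) fun f' _ => (h2 f').mul_const (x f')
  refine h3.congr_deriv ?_
  simp only [el, Finset.sum_mul, ite_mul, one_mul, zero_mul]
  rw [Finset.sum_comm]
  refine Finset.sum_congr rfl fun b _ => ?_
  by_cases hb : f b = i
  · simp [hb]
  · simp [hb]

end

section
variable {n : ℕ} {ι : Type} [Fintype ι] [DecidableEq ι]

/-- The matrix of `el i j`. -/
def eM (ι : Type) [Fintype ι] [DecidableEq ι] (i j : Fin n) : Matrix (ι → Fin n) (ι → Fin n) ℂ :=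
  Matrix.of fun f f' => ∑ b, if f b = i ∧ f' = Function.update f b j then 1 else 0

lemma eM_mulVec (i j : Fin n) (x : (ι → Fin n) → ℂ) : eM ι i j *ᵥ x = el i j x := by
  funext f
  simp only [mulVec, dotProduct, eM, el, Matrix.of_apply, Finset.sum_mul, ite_mul, one_mul, zero_mul]
  rw [Finset.sum_comm]
  refine Finset.sum_congr rfl fun b _ => ?_
  by_cases hb : f b = i
  · simp [hb]
  · simp [hb]

lemma IsProj.eM_comm {P : Matrix (ι → Fin n) (ι → Fin n) ℂ} (hP : IsProj P) {i j : Fin n} (h : i ≠ j) :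
    P * eM ι i j = eM ι i j * P := by
  refine Matrix.ext_of_mulVec_single fun f' => ?_
  rw [← Matrix.mulVec_mulVec, ← Matrix.mulVec_mulVec, eM_mulVec, eM_mulVec]
  set x : (ι → Fin n) → ℂ := Pi.single f' 1
  funext f
  have h1 : HasDerivAt (fun s => ∑ f', P f f' * ten ι n (tv i j h s) x f')
      (∑ f', P f f' * el i j x f') 0 :=
    HasDerivAt.fun_sum fun f' _ => (hasDerivAt_ten h x f').const_mul (P f f')
  refine h1.unique ((hasDerivAt_ten h (P *ᵥ x) f).congr_of_eventuallyEq (Filter.Eventually.of_forall fun s => ?_))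
  change (P *ᵥ (tpow ι _ *ᵥ x)) f = (tpow ι _ *ᵥ (P *ᵥ x)) f
  rw [Matrix.mulVec_mulVec, Matrix.mulVec_mulVec, hP.comm]

lemma el_eq_zero {i j : Fin n} (h : i ≠ j) {x : (ι → Fin n) → ℂ} (hx : ∀ s, ten ι n (tv i j h s) x = x) :
    el i j x = 0 := by
  funext f
  refine (hasDerivAt_ten h x f).unique ((hasDerivAt_const (0 : ℂ) (x f)).congr_of_eventuallyEq
    (Filter.Eventually.of_forall fun s => congrFun (hx s) f))

lemma el_self (i : Fin n) (x : (ι → Fin n) → ℂ) (f : ι → Fin n) : el i i x f = ct f i * x f := by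
  simp only [el, ct]
  have : ∀ b, (if f b = i then x (Function.update f b i) else 0) = if f b = i then x f else 0 := fun b => by
    split_ifs with hb
    · rw [← hb, Function.update_eq_self]
    · rfl
  rw [Finset.sum_congr rfl fun b _ => this b, ← Finset.sum_filter, Finset.sum_const, nsmul_eq_mul]
  simp

lemma el_el (i j : Fin n) (x : (ι → Fin n) → ℂ) (f : ι → Fin n) :
    el i j (el j i x) f = ∑ b, if f b = i then
      x f + ∑ b', (if b' ≠ b ∧ f b' = j then x (f ∘ Equiv.swap b b') else 0) else 0 := by
  rw [el]
  refine Finset.sum_congr rfl fun b _ => ?_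
  by_cases hb : f b = i
  · rw [if_pos hb, if_pos hb, el, ← Finset.add_sum_erase _ _ (Finset.mem_univ b)]
    congr 1
    · simp [← hb]
    · rw [← Finset.sum_erase (Finset.univ) (a := b) (by simp)]
      refine Finset.sum_congr rfl fun b' hb' => ?_
      have hne := Finset.ne_of_mem_erase hb'
      simp only [Function.update_of_ne hne, hne, ne_eq, not_false_iff, true_and]
      by_cases h : f b' = j
      · rw [if_pos h, if_pos h]
        congr 1
        funext c
        rcases eq_or_ne c b' with rfl | h1
        · simp [hb]
        rcases eq_or_ne c b with rfl | h2
        · simp [h1, h]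
        simp [h1, h2, Equiv.swap_apply_of_ne_of_ne]
      · rw [if_neg h, if_neg h]
  · rw [if_neg hb, if_neg hb]

lemma el_comm {i j : Fin n} (x : (ι → Fin n) → ℂ) (f : ι → Fin n) :
    el i j (el j i x) f = el j i (el i j x) f + ((ct f i : ℂ) - ct f j) * x f := by
  have key : ∀ i j : Fin n, el i j (el j i x) f = ct f i * x f + ∑ b, ∑ b',
      if f b = i ∧ b' ≠ b ∧ f b' = j then x (f ∘ Equiv.swap b b') else 0 := fun i j => by
    rw [el_el, ← el_self, el, ← Finset.sum_add_distrib]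
    refine Finset.sum_congr rfl fun b _ => ?_
    by_cases hb : f b = i
    · simp only [hb, if_true, true_and]
      rw [← hb, Function.update_eq_self]
    · simp [hb]
  rw [key, key, Finset.sum_comm]
  have : ∀ b b' : ι, (if f b' = i ∧ b ≠ b' ∧ f b = j then x (f ∘ Equiv.swap b' b) else 0)
      = if f b = j ∧ b' ≠ b ∧ f b' = i then x (f ∘ Equiv.swap b b') else 0 := fun b b' => by
    rw [Equiv.swap_comm b' b]
    refine if_congr ?_ rfl rfl
    tauto
  simp only [this]
  ring

/-- The Casimir operator. -/
def cas (x : (ι → Fin n) → ℂ) : (ι → Fin n) → ℂ := ∑ i, ∑ j, el i j (el j i x)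

lemma cas_apply (x : (ι → Fin n) → ℂ) (f : ι → Fin n) :
    cas x f = n * Fintype.card ι * x f + ∑ b, ∑ b', if b' ≠ b then x (f ∘ Equiv.swap b b') else 0 := by
  simp only [cas, Finset.sum_apply, el_el]
  have : ∀ b, (∑ i, ∑ j, if f b = i then
      x f + ∑ b', (if b' ≠ b ∧ f b' = j then x (f ∘ Equiv.swap b b') else 0) else 0)
      = n * x f + ∑ b', if b' ≠ b then x (f ∘ Equiv.swap b b') else 0 := fun b => by
    rw [Finset.sum_comm]
    simp only [Finset.sum_ite_eq, Finset.mem_univ, if_true, Finset.sum_add_distrib, Finset.sum_const,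
      Finset.card_univ, Fintype.card_fin, nsmul_eq_mul]
    congr 1
    rw [Finset.sum_comm]
    refine Finset.sum_congr rfl fun b' _ => ?_
    by_cases h : b' = b
    · simp [h]
    · simp [h]
  rw [Finset.sum_congr rfl fun i _ => Finset.sum_comm, Finset.sum_comm]
  rw [Finset.sum_congr rfl fun b _ => this b, Finset.sum_add_distrib, Finset.sum_const, Finset.card_univ,
    nsmul_eq_mul]
  ring

omit [DecidableEq ι] in
lemma tpow_comp (A : Matrix (Fin n) (Fin n) ℂ) (σ : Equiv.Perm ι) (f f' : ι → Fin n) :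
    tpow ι A (f ∘ σ) (f' ∘ σ) = tpow ι A f f' := by
  simp only [tpow, Matrix.of_apply, Function.comp]
  exact Equiv.prod_comp σ fun b => A (f b) (f' b)

lemma ten_comp (g : GL (Fin n) ℂ) (x : (ι → Fin n) → ℂ) (σ : Equiv.Perm ι) (f : ι → Fin n) :
    ten ι n g x (f ∘ σ) = ten ι n g (fun f => x (f ∘ σ)) f := by
  rw [ten_apply, ten_apply, mulVec, mulVec, dotProduct, dotProduct]
  refine (Equiv.sum_comp (Equiv.arrowCongr σ.symm (Equiv.refl (Fin n))) _).symm.trans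
    (Finset.sum_congr rfl fun f' _ => ?_)
  have : (Equiv.arrowCongr σ.symm (Equiv.refl (Fin n))) f' = f' ∘ σ := by ext b; simp
  rw [this, tpow_comp]

lemma cas_ten (g : GL (Fin n) ℂ) (x : (ι → Fin n) → ℂ) : cas (ten ι n g x) = ten ι n g (cas x) := by
  have : cas x = ((n : ℂ) * Fintype.card ι) • x
      + ∑ b, ∑ b', if b' ≠ b then (fun f => x (f ∘ Equiv.swap b b')) else 0 := by
    funext f
    rw [cas_apply, Pi.add_apply, Pi.smul_apply, smul_eq_mul]
    simp only [Finset.sum_apply]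
    congr 1
    refine Finset.sum_congr rfl fun b _ => Finset.sum_congr rfl fun b' _ => ?_
    split_ifs <;> rfl
  rw [this, map_add, map_smul]
  funext f
  rw [cas_apply, Pi.add_apply, Pi.smul_apply, smul_eq_mul]
  simp only [map_sum, Finset.sum_apply]
  congr 1
  refine Finset.sum_congr rfl fun b _ => Finset.sum_congr rfl fun b' _ => ?_
  split_ifs
  · rw [ten_comp]
  · simp

/-- Highest weight vectors of a tensor power. -/
structure IsHW (x : (ι → Fin n) → ℂ) (a : Fin n → ℤ) : Prop where
  ne_zero : x ≠ 0
  fixed : ∀ (i j : Fin n) (h : i < j) (c : ℂ), ten ι n (tv i j h.ne c) x = x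
  weight : ∀ f, x f ≠ 0 → ct f = a

lemma IsHW.ct_mul {x : (ι → Fin n) → ℂ} {a : Fin n → ℤ} (hx : IsHW x a) (f : ι → Fin n) (φ : (Fin n → ℤ) → ℂ) :
    φ (ct f) * x f = φ a * x f := by
  by_cases h : x f = 0
  · simp [h]
  · rw [hx.weight f h]

lemma el_zero (i j : Fin n) : el i j (0 : (ι → Fin n) → ℂ) = 0 := by
  funext f
  simp [el]

/-- The eigenvalue of the Casimir operator at highest weight `a`. -/
def casVal (a : Fin n → ℤ) : ℂ :=
  ∑ i, ∑ j, if i = j then (a i : ℂ) ^ 2 else if i < j then (a i : ℂ) - a j else 0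

lemma IsHW.cas {x : (ι → Fin n) → ℂ} {a : Fin n → ℤ} (hx : IsHW x a) : cas x = casVal a • x := by
  have h0 : ∀ i j : Fin n, i < j → el i j x = 0 := fun i j h => el_eq_zero h.ne fun s => hx.fixed i j h s
  funext f
  simp only [StableGL.cas, casVal, Finset.sum_apply, Pi.smul_apply, smul_eq_mul, Finset.sum_mul]
  refine Finset.sum_congr rfl fun i _ => Finset.sum_congr rfl fun j _ => ?_
  split_ifs with h1 h2
  · subst h1
    rw [el_self, el_self, ← mul_assoc, ← sq]
    exact hx.ct_mul f fun c => (c i : ℂ) ^ 2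
  · rw [el_comm, h0 i j h2, el_zero]
    have := hx.ct_mul f fun c => (c i : ℂ) - c j
    simpa using this
  · rw [h0 j i (by omega), el_zero]
    simp

lemma cas_add (x y : (ι → Fin n) → ℂ) : cas (x + y) = StableGL.cas x + StableGL.cas y := by
  simp only [StableGL.cas, ← eM_mulVec, mulVec_add, Finset.sum_add_distrib]

lemma cas_smul (c : ℂ) (x : (ι → Fin n) → ℂ) : cas (c • x) = c • StableGL.cas x := by
  simp only [StableGL.cas, ← eM_mulVec, mulVec_smul, Finset.smul_sum]

/-- The subrepresentation generated by a vector. -/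
def gspan (x : (ι → Fin n) → ℂ) : Submodule ℂ ((ι → Fin n) → ℂ) :=
  Submodule.span ℂ (Set.range fun g => ten ι n g x)

lemma gspan_subrep (x : (ι → Fin n) → ℂ) : IsSubrep (ten ι n) (gspan x) := fun g y hy => by
  induction hy using Submodule.span_induction with
  | mem y hy =>
    obtain ⟨g', rfl⟩ := hy
    exact Submodule.subset_span ⟨g * g', by simp [map_mul]⟩
  | zero => rw [map_zero]; exact Submodule.zero_mem _
  | add y z _ _ hy hz => rw [map_add]; exact Submodule.add_mem _ hy hz
  | smul c y _ hy => rw [map_smul]; exact Submodule.smul_mem _ c hy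

lemma mem_gspan (x : (ι → Fin n) → ℂ) : x ∈ gspan x :=
  Submodule.subset_span ⟨1, by simp⟩

lemma gspan_le {x : (ι → Fin n) → ℂ} {X : Submodule ℂ ((ι → Fin n) → ℂ)} (hX : IsSubrep (ten ι n) X)
    (hx : x ∈ X) : gspan x ≤ X :=
  Submodule.span_le.2 (by rintro _ ⟨g, rfl⟩; exact hX g x hx)

lemma IsHW.cas_gspan {x : (ι → Fin n) → ℂ} {a : Fin n → ℤ} (hx : IsHW x a) {y : (ι → Fin n) → ℂ}
    (hy : y ∈ gspan x) : StableGL.cas y = casVal a • y := by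
  induction hy using Submodule.span_induction with
  | mem y hy =>
    obtain ⟨g', rfl⟩ := hy
    change StableGL.cas (ten ι n g' x) = casVal a • ten ι n g' x
    rw [cas_ten, hx.cas, map_smul]
  | zero => simpa using cas_smul 0 (0 : (ι → Fin n) → ℂ)
  | add y z _ _ hy hz => rw [cas_add, hy, hz, smul_add]
  | smul c y _ hy => rw [cas_smul, hy, smul_comm]

lemma IsHW.cas_mul {x : (ι → Fin n) → ℂ} {a : Fin n → ℤ} (hx : IsHW x a)
    {P : Matrix (ι → Fin n) (ι → Fin n) ℂ} (hP : ∀ y, P *ᵥ y ∈ gspan x) :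
    ∑ i, ∑ j, eM ι i j * eM ι j i * P = casVal a • P := by
  refine Matrix.ext_of_mulVec_single fun f' => ?_
  rw [smul_mulVec, ← hx.cas_gspan (hP _)]
  simp only [Matrix.sum_mulVec, StableGL.cas, ← eM_mulVec, Matrix.mulVec_mulVec, mul_assoc]

lemma eM_self (i : Fin n) : eM ι i i = diagonal fun f => (ct f i : ℂ) :=
  Matrix.ext_of_mulVec_single fun f' => by
    rw [eM_mulVec]
    funext f
    rw [el_self, mulVec_diagonal]

lemma eM_bracket (i j : Fin n) :
    eM ι i j * eM ι j i = eM ι j i * eM ι i j + diagonal fun f => (ct f i : ℂ) - ct f j :=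
  Matrix.ext_of_mulVec_single fun f' => by
    rw [Matrix.add_mulVec, ← Matrix.mulVec_mulVec, ← Matrix.mulVec_mulVec]
    simp only [eM_mulVec]
    funext f
    rw [Pi.add_apply, el_comm, mulVec_diagonal]

lemma eM_weight {i j : Fin n} {f f' : ι → Fin n} (h : eM ι i j f f' ≠ 0) :
    ct f + Pi.single j 1 = ct f' + Pi.single i 1 := by
  obtain ⟨b, -, hb⟩ := Finset.exists_ne_zero_of_sum_ne_zero (s := Finset.univ) h
  obtain ⟨rfl, rfl⟩ : f b = i ∧ f' = Function.update f b j := by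
    by_contra h; exact hb (if_neg h)
  funext k
  have := sum_ct (Pi.single k 1) f
  have h2 := sum_ct (Pi.single k 1) (Function.update f b j)
  simp only [Pi.single_apply, ite_mul, one_mul, zero_mul, Finset.sum_ite_eq', Finset.mem_univ, if_true] at this h2
  rw [Pi.add_apply, Pi.add_apply, this, h2, Pi.single_apply, Pi.single_apply,
    ← Finset.add_sum_erase _ _ (Finset.mem_univ b),
    ← Finset.add_sum_erase _ (fun c => if Function.update f b j c = k then (1 : ℤ) else 0) (Finset.mem_univ b)]
  have h3 : ∀ c ∈ Finset.univ.erase b, (if Function.update f b j c = k then (1 : ℤ) else 0)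
      = if f c = k then 1 else 0 := fun c hc => by rw [Function.update_of_ne (Finset.ne_of_mem_erase hc)]
  rw [Finset.sum_congr rfl h3]
  simp only [Function.update_self, eq_comm (a := k)]
  ring

end

/-- Laurent polynomials with complex coefficients. -/
abbrev LauC (n : ℕ) := AddMonoidAlgebra ℂ (Fin n → ℤ)

section
variable {n : ℕ}

/-- Extension of scalars to `ℂ`. -/
def toC : Lau n →+* LauC n := AddMonoidAlgebra.mapRingHom (Fin n → ℤ) (Int.castRingHom ℂ)

lemma coeff_toC (F : Lau n) (a : Fin n → ℤ) : (toC F).coeff a = (F.coeff a : ℂ) := by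
  simp [toC]

lemma toC_injective : Function.Injective (toC (n := n)) := fun F G h => by
  ext a
  have := congrArg (fun H : LauC n => H.coeff a) h
  simpa only [coeff_toC, Int.cast_inj] using this

/-- Monomials with complex coefficients. -/
def mC (a : Fin n → ℤ) : LauC n := AddMonoidAlgebra.single a 1

lemma toC_mon (a : Fin n → ℤ) : toC (mon a) = mC a := by
  simp [toC, mon, mC]

lemma mC_mul_single (a b : Fin n → ℤ) (c : ℂ) :
    mC a * AddMonoidAlgebra.single b c = AddMonoidAlgebra.single (a + b) c := by
  simp [mC, AddMonoidAlgebra.single_mul_single]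

/-- The Euler operator of the `k`-th variable, as a linear map. -/
def DL (k : Fin n) : LauC n →ₗ[ℂ] LauC n :=
  (AddMonoidAlgebra.coeffLinearEquiv ℂ).symm.toLinearMap ∘ₗ
    (Finsupp.lsum ℂ fun a => (a k : ℂ) • Finsupp.lsingle a) ∘ₗ
    (AddMonoidAlgebra.coeffLinearEquiv ℂ).toLinearMap

lemma DL_single (k : Fin n) (a : Fin n → ℤ) (c : ℂ) :
    DL k (AddMonoidAlgebra.single a c) = AddMonoidAlgebra.single a (a k * c) := by
  apply (AddMonoidAlgebra.coeffLinearEquiv ℂ).injective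
  simp [DL]

/-- The Euler operator of the `k`-th variable. -/
def D (k : Fin n) : Derivation ℂ (LauC n) (LauC n) := Derivation.mk' (DL k) fun x y => by
  refine AddMonoidAlgebra.induction_linear x (by simp)
    (fun x x' h h' => by rw [add_mul, map_add, h, h', map_add, smul_add, add_smul]; abel) fun a c => ?_
  refine AddMonoidAlgebra.induction_linear y (by simp)
    (fun x x' h h' => by rw [mul_add, map_add, h, h', map_add, smul_add, add_smul]; abel) fun b d => ?_
  rw [AddMonoidAlgebra.single_mul_single, DL_single, DL_single, DL_single, smul_eq_mul, smul_eq_mul,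
    AddMonoidAlgebra.single_mul_single, AddMonoidAlgebra.single_mul_single, add_comm b a,
    ← AddMonoidAlgebra.single_add, Pi.add_apply]
  congr 1
  push_cast
  ring

lemma D_single (k : Fin n) (a : Fin n → ℤ) (c : ℂ) :
    D k (AddMonoidAlgebra.single a c) = AddMonoidAlgebra.single a (a k * c) := DL_single k a c

lemma coeff_D (k : Fin n) (F : LauC n) (a : Fin n → ℤ) : (D k F).coeff a = a k * F.coeff a := by
  refine AddMonoidAlgebra.induction_linear F (by simp)
    (fun x x' h h' => by
      rw [map_add, AddMonoidAlgebra.coeff_add, AddMonoidAlgebra.coeff_add, Finsupp.add_apply, Finsupp.add_apply,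
        h, h', mul_add]) fun b d => ?_
  rw [D_single, AddMonoidAlgebra.coeff_single, AddMonoidAlgebra.coeff_single, Finsupp.single_apply,
    Finsupp.single_apply]
  split_ifs with h
  · rw [h]
  · simp

end

section
variable {n : ℕ} {ι : Type} [Fintype ι] [DecidableEq ι]

/-- The weighted trace of a matrix. -/
def trc (M : Matrix (ι → Fin n) (ι → Fin n) ℂ) : LauC n := ∑ f, AddMonoidAlgebra.single (ct f) (M f f)

lemma trc_add (M N : Matrix (ι → Fin n) (ι → Fin n) ℂ) : trc (M + N) = trc M + trc N := by
  simp only [trc, Matrix.add_apply, AddMonoidAlgebra.single_add, Finset.sum_add_distrib]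

lemma trc_smul (c : ℂ) (M : Matrix (ι → Fin n) (ι → Fin n) ℂ) : trc (c • M) = c • trc M := by
  simp only [trc, Matrix.smul_apply, Finset.smul_sum, AddMonoidAlgebra.smul_single]

lemma trc_sum {α : Type*} (s : Finset α) (M : α → Matrix (ι → Fin n) (ι → Fin n) ℂ) :
    trc (∑ i ∈ s, M i) = ∑ i ∈ s, trc (M i) := by
  classical
  induction s using Finset.induction_on with
  | empty => simp [trc]
  | insert i s hi h => rw [Finset.sum_insert hi, Finset.sum_insert hi, trc_add, h]

lemma trc_comm {A : Matrix (ι → Fin n) (ι → Fin n) ℂ} {u v : Fin n → ℤ}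
    (hA : ∀ f f', A f f' ≠ 0 → ct f + u = ct f' + v) (M : Matrix (ι → Fin n) (ι → Fin n) ℂ) :
    mC u * trc (A * M) = mC v * trc (M * A) := by
  have hs : ∀ (s : Finset (ι → Fin n)) (a : Fin n → ℤ) (c : (ι → Fin n) → ℂ),
      (AddMonoidAlgebra.single a (∑ f ∈ s, c f) : LauC n) = ∑ f ∈ s, AddMonoidAlgebra.single a (c f) :=
    fun s a c => map_sum (AddMonoidAlgebra.singleAddHom a) c s
  simp only [trc, Finset.mul_sum, mC_mul_single, Matrix.mul_apply, hs]
  rw [Finset.sum_comm]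
  refine Finset.sum_congr rfl fun f _ => Finset.sum_congr rfl fun f' _ => ?_
  by_cases h : A f' f = 0
  · simp [h]
  · rw [mul_comm, add_comm u, hA _ _ h, add_comm v]

lemma trc_eM (i j : Fin n) (M : Matrix (ι → Fin n) (ι → Fin n) ℂ) :
    mC (Pi.single j 1) * trc (eM ι i j * M) = mC (Pi.single i 1) * trc (M * eM ι i j) :=
  trc_comm (fun _ _ h => eM_weight h) M

lemma D_trc (k : Fin n) (M : Matrix (ι → Fin n) (ι → Fin n) ℂ) :
    trc (diagonal (fun f => (ct f k : ℂ)) * M) = D k (trc M) := by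
  simp only [trc, diagonal_mul, map_sum, D_single]

lemma IsProj.trc_swap {P : Matrix (ι → Fin n) (ι → Fin n) ℂ} (hP : IsProj P) {i j : Fin n} (h : i ≠ j) :
    mC (Pi.single j 1) * trc (eM ι i j * eM ι j i * P) = mC (Pi.single i 1) * trc (eM ι j i * eM ι i j * P) := by
  rw [mul_assoc, trc_eM, mul_assoc, mul_assoc, hP.eM_comm h]

lemma trc_bracket (P : Matrix (ι → Fin n) (ι → Fin n) ℂ) (i j : Fin n) :
    trc (eM ι i j * eM ι j i * P) = trc (eM ι j i * eM ι i j * P) + (D i (trc P) - D j (trc P)) := by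
  rw [eM_bracket, add_mul, trc_add, ← D_trc, ← D_trc]
  congr 1
  rw [eq_sub_iff_add_eq, ← trc_add, ← add_mul, diagonal_add]
  simp

lemma IsProj.trc_pair {P : Matrix (ι → Fin n) (ι → Fin n) ℂ} (hP : IsProj P) {i j : Fin n} (h : i ≠ j) :
    (mC (Pi.single i 1) - mC (Pi.single j 1)) *
      (trc (eM ι i j * eM ι j i * P) + trc (eM ι j i * eM ι i j * P))
    = (mC (Pi.single i 1) + mC (Pi.single j 1)) * (D i (trc P) - D j (trc P)) := by
  have h1 := hP.trc_swap h
  rw [trc_bracket P i j] at h1 ⊢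
  linear_combination (-2) * h1

lemma IsHW.trc_cas {x : (ι → Fin n) → ℂ} {a : Fin n → ℤ} (hx : IsHW x a)
    {P : Matrix (ι → Fin n) (ι → Fin n) ℂ} (hP : ∀ y, P *ᵥ y ∈ gspan x) :
    ∑ i, ∑ j, trc (eM ι i j * eM ι j i * P) = casVal a • trc P := by
  rw [← trc_smul, ← hx.cas_mul hP, trc_sum]
  exact Finset.sum_congr rfl fun i _ => (trc_sum _ _).symm

lemma trc_self (P : Matrix (ι → Fin n) (ι → Fin n) ℂ) (i : Fin n) :
    trc (eM ι i i * eM ι i i * P) = D i (D i (trc P)) := by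
  rw [mul_assoc, eM_self, D_trc, D_trc]

lemma sum_D_trc (P : Matrix (ι → Fin n) (ι → Fin n) ℂ) :
    ∑ i, D i (trc P) = (Fintype.card ι : ℂ) • trc P := by
  simp only [← D_trc, ← trc_sum, ← trc_smul, ← Finset.sum_mul]
  congr 1
  have : ∑ i : Fin n, diagonal (fun f : ι → Fin n => (ct f i : ℂ)) = (Fintype.card ι : ℂ) • 1 := by
    ext f f'
    rw [Matrix.sum_apply, Matrix.smul_apply]
    by_cases h : f = f'
    · subst h
      simp only [diagonal_apply_eq, Matrix.one_apply_eq]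
      have := sum_ct 1 f
      simp only [Pi.one_apply, one_mul, Finset.sum_const, Finset.card_univ, nsmul_eq_mul, mul_one] at this
      rw [smul_eq_mul, mul_one]
      exact_mod_cast this
    · simp [diagonal_apply_ne _ h, Matrix.one_apply_ne h]
  rw [this, smul_mul_assoc, one_mul]

end

section
variable {n : ℕ}

/-- The pairs `i < j`. -/
def prs (n : ℕ) : Finset (Fin n × Fin n) := Finset.univ.filter fun p => p.1 < p.2

lemma mon_sum {α : Type*} (s : Finset α) (a : α → Fin n → ℤ) : mon (∑ i ∈ s, a i) = ∏ i ∈ s, mon (a i) := by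
  classical
  induction s using Finset.induction_on with
  | empty => exact (congrArg mon Finset.sum_empty).trans Finset.prod_empty.symm
  | insert i s hi h => rw [Finset.sum_insert hi, Finset.prod_insert hi, mon_add, h]

lemma mon_nsmul (k : ℕ) (a : Fin n → ℤ) : mon (k • a) = mon a ^ k := by
  induction k with
  | zero => exact (congrArg mon (zero_nsmul a)).trans (pow_zero _).symm
  | succ k ih => rw [succ_nsmul, mon_add, ih, pow_succ]

lemma alt_rho_eq : alt (rho n) = ∏ p ∈ prs n, (mon (Pi.single p.1 1) - mon (Pi.single p.2 1)) := by
  have h := Matrix.det_projVandermonde (1 : Fin n → Lau n) (fun i => mon (Pi.single i 1))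
  have h2 : (∏ p ∈ prs n, (mon (Pi.single p.1 1) - mon (Pi.single p.2 1)) : Lau n)
      = ∏ i : Fin n, ∏ j ∈ Finset.Ioi i, (mon (Pi.single i 1) - mon (Pi.single j 1)) := by
    rw [prs, Finset.prod_filter, ← Finset.univ_product_univ, Finset.prod_product]
    refine Finset.prod_congr rfl fun i _ => ?_
    rw [← Finset.prod_filter]
    refine Finset.prod_congr ?_ fun _ _ => rfl
    ext j; simp
  simp only [Pi.one_apply, one_mul] at h
  rw [h2, ← h, det_apply, alt]
  refine Fintype.sum_equiv (Equiv.inv _) _ _ fun σ => ?_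
  rw [Equiv.inv_apply, Equiv.Perm.sign_inv, Units.smul_def]
  congr 1
  have : rho n ∘ σ = ∑ i : Fin n, (i.rev : ℕ) • Pi.single (σ⁻¹ i) (1 : ℤ) := by
    funext k
    rw [Finset.sum_apply, Finset.sum_eq_single (σ k)]
    · simp [rho, Fin.val_rev]
      omega
    · intro i _ hi
      rw [Pi.smul_apply, Pi.single_eq_of_ne (fun e => hi (by rw [e]; simp)), smul_zero]
    · simp
  rw [this, mon_sum]
  refine Finset.prod_congr rfl fun i _ => ?_
  rw [mon_nsmul, projVandermonde_apply]
  simp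

/-- The Vandermonde product with the factors in `s` only. -/
def vdm (s : Finset (Fin n × Fin n)) : LauC n := ∏ p ∈ s, (mC (Pi.single p.1 1) - mC (Pi.single p.2 1))

lemma toC_alt_rho : toC (alt (rho n)) = vdm (prs n) := by
  simp only [alt_rho_eq, vdm, map_prod, map_sub, toC_mon]

lemma D_mC (k i : Fin n) : D k (mC (Pi.single i 1)) = if k = i then mC (Pi.single i 1) else 0 := by
  rw [mC, D_single, Pi.single_apply]
  split_ifs <;> simp

lemma D_vdm (k : Fin n) (s : Finset (Fin n × Fin n)) : D k (vdm s) = ∑ p ∈ s, vdm (s.erase p) *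
    ((if k = p.1 then mC (Pi.single p.1 1) else 0) - if k = p.2 then mC (Pi.single p.2 1) else 0) := by
  induction s using Finset.induction_on with
  | empty => simp [vdm]
  | insert p s hp h =>
    rw [vdm, Finset.prod_insert hp, ← vdm, Derivation.leibniz, h, Finset.sum_insert hp,
      Finset.erase_insert hp, smul_eq_mul, smul_eq_mul, map_sub, D_mC, D_mC, Finset.mul_sum, add_comm]
    congr 1
    refine Finset.sum_congr rfl fun q hq => ?_
    have hne : p ≠ q := fun e => hp (e ▸ hq)
    rw [Finset.erase_insert_of_ne hne, vdm, vdm, Finset.prod_insert (fun h => hp (Finset.mem_of_mem_erase h)),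
      mul_assoc]

lemma vdm_erase {s : Finset (Fin n × Fin n)} {p : Fin n × Fin n} (hp : p ∈ s) :
    vdm (s.erase p) * (mC (Pi.single p.1 1) - mC (Pi.single p.2 1)) = vdm s :=
  Finset.prod_erase_mul _ _ hp

lemma sum_prs {M : Type*} [AddCommGroup M] (f : Fin n → Fin n → M) :
    ∑ i, ∑ j, f i j = ∑ p ∈ prs n, (f p.1 p.2 + f p.2 p.1) + ∑ i, f i i := by
  have h : ∀ i j : Fin n, f i j = ((if i < j then f i j else 0) + if j < i then f i j else 0)
      + if i = j then f i i else 0 := fun i j => by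
    rcases lt_trichotomy i j with h | h | h
    · simp [h, h.not_gt, h.ne]
    · subst h; simp
    · simp [h, h.not_gt, h.ne']
  have h1 : ∑ i, ∑ j, f i j = ∑ i, ∑ j, (((if i < j then f i j else 0) + if j < i then f i j else 0)
      + if i = j then f i i else 0) := Finset.sum_congr rfl fun i _ => Finset.sum_congr rfl fun j _ => h i j
  rw [h1]
  simp only [Finset.sum_add_distrib, Finset.sum_ite_eq, Finset.mem_univ, if_true]
  congr 1
  congr 1
  · rw [prs, Finset.sum_filter, ← Finset.univ_product_univ, Finset.sum_product]
  · rw [prs, Finset.sum_filter, ← Finset.univ_product_univ, Finset.sum_product, Finset.sum_comm]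

lemma sum_prs_add {M : Type*} [AddCommGroup M] (f : Fin n → M) :
    ∑ p ∈ prs n, (f p.1 + f p.2) + ∑ i, f i = n • ∑ i, f i := by
  rw [← sum_prs fun i _ => f i, Finset.sum_comm]
  simp

lemma sum_prs_sub (f : Fin n → ℂ) :
    ∑ p ∈ prs n, (f p.1 - f p.2) = ∑ i, (2 * (rho n i : ℂ) - (n - 1)) * f i := by
  have h1 := sum_prs_add f
  have h2 : ∑ p ∈ prs n, f p.1 = ∑ i, (rho n i : ℂ) * f i := by
    rw [prs, Finset.sum_filter, ← Finset.univ_product_univ, Finset.sum_product]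
    refine Finset.sum_congr rfl fun i _ => ?_
    rw [← Finset.sum_filter]
    simp only [Finset.sum_const, nsmul_eq_mul]
    congr 1
    have : (Finset.univ.filter fun j => i < j) = Finset.Ioi i := by ext; simp
    rw [this, Fin.card_Ioi, rho]
    push_cast [Nat.cast_sub (show 1 ≤ n by have := i.2; omega), Nat.cast_sub (show (i : ℕ) ≤ n - 1 by have := i.2; omega)]
    ring_nf
  have h3 : ∑ p ∈ prs n, (f p.1 - f p.2) = 2 * ∑ p ∈ prs n, f p.1 - ∑ p ∈ prs n, (f p.1 + f p.2) := by
    rw [Finset.mul_sum, ← Finset.sum_sub_distrib]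
    exact Finset.sum_congr rfl fun _ _ => by ring
  rw [h3, eq_sub_of_add_eq h1, h2, nsmul_eq_mul]
  simp only [sub_mul, Finset.sum_sub_distrib, mul_assoc, ← Finset.mul_sum]
  ring

lemma casVal_eq (a : Fin n → ℤ) :
    casVal a + (n - 1) * ∑ i, (a i : ℂ) + ∑ i, (rho n i : ℂ) ^ 2 = ∑ i, ((a i : ℂ) + rho n i) ^ 2 := by
  have : casVal a = ∑ p ∈ prs n, ((a p.1 : ℂ) - a p.2) + ∑ i, (a i : ℂ) ^ 2 := by
    rw [casVal, sum_prs]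
    congr 1
    · refine Finset.sum_congr rfl fun p hp => ?_
      have h := (Finset.mem_filter.1 hp).2
      simp [h, h.not_gt, h.ne, h.ne']
    · simp
  rw [this, sum_prs_sub fun i => (a i : ℂ), Finset.mul_sum, ← Finset.sum_add_distrib, ← Finset.sum_add_distrib,
    ← Finset.sum_add_distrib]
  exact Finset.sum_congr rfl fun i _ => by ring

lemma coeff_alt_ne {a b : Fin n → ℤ} (h : (alt a).coeff b ≠ 0) : ∃ σ : Equiv.Perm (Fin n), b = a ∘ σ := by
  rw [alt, AddMonoidAlgebra.coeff_sum, Finsupp.finsetSum_apply] at h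
  obtain ⟨σ, -, hσ⟩ := Finset.exists_ne_zero_of_sum_ne_zero h
  refine ⟨σ, ?_⟩
  by_contra hne
  exact hσ (by simp [mon, AddMonoidAlgebra.coeff_single, Ne.symm hne])

lemma sum_D_D_alt : ∑ k, D k (D k (toC (alt (rho n)))) = (∑ i, (rho n i : ℂ) ^ 2) • toC (alt (rho n)) := by
  ext b
  rw [AddMonoidAlgebra.coeff_sum, Finsupp.finsetSum_apply, AddMonoidAlgebra.coeff_smul_apply]
  simp only [coeff_D, coeff_toC, ← mul_assoc, ← Finset.sum_mul, smul_eq_mul]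
  by_cases h : (alt (rho n)).coeff b = 0
  · simp [h]
  · obtain ⟨σ, rfl⟩ := coeff_alt_ne h
    congr 1
    simp only [← sq, Function.comp]
    exact Equiv.sum_comp σ fun i => (rho n i : ℂ) ^ 2

variable {ι : Type} [Fintype ι] [DecidableEq ι]

lemma IsHW.casimir {x : (ι → Fin n) → ℂ} {a : Fin n → ℤ} (hx : IsHW x a)
    {P : Matrix (ι → Fin n) (ι → Fin n) ℂ} (hP : IsProj P) (hr : ∀ y, P *ᵥ y ∈ gspan x) :
    ∑ k, D k (D k (toC (alt (rho n)) * trc P))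
      = (∑ i, (rho n i : ℂ) ^ 2 + casVal a + (n - 1) * Fintype.card ι) • (toC (alt (rho n)) * trc P) := by
  set X := trc P with hX
  set A := toC (alt (rho n)) with hA
  have h0 := hx.trc_cas hr
  rw [sum_prs, ← hX] at h0
  simp only [trc_self, ← hX] at h0
  have h1 : ∑ k, D k A * D k X = ∑ p ∈ prs n, vdm ((prs n).erase p) *
      (mC (Pi.single p.1 1) * D p.1 X - mC (Pi.single p.2 1) * D p.2 X) := by
    simp only [hA, toC_alt_rho, D_vdm, Finset.sum_mul]
    rw [Finset.sum_comm]
    refine Finset.sum_congr rfl fun p _ => ?_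
    simp only [mul_assoc, ← Finset.mul_sum, sub_mul, ite_mul, zero_mul, Finset.sum_sub_distrib,
      Finset.sum_ite_eq', Finset.mem_univ, if_true]
  have h2 : 2 * ∑ k, D k A * D k X = A * ∑ p ∈ prs n, (trc (eM ι p.1 p.2 * eM ι p.2 p.1 * P)
      + trc (eM ι p.2 p.1 * eM ι p.1 p.2 * P)) + A * ∑ p ∈ prs n, (D p.1 X + D p.2 X) := by
    rw [h1, Finset.mul_sum, Finset.mul_sum, Finset.mul_sum, ← Finset.sum_add_distrib]
    refine Finset.sum_congr rfl fun p hp => ?_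
    have h3 := hP.trc_pair (Finset.mem_filter.1 hp).2.ne
    rw [hA, toC_alt_rho, ← vdm_erase hp]
    linear_combination (-vdm ((prs n).erase p)) * h3
  have h4 : ∑ p ∈ prs n, (D p.1 X + D p.2 X) = ((n - 1 : ℂ) * Fintype.card ι) • X := by
    rw [eq_sub_of_add_eq (sum_prs_add fun i => D i X), hX, sum_D_trc, ← Nat.cast_smul_eq_nsmul ℂ, smul_smul, ← sub_smul]
    congr 1
    ring
  have h5 : ∑ k, D k (D k (A * X)) = (∑ k, D k (D k A)) * X + 2 * (∑ k, D k A * D k X)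
      + A * ∑ k, D k (D k X) := by
    rw [Finset.sum_mul, Finset.mul_sum, Finset.mul_sum, ← Finset.sum_add_distrib, ← Finset.sum_add_distrib]
    refine Finset.sum_congr rfl fun k _ => ?_
    simp only [Derivation.leibniz, map_add, smul_eq_mul]
    ring
  rw [h5, h2, h4, eq_sub_of_add_eq' h0, hA, sum_D_D_alt, add_smul, add_smul, mul_sub, mul_smul_comm, mul_smul_comm,
    smul_mul_assoc]
  abel

lemma IsHW.sum_eq {x : (ι → Fin n) → ℂ} {a : Fin n → ℤ} (hx : IsHW x a) : ∑ i, a i = Fintype.card ι := by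
  obtain ⟨f, hf⟩ := Function.ne_iff.1 hx.ne_zero
  rw [← hx.weight f hf]
  simpa using sum_ct 1 f

lemma IsHW.sq_sum {x : (ι → Fin n) → ℂ} {a : Fin n → ℤ} (hx : IsHW x a)
    {P : Matrix (ι → Fin n) (ι → Fin n) ℂ} (hP : IsProj P) (hr : ∀ y, P *ᵥ y ∈ gspan x) {b : Fin n → ℤ}
    (hb : (toC (alt (rho n)) * trc P).coeff b ≠ 0) : ∑ i, b i ^ 2 = ∑ i, (a i + rho n i) ^ 2 := by
  have h := congrArg (fun F : LauC n => F.coeff b) (hx.casimir hP hr)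
  simp only [AddMonoidAlgebra.coeff_sum, Finsupp.finsetSum_apply, AddMonoidAlgebra.coeff_smul_apply,
    coeff_D, ← mul_assoc, ← Finset.sum_mul, smul_eq_mul] at h
  have h2 := mul_right_cancel₀ hb h
  have h3 := casVal_eq a
  have h4 : (∑ i, (a i : ℂ)) = Fintype.card ι := by exact_mod_cast congrArg (Int.cast : ℤ → ℂ) hx.sum_eq
  rw [h4] at h3
  have : (∑ i, (b i : ℂ) ^ 2) = ∑ i, ((a i : ℂ) + rho n i) ^ 2 := by
    rw [← h3]
    simp only [sq] at h2 ⊢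
    rw [h2]
    ring
  exact_mod_cast this

end

section
variable {n : ℕ} {ι : Type} [Fintype ι] [DecidableEq ι]

lemma eM_conjTranspose (i j : Fin n) : (eM ι i j)ᴴ = eM ι j i := by
  ext f f'
  simp only [conjTranspose_apply, eM, Matrix.of_apply, star_sum]
  refine Finset.sum_congr rfl fun b _ => ?_
  have : (f' b = i ∧ f = Function.update f' b j) ↔ (f b = j ∧ f' = Function.update f b i) := by
    constructor
    · rintro ⟨rfl, rfl⟩; simp
    · rintro ⟨rfl, rfl⟩; simp
  simp only [this, apply_ite Star.star, star_one, star_zero]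

lemma IsHW.le {x : (ι → Fin n) → ℂ} {a : Fin n → ℤ} (hx : IsHW x a) {i j : Fin n} (h : i < j) : a j ≤ a i := by
  have h0 : el i j x = 0 := el_eq_zero h.ne fun s => hx.fixed i j h s
  have h1 : el i j (el j i x) = ((a i : ℂ) - a j) • x := by
    funext f
    rw [el_comm, h0, el_zero, Pi.zero_apply, zero_add]
    exact hx.ct_mul f fun c => (c i : ℂ) - c j
  have h2 : Star.star (el j i x) ⬝ᵥ el j i x = ((a i : ℂ) - a j) * (Star.star x ⬝ᵥ x) := by
    rw [← eM_mulVec j i x, star_mulVec, eM_conjTranspose, ← dotProduct_mulVec, eM_mulVec, eM_mulVec, h1,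
      dotProduct_smul, smul_eq_mul]
  have hn : ∀ y : (ι → Fin n) → ℂ, Star.star y ⬝ᵥ y = ((∑ f, ‖y f‖ ^ 2 : ℝ) : ℂ) := fun y => by
    simp only [dotProduct, Pi.star_apply, Complex.ofReal_sum]
    refine Finset.sum_congr rfl fun f _ => ?_
    rw [Complex.star_def, Complex.conj_mul']
    push_cast
    rfl
  rw [hn, hn] at h2
  have h3 : (∑ f, ‖el j i x f‖ ^ 2 : ℝ) = ((a i : ℝ) - a j) * ∑ f, ‖x f‖ ^ 2 := by exact_mod_cast h2
  have h4 : 0 < ∑ f, ‖x f‖ ^ 2 := by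
    obtain ⟨f, hf⟩ := Function.ne_iff.1 hx.ne_zero
    refine Finset.sum_pos' (fun f _ => by positivity) ⟨f, Finset.mem_univ f, ?_⟩
    have : 0 < ‖x f‖ := norm_pos_iff.2 hf
    positivity
  have h5 : 0 ≤ ∑ f, ‖el j i x f‖ ^ 2 := Finset.sum_nonneg fun f _ => by positivity
  rw [h3] at h5
  have h6 := nonneg_of_mul_nonneg_left h5 h4
  exact_mod_cast (sub_nonneg.1 h6)

lemma IsHW.antitone {x : (ι → Fin n) → ℂ} {a : Fin n → ℤ} (hx : IsHW x a) : Antitone a := fun i j h => by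
  rcases h.lt_or_eq with h | rfl
  · exact hx.le h
  · exact le_rfl

lemma IsHW.gspan_le_low {x : (ι → Fin n) → ℂ} {a : Fin n → ℤ} (hx : IsHW x a) : gspan x ≤
    Submodule.span ℂ {y | ∃ u : GL (Fin n) ℂ, IsLow (u : Matrix (Fin n) (Fin n) ℂ) ∧ ten ι n u x = y} := by
  refine gspan_le (span_low_stable (ten ι n) hx.fixed fun d => ⟨_, ten_dg_eq hx.weight d⟩) ?_
  refine Submodule.subset_span ⟨1, ⟨fun i => ?_, fun i j h => ?_⟩, by simp⟩
  · rw [Units.val_one, Matrix.one_apply_eq]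
  · rw [Units.val_one, Matrix.one_apply_ne h.ne]

omit [DecidableEq ι] in
lemma IsHW.low_support {x : (ι → Fin n) → ℂ} {u : Matrix (Fin n) (Fin n) ℂ} (hu : IsLow u)
    {f g : ι → Fin n} (h : tpow ι u g f * x f ≠ 0) : f ≤ g ∧ x f ≠ 0 := by
  refine ⟨fun b => ?_, right_ne_zero_of_mul h⟩
  by_contra hlt
  refine left_ne_zero_of_mul h (Finset.prod_eq_zero (Finset.mem_univ b) ?_)
  exact hu.2 _ _ (not_le.1 hlt)

lemma IsHW.gspan_support {x : (ι → Fin n) → ℂ} {a : Fin n → ℤ} (hx : IsHW x a) {y : (ι → Fin n) → ℂ}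
    (hy : y ∈ gspan x) {g : ι → Fin n} (hg : y g ≠ 0) : ∃ f, x f ≠ 0 ∧ f ≤ g := by
  by_contra hne
  refine hg ?_
  clear hg
  replace hy := hx.gspan_le_low hy
  induction hy using Submodule.span_induction with
  | mem y hy =>
    obtain ⟨u, hu, rfl⟩ := hy
    rw [ten_apply]
    refine Finset.sum_eq_zero fun f _ => ?_
    by_contra h
    have := IsHW.low_support hu h
    exact hne ⟨f, this.2, this.1⟩
  | zero => rfl
  | add y z _ _ hy hz =>
    rw [Pi.add_apply, hy, hz, add_zero]
  | smul c y _ hy => rw [Pi.smul_apply, hy, smul_zero]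

omit [DecidableEq ι] in
lemma eq_of_le_of_sum {d : Fin n → ℤ} (hd : StrictAnti d) {f g : ι → Fin n} (h : f ≤ g)
    (hs : ∑ b, d (f b) ≤ ∑ b, d (g b)) : f = g := by
  have h1 : ∀ b ∈ Finset.univ, d (g b) ≤ d (f b) := fun b _ => hd.antitone (h b)
  have h2 := (Finset.sum_eq_sum_iff_of_le h1).1 (le_antisymm (Finset.sum_le_sum h1) hs)
  funext b
  exact hd.injective (h2 b (Finset.mem_univ b)).symm

lemma IsHW.gspan_dom {x : (ι → Fin n) → ℂ} {a : Fin n → ℤ} (hx : IsHW x a) {y : (ι → Fin n) → ℂ}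
    (hy : y ∈ gspan x) {g : ι → Fin n} (hg : y g ≠ 0) {d : Fin n → ℤ} (hd : StrictAnti d) :
    ∑ i, d i * ct g i ≤ ∑ i, d i * a i ∧ (∑ i, d i * a i ≤ ∑ i, d i * ct g i → ct g = a) := by
  obtain ⟨f, hf, hfg⟩ := hx.gspan_support hy hg
  rw [← hx.weight f hf, sum_ct, sum_ct]
  exact ⟨Finset.sum_le_sum fun b _ => hd.antitone (hfg b), fun h => by rw [eq_of_le_of_sum hd hfg h]⟩

lemma IsHW.gspan_weight {x : (ι → Fin n) → ℂ} {a : Fin n → ℤ} (hx : IsHW x a) {y : (ι → Fin n) → ℂ}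
    (hy : y ∈ gspan x) : ∃ c : ℂ, ∀ g, ct g = a → y g = c * x g := by
  replace hy := hx.gspan_le_low hy
  induction hy using Submodule.span_induction with
  | mem y hy =>
    obtain ⟨u, hu, rfl⟩ := hy
    refine ⟨1, fun g hg => ?_⟩
    rw [ten_apply, mulVec, dotProduct, Finset.sum_eq_single g]
    · congr 1
      exact Finset.prod_eq_one fun b _ => hu.1 _
    · intro f _ hne
      by_contra h
      have h1 := IsHW.low_support hu h
      refine hne (eq_of_le_of_sum (strictAnti_rho (n := n)) h1.1 ?_)
      rw [← sum_ct, ← sum_ct, hg, hx.weight f h1.2]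
    · simp
  | zero => exact ⟨0, by simp⟩
  | add y z _ _ hy hz =>
    obtain ⟨c, hc⟩ := hy
    obtain ⟨d, hd⟩ := hz
    exact ⟨c + d, fun g hg => by rw [Pi.add_apply, hc g hg, hd g hg, add_mul]⟩
  | smul c y _ hy =>
    obtain ⟨d, hd⟩ := hy
    exact ⟨c * d, fun g hg => by rw [Pi.smul_apply, hd g hg, smul_eq_mul, mul_assoc]⟩

lemma coeff_trc (M : Matrix (ι → Fin n) (ι → Fin n) ℂ) (c : Fin n → ℤ) :
    (trc M).coeff c = ∑ f, if ct f = c then M f f else 0 := by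
  rw [trc, AddMonoidAlgebra.coeff_sum, Finsupp.finsetSum_apply]
  exact Finset.sum_congr rfl fun f _ => by rw [AddMonoidAlgebra.coeff_single, Finsupp.single_apply]

lemma IsHW.coeff_trc_self {x : (ι → Fin n) → ℂ} {a : Fin n → ℤ} (hx : IsHW x a)
    {P : Matrix (ι → Fin n) (ι → Fin n) ℂ} (hr : ∀ y, P *ᵥ y ∈ gspan x) (hx2 : P *ᵥ x = x) :
    (trc P).coeff a = 1 := by
  have h1 : ∀ f', ∃ c : ℂ, ∀ g, ct g = a → P g f' = c * x g := fun f' => by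
    obtain ⟨c, hc⟩ := hx.gspan_weight (hr (Pi.single f' 1))
    refine ⟨c, fun g hg => ?_⟩
    rw [← hc g hg, mulVec_single_one]
    rfl
  choose c hc using h1
  rw [coeff_trc]
  obtain ⟨g, hg⟩ := Function.ne_iff.1 hx.ne_zero
  have hg' := hx.weight g hg
  have h2 := congrFun hx2 g
  refine mul_right_cancel₀ hg ?_
  rw [one_mul]
  refine Eq.trans ?_ h2
  rw [Finset.sum_mul, mulVec, dotProduct]
  refine Finset.sum_congr rfl fun f _ => ?_
  split_ifs with hf
  · rw [hc f f hf, hc f g hg']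
    ring
  · by_cases h : x f = 0
    · simp [h]
    · exact absurd (hx.weight f h) hf

lemma IsHW.trc_dom {x : (ι → Fin n) → ℂ} {a : Fin n → ℤ} (hx : IsHW x a)
    {P : Matrix (ι → Fin n) (ι → Fin n) ℂ} (hr : ∀ y, P *ᵥ y ∈ gspan x) {c : Fin n → ℤ}
    (hc : (trc P).coeff c ≠ 0) {d : Fin n → ℤ} (hd : StrictAnti d) :
    ∑ i, d i * c i ≤ ∑ i, d i * a i ∧ (∑ i, d i * a i ≤ ∑ i, d i * c i → c = a) := by
  rw [coeff_trc] at hc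
  obtain ⟨f, -, hf⟩ := Finset.exists_ne_zero_of_sum_ne_zero hc
  obtain ⟨rfl, hf'⟩ : ct f = c ∧ P f f ≠ 0 := by
    split_ifs at hf with h
    · exact ⟨h, hf⟩
    · exact absurd rfl hf
  refine hx.gspan_dom (hr (Pi.single f 1)) (g := f) ?_ hd
  rw [mulVec_single_one]
  exact hf'

/-- Permutation matrices in `GL_n`. -/
def pmat (σ : Equiv.Perm (Fin n)) : GL (Fin n) ℂ :=
  Matrix.GeneralLinearGroup.mkOfDetNeZero (σ.permMatrix ℂ) (by
    rw [Matrix.det_permutation]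
    exact_mod_cast (Equiv.Perm.sign σ).ne_zero)

omit [DecidableEq ι] in
lemma tpow_pmat (σ : Equiv.Perm (Fin n)) (f f' : ι → Fin n) :
    tpow ι (pmat σ : Matrix (Fin n) (Fin n) ℂ) f f' = if σ ∘ f = f' then 1 else 0 := by
  rw [← prod_one_apply]
  refine Finset.prod_congr rfl fun b _ => ?_
  change σ.permMatrix ℂ (f b) (f' b) = _
  simp [Equiv.Perm.permMatrix, PEquiv.toMatrix_apply, Matrix.one_apply, eq_comm]

lemma IsProj.perm {P : Matrix (ι → Fin n) (ι → Fin n) ℂ} (hP : IsProj P) (σ : Equiv.Perm (Fin n))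
    (f f' : ι → Fin n) : P (σ ∘ f) (σ ∘ f') = P f f' := by
  have h := congrFun (congrFun (hP.comm (pmat σ)) f) (σ ∘ f')
  simp only [Matrix.mul_apply, tpow_pmat] at h
  have h1 : ∀ g : ι → Fin n, σ ∘ g = σ ∘ f' ↔ g = f' := fun g => σ.injective.comp_left.eq_iff
  simpa [h1] using h.symm

omit [DecidableEq ι] in
lemma ct_comp (σ : Equiv.Perm (Fin n)) (f : ι → Fin n) : ct (σ ∘ f) ∘ σ = ct f := by
  funext i
  simp [ct]

lemma IsProj.coeff_perm {P : Matrix (ι → Fin n) (ι → Fin n) ℂ} (hP : IsProj P) (σ : Equiv.Perm (Fin n))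
    (c : Fin n → ℤ) : (trc P).coeff (c ∘ σ) = (trc P).coeff c := by
  rw [coeff_trc, coeff_trc]
  refine Fintype.sum_equiv (Equiv.arrowCongr (Equiv.refl ι) σ) _ _ fun f => ?_
  have : Equiv.arrowCongr (Equiv.refl ι) σ f = σ ∘ f := by ext b; simp
  rw [this, hP.perm]
  refine if_congr ?_ rfl rfl
  rw [← ct_comp σ f]
  exact σ.surjective.injective_comp_right.eq_iff

end

section
variable {n : ℕ}

lemma eq_zero_of_antisymm {A : (Fin n → ℤ) → ℂ}
    (hA : ∀ (σ : Equiv.Perm (Fin n)) b, A (b ∘ σ) = ((Equiv.Perm.sign σ : ℤ) : ℂ) * A b)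
    (h : ∀ b, StrictAnti b → A b = 0) (b : Fin n → ℤ) : A b = 0 := by
  by_cases hb : Function.Injective b
  · have hs : StrictAnti (b ∘ Tuple.sort (fun i => - b i)) := by
      have hm := Tuple.monotone_sort (fun i => - b i)
      intro i j hij
      refine lt_of_le_of_ne (neg_le_neg_iff.1 (hm hij.le)) fun he => ?_
      exact hij.ne ((Tuple.sort _).injective (hb he.symm))
    have := h _ hs
    rw [hA] at this
    exact (mul_eq_zero.1 this).resolve_left (Int.cast_ne_zero.2 (Units.ne_zero _))
  · simp only [Function.Injective, not_forall] at hb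
    obtain ⟨i, j, hij, hne⟩ := hb
    have := hA (Equiv.swap i j) b
    rw [Equiv.Perm.sign_swap hne, show b ∘ Equiv.swap i j = b from ?_] at this
    · push_cast at this
      exact self_eq_neg.1 (by simpa using this)
    · funext k
      rcases eq_or_ne k i with rfl | h1
      · simp [hij]
      rcases eq_or_ne k j with rfl | h2
      · simp [hij]
      simp [Equiv.swap_apply_of_ne_of_ne h1 h2]

lemma coeff_toC_alt_mul (a b : Fin n → ℤ) (X : LauC n) : (toC (alt a) * X).coeff b
    = ∑ σ : Equiv.Perm (Fin n), ((Equiv.Perm.sign σ : ℤ) : ℂ) * X.coeff (b - a ∘ σ) := by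
  simp only [alt, map_sum, map_zsmul, toC_mon, Finset.sum_mul, smul_mul_assoc, AddMonoidAlgebra.coeff_sum,
    Finsupp.finsetSum_apply, AddMonoidAlgebra.coeff_smul_apply, mC, AddMonoidAlgebra.coeff_single_mul_apply,
    one_mul, neg_add_eq_sub]
  simp only [zsmul_eq_mul]

lemma coeff_toC_alt_mul_perm (a : Fin n → ℤ) {X : LauC n}
    (hX : ∀ (σ : Equiv.Perm (Fin n)) c, X.coeff (c ∘ σ) = X.coeff c) (σ : Equiv.Perm (Fin n)) (b : Fin n → ℤ) :
    (toC (alt a) * X).coeff (b ∘ σ) = ((Equiv.Perm.sign σ : ℤ) : ℂ) * (toC (alt a) * X).coeff b := by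
  rw [coeff_toC_alt_mul, coeff_toC_alt_mul, Finset.mul_sum]
  refine (Fintype.sum_equiv (Equiv.mulRight σ) _ _ fun τ => ?_).symm
  rw [Equiv.coe_mulRight, Equiv.Perm.sign_mul, ← hX σ, ← mul_assoc]
  congr 1
  push_cast
  ring

lemma sum_mul_comp_le {d a : Fin n → ℤ} (hd : StrictAnti d) (ha : StrictAnti a) (σ : Equiv.Perm (Fin n)) :
    ∑ i, d i * a (σ i) ≤ ∑ i, d i * a i ∧ (∑ i, d i * a i ≤ ∑ i, d i * a (σ i) → σ = 1) := by
  have hm : Monovary d a := fun i j h => hd.antitone (ha.lt_iff_gt.1 h).le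
  refine ⟨hm.sum_mul_comp_perm_le_sum_mul, fun h => strictAnti_comp_perm ha fun i j hij => ?_⟩
  have h2 := hm.sum_mul_comp_perm_eq_sum_mul_iff.1 (le_antisymm hm.sum_mul_comp_perm_le_sum_mul h)
  by_contra hle
  rcases (not_lt.1 hle).lt_or_eq with h3 | h3
  · exact absurd (h2 h3) (not_le.2 (hd hij))
  · exact hij.ne ((σ.injective (ha.injective h3)))

variable {ι : Type} [Fintype ι] [DecidableEq ι]

lemma IsHW.alt_mul_trc {x : (ι → Fin n) → ℂ} {a : Fin n → ℤ} (hx : IsHW x a)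
    {P : Matrix (ι → Fin n) (ι → Fin n) ℂ} (hP : IsProj P) (hr : ∀ y, P *ᵥ y ∈ gspan x) (hx2 : P *ᵥ x = x) :
    toC (alt (rho n)) * trc P = toC (alt (a + rho n)) := by
  have hs : StrictAnti (a + rho n) := strictAnti_add_rho hx.antitone
  have key : ∀ b, StrictAnti b → ∑ i, b i ^ 2 = ∑ i, (a i + rho n i) ^ 2 → ∀ σ : Equiv.Perm (Fin n),
      (trc P).coeff (b - rho n ∘ σ) ≠ 0 → b = a + rho n ∧ σ = 1 := by
    intro b hb hsq σ hσ
    have hd : StrictAnti (b + (a + rho n)) := fun i j h => add_lt_add (hb h) (hs h)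
    have h1 := hx.trc_dom hr hσ hd
    have h2 := sum_mul_comp_le hd (strictAnti_rho (n := n)) σ
    have h3 : ∑ i, (b + (a + rho n)) i * b i = ∑ i, (b + (a + rho n)) i * (a + rho n) i := by
      have : ∑ i, (b + (a + rho n)) i * (b i - (a + rho n) i) = ∑ i, (b i ^ 2 - (a i + rho n i) ^ 2) :=
        Finset.sum_congr rfl fun i _ => by simp only [Pi.add_apply]; ring
      rw [Finset.sum_sub_distrib, hsq, sub_self] at this
      rw [← sub_eq_zero, ← this, ← Finset.sum_sub_distrib]
      exact Finset.sum_congr rfl fun i _ => by ring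
    have h4 : ∑ i, (b + (a + rho n)) i * b i = ∑ i, (b + (a + rho n)) i * (b - rho n ∘ σ) i
        + ∑ i, (b + (a + rho n)) i * rho n (σ i) := by
      rw [← Finset.sum_add_distrib]
      exact Finset.sum_congr rfl fun i _ => by simp only [Pi.sub_apply, Function.comp]; ring
    have h5 : ∑ i, (b + (a + rho n)) i * (a + rho n) i = ∑ i, (b + (a + rho n)) i * a i
        + ∑ i, (b + (a + rho n)) i * rho n i := by
      rw [← Finset.sum_add_distrib]
      exact Finset.sum_congr rfl fun i _ => by simp only [Pi.add_apply]; ring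
    have hσ1 : σ = 1 := h2.2 (by linarith [h1.1])
    have hc := h1.2 (by linarith [h2.1])
    subst hσ1
    exact ⟨by rw [← hc]; simp, rfl⟩
  have main := eq_zero_of_antisymm (A := fun b => (toC (alt (rho n)) * trc P).coeff b
    - (toC (alt (a + rho n)) * 1).coeff b) (fun σ b => by
      simp only [mul_sub]
      rw [coeff_toC_alt_mul_perm _ hP.coeff_perm, coeff_toC_alt_mul_perm]
      intro σ c
      rw [AddMonoidAlgebra.one_def, AddMonoidAlgebra.coeff_single, Finsupp.single_apply, Finsupp.single_apply]
      refine if_congr ?_ rfl rfl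
      exact ⟨fun h => σ.surjective.injective_comp_right h, fun h => by rw [← h]; rfl⟩) (fun b hb => by
      rw [sub_eq_zero, mul_one, coeff_toC, coeff_alt hs hb]
      split_ifs with h
      · rw [coeff_toC_alt_mul, Finset.sum_eq_single 1]
        · have : b - rho n ∘ (1 : Equiv.Perm (Fin n)) = a := by
            rw [← h]
            simp
          rw [this, hx.coeff_trc_self hr hx2]
          simp
        · intro σ _ hσ
          by_contra h0
          refine hσ (key b hb ?_ σ (right_ne_zero_of_mul h0)).2
          rw [← h]
          rfl
        · simp
      · by_contra h0
        have h1 := hx.sq_sum hP hr (b := b) (by simpa using h0)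
        rw [coeff_toC_alt_mul] at h0
        push_cast at h0
        obtain ⟨σ, -, hσ⟩ := Finset.exists_ne_zero_of_sum_ne_zero h0
        exact h (key b hb h1 σ (right_ne_zero_of_mul hσ)).1.symm)
  ext b
  have := main b
  rw [mul_one, sub_eq_zero] at this
  exact this

lemma toC_alt_rho_ne_zero : toC (alt (rho n)) ≠ 0 := fun h =>
  alt_rho_ne_zero (toC_injective (h.trans (map_zero toC).symm))

/-- The character of the representation generated by a highest weight vector. -/
theorem IsHW.trc_eq {x : (ι → Fin n) → ℂ} {a : Fin n → ℤ} (hx : IsHW x a)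
    {P : Matrix (ι → Fin n) (ι → Fin n) ℂ} (hP : IsProj P) (hr : ∀ y, P *ᵥ y = y ↔ y ∈ gspan x) :
    trc P = toC (chi a) := by
  have h := hx.alt_mul_trc hP (fun y => (hr _).1 (by rw [Matrix.mulVec_mulVec, hP.mul_self]))
    ((hr x).2 (mem_gspan x))
  refine mul_left_cancel₀ toC_alt_rho_ne_zero ?_
  rw [h, ← map_mul, (chi_spec ⟨a, hx.antitone⟩).1]

end

section
variable {n : ℕ} {V : Type*} [AddCommGroup V] [Module ℂ V]

/-- A nonzero vector fixed by upper transvections, of weight `a` for the diagonal torus. -/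
structure IsHWVec (ρ : Representation ℂ (GL (Fin n) ℂ) V) (a : Fin n → ℤ) (v : V) : Prop where
  ne_zero : v ≠ 0
  fixed : ∀ (i j : Fin n) (h : i < j) c, ρ (tv i j h.ne c) v = v
  weight : ∀ d, ρ (dg d) v = (∏ i, (d i : ℂ) ^ a i) • v

lemma isHWVec_of_isGLHW {ρ : Representation ℂ (GL (Fin n) ℂ) V} {a : Fin n → ℤ} (h : IsGLHW n a ρ) :
    ∃ v, IsHWVec ρ a v := by
  obtain ⟨-, -, v, h0, h1, h2⟩ := h
  refine ⟨v, h0, fun i j h c => h1 _ ⟨fun k => ?_, fun k l hkl => ?_⟩, fun d => h2 _ _ (coe_dg d)⟩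
  · rw [coe_tv]
    simp only [transvection, Matrix.add_apply, Matrix.one_apply_eq, Matrix.single_apply]
    rw [if_neg (by rintro ⟨rfl, rfl⟩; exact h.false), add_zero]
  · rw [coe_tv]
    simp only [transvection, Matrix.add_apply, Matrix.one_apply_ne (Fin.lt_def.2 hkl).ne', Matrix.single_apply]
    rw [if_neg (by rintro ⟨rfl, rfl⟩; exact absurd h (Fin.lt_def.2 hkl).not_gt), add_zero]

lemma fixed_of_isLow {ρ : Representation ℂ (GL (Fin n) ℂ) V} {ψ : V →ₗ[ℂ] ℂ}
    (hψ : ∀ (i j : Fin n) (h : j < i) c y, ψ (ρ (tv i j h.ne' c) y) = ψ y) (u : GL (Fin n) ℂ)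
    (hu : IsLow (u : Matrix (Fin n) (Fin n) ℂ)) (y : V) : ψ (ρ u y) = ψ y := by
  have key : ∀ m : ℕ, ∀ u : GL (Fin n) ℂ, IsLow (u : Matrix (Fin n) (Fin n) ℂ) →
      (∀ i j : Fin n, j < i → m ≤ i * n + j → u i j = 0) → ψ (ρ u y) = ψ y := by
    intro m
    induction m with
    | zero =>
      intro u hu h
      have : u = 1 := by
        refine Units.ext ?_
        ext i j
        rcases lt_trichotomy i j with h1 | h1 | h1
        · rw [hu.2 i j h1, Units.val_one, Matrix.one_apply_ne h1.ne]
        · rw [h1, hu.1, Units.val_one, Matrix.one_apply_eq]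
        · rw [h i j h1 (Nat.zero_le _), Units.val_one, Matrix.one_apply_ne h1.ne']
      rw [this, map_one]
      rfl
    | succ m ih =>
      intro u hu h
      by_cases hm : ∃ i j : Fin n, j < i ∧ (i * n + j : ℕ) = m
      · obtain ⟨i, j, hji, hm⟩ := hm
        have h1 := ih (tv i j hji.ne' (-u i j) * u) (by
          rw [Units.val_mul]
          exact (isLow_transvection hji _).mul hu) (by
          intro k l hlk hle
          rw [Units.val_mul, coe_tv]
          by_cases hk : k = i
          · subst hk
            rw [transvection_mul_apply_same]
            by_cases hl : l = j
            · rw [hl, hu.1]; ring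
            · have : j < l := by
                have : (j : ℕ) ≠ l := fun h => hl (Fin.ext h.symm)
                exact Fin.lt_def.2 (by omega)
              rw [hu.2 j l this, h k l hlk (by have := Fin.lt_def.1 this; omega)]
              ring
          · rw [transvection_mul_apply_of_ne _ _ _ _ hk]
            refine h k l hlk (lt_of_le_of_ne hle fun he => hk ?_)
            have e1 := congrArg (· / n) (hm.trans he)
            have hn : 0 < n := k.pos
            simp only [mul_comm _ n, Nat.mul_add_div hn, Nat.div_eq_of_lt j.2, Nat.div_eq_of_lt l.2] at e1
            exact Fin.ext (by omega))
        rw [map_mul, Module.End.mul_apply, hψ i j hji] at h1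
        exact h1
      · exact ih u hu fun i j hji hle => h i j hji (Nat.lt_of_le_of_ne hle fun he => hm ⟨i, j, hji, he.symm⟩)
  exact key (n * n) u hu fun i j _ hle => by
    exfalso
    have h1 : (i : ℕ) + 1 ≤ n := i.2
    have := Nat.mul_le_mul_right n h1
    rw [add_mul, one_mul] at this
    have := j.2
    omega

/-- The transpose of an invertible matrix. -/
def trGL (g : GL (Fin n) ℂ) : GL (Fin n) ℂ :=
  ⟨(g : Matrix (Fin n) (Fin n) ℂ)ᵀ, ((g⁻¹ : GL (Fin n) ℂ) : Matrix (Fin n) (Fin n) ℂ)ᵀ,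
    by rw [← transpose_mul, Units.inv_mul, transpose_one],
    by rw [← transpose_mul, Units.mul_inv, transpose_one]⟩

lemma trGL_mul (g h : GL (Fin n) ℂ) : trGL (g * h) = trGL h * trGL g :=
  Units.ext (transpose_mul _ _)

/-- The contragredient of a representation, composed with the inverse transpose. -/
def dualTr (ρ : Representation ℂ (GL (Fin n) ℂ) V) : Representation ℂ (GL (Fin n) ℂ) (Module.Dual ℂ V) where
  toFun g := (ρ (trGL g)).dualMap
  map_one' := by
    rw [show trGL (1 : GL (Fin n) ℂ) = 1 from Units.ext transpose_one, map_one]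
    rfl
  map_mul' g h := by
    rw [trGL_mul, map_mul]
    rfl

lemma exists_low_functional [FiniteDimensional ℂ V] [Nontrivial V] (ρ : Representation ℂ (GL (Fin n) ℂ) V) :
    ∃ ψ : V →ₗ[ℂ] ℂ, ψ ≠ 0 ∧ ∀ u : GL (Fin n) ℂ, IsLow (u : Matrix (Fin n) (Fin n) ℂ) → ∀ y, ψ (ρ u y) = ψ y := by
  obtain ⟨ψ, h0, h1⟩ := exists_fixed_vector (dualTr ρ)
  refine ⟨ψ, h0, fixed_of_isLow fun i j h c y => ?_⟩
  have := LinearMap.congr_fun (h1 j i h c) y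
  rw [← this]
  change _ = ψ (ρ _ y)
  congr 3
  refine Units.ext ?_
  change transvection i j c = (transvection j i c)ᵀ
  simp [transvection, transpose_single]

end

section
variable {n : ℕ} {ι : Type} [Fintype ι] [DecidableEq ι]

lemma IsProj.mulVec_ten {P : Matrix (ι → Fin n) (ι → Fin n) ℂ} (hP : IsProj P) (g : GL (Fin n) ℂ)
    (y : (ι → Fin n) → ℂ) : P *ᵥ ten ι n g y = ten ι n g (P *ᵥ y) := by
  rw [ten_apply, ten_apply, mulVec_mulVec, mulVec_mulVec, hP.comm]

lemma IsHW.gspan_irreducible {x : (ι → Fin n) → ℂ} {a : Fin n → ℤ} (hx : IsHW x a)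
    {X : Submodule ℂ ((ι → Fin n) → ℂ)} (hX : IsSubrep (ten ι n) X) (hle : X ≤ gspan x) :
    X = ⊥ ∨ X = gspan x := by
  obtain ⟨P, hP, hr⟩ := exists_isProj X hX
  have hr' : ∀ y, P *ᵥ y ∈ X := fun y => (hr _).1 (by rw [mulVec_mulVec, hP.mul_self])
  obtain ⟨c, hc⟩ := hx.gspan_weight (hle (hr' x))
  have hPx : P *ᵥ x = c • x := by
    funext f
    by_cases hf : ct f = a
    · exact hc f hf
    · have h0 : x f = 0 := not_imp_comm.1 (hx.weight f) hf
      rw [Pi.smul_apply, h0, smul_zero, mulVec, dotProduct]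
      refine Finset.sum_eq_zero fun f' _ => ?_
      by_contra h
      exact hf ((hP.apply_eq_zero (left_ne_zero_of_mul h)).trans (hx.weight f' (right_ne_zero_of_mul h)))
  by_cases h0 : c = 0
  · left
    rw [eq_bot_iff]
    intro y hy
    have : gspan x ≤ LinearMap.ker P.mulVecLin := by
      refine gspan_le (fun g z hz => ?_) ?_
      · rw [LinearMap.mem_ker, mulVecLin_apply] at hz ⊢
        rw [hP.mulVec_ten, hz, map_zero]
      · rw [LinearMap.mem_ker, mulVecLin_apply, hPx, h0, zero_smul]
    rw [Submodule.mem_bot, ← (hr y).2 hy]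
    exact this (hle hy)
  · right
    refine le_antisymm hle (gspan_le hX ?_)
    have := X.smul_mem c⁻¹ (hr' x)
    rwa [hPx, smul_smul, inv_mul_cancel₀ h0, one_smul] at this

open scoped ComplexOrder in
lemma eq_zero_of_star_dotProduct {κ : Type*} [Fintype κ] {x : κ → ℂ} (h : Star.star x ⬝ᵥ x = 0) : x = 0 :=
  dotProduct_star_self_eq_zero.1 h

lemma star_dotProduct_low {x : (ι → Fin n) → ℂ} (hx : ∀ (i j : Fin n) (h : i < j) c, ten ι n (tv i j h.ne c) x = x)
    (u : GL (Fin n) ℂ) (hu : IsLow (u : Matrix (Fin n) (Fin n) ℂ)) (y : (ι → Fin n) → ℂ) :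
    Star.star x ⬝ᵥ ten ι n u y = Star.star x ⬝ᵥ y := by
  refine fixed_of_isLow (ρ := ten ι n) (ψ := dotProductBilin ℂ ℂ (Star.star x)) (fun i j h c y => ?_) u hu y
  have h1 : (tpow ι (transvection i j c))ᴴ = tpow ι (transvection j i (Star.star c)) := by
    rw [← tpow_conjTranspose]
    congr 1
    simp [transvection, conjTranspose_single]
  change Star.star x ⬝ᵥ tpow ι (transvection i j c) *ᵥ y = Star.star x ⬝ᵥ y
  rw [dotProduct_mulVec, ← conjTranspose_conjTranspose (tpow ι (transvection i j c)), ← star_mulVec, h1]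
  congr 2
  exact hx j i h _

variable {V : Type*} [AddCommGroup V] [Module ℂ V]

/-- A representation is embedded in tensors onto `gspan x`. -/
theorem exists_embedding [FiniteDimensional ℂ V] {ρ : Representation ℂ (GL (Fin n) ℂ) V}
    (hirr : IsIrreducibleRep ρ) {a : Fin n → ℤ} {v : V} (hv : IsHWVec ρ a v)
    {x : (ι → Fin n) → ℂ} (hx : IsHW x a) :
    ∃ φ : V →ₗ[ℂ] ((ι → Fin n) → ℂ), Function.Injective φ ∧ (∀ g y, φ (ρ g y) = ten ι n g (φ y)) ∧
      LinearMap.range φ = gspan x := by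
  have := hirr.1
  have hgen : ∀ U : Submodule ℂ V, IsSubrep ρ U → v ∈ U → U = ⊤ := fun U hU hvU =>
    (hirr.2 U hU).resolve_left fun h => hv.ne_zero (by rwa [h, Submodule.mem_bot] at hvU)
  have hspan : Submodule.span ℂ {z | ∃ u : GL (Fin n) ℂ, IsLow (u : Matrix (Fin n) (Fin n) ℂ) ∧ ρ u v = z} = ⊤ := by
    refine hgen _ (span_low_stable ρ hv.fixed fun d => ⟨_, hv.weight d⟩) (Submodule.subset_span ⟨1, ?_, by simp⟩)
    exact ⟨fun i => Matrix.one_apply_eq i, fun i j h => Matrix.one_apply_ne h.ne⟩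
  obtain ⟨ψ, hψ0, hψ⟩ := exists_low_functional ρ
  have hψv : ψ v ≠ 0 := fun h0 => hψ0 (LinearMap.ext fun y => by
    have hy : y ∈ (⊤ : Submodule ℂ V) := trivial
    rw [← hspan] at hy
    refine (Submodule.span_le (p := LinearMap.ker ψ)).2 ?_ hy
    rintro _ ⟨u, hu, rfl⟩
    rw [SetLike.mem_coe, LinearMap.mem_ker, hψ u hu, h0])
  set W := Submodule.span ℂ {z | ∃ u : GL (Fin n) ℂ, IsLow (u : Matrix (Fin n) (Fin n) ℂ) ∧
    (ρ.prod (ten ι n)) u (v, x) = z} with hW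
  have hWs : IsSubrep (ρ.prod (ten ι n)) W := span_low_stable _
    (fun i j h c => Prod.ext (hv.fixed i j h c) (hx.fixed i j h c))
    (fun d => ⟨_, Prod.ext (hv.weight d) (ten_dg_eq hx.weight d)⟩)
  have hvx : (v, x) ∈ W := Submodule.subset_span
    ⟨1, ⟨fun i => Matrix.one_apply_eq i, fun i j h => Matrix.one_apply_ne h.ne⟩, by simp⟩
  have hxx : Star.star x ⬝ᵥ x ≠ 0 := fun h => hx.ne_zero (eq_zero_of_star_dotProduct h)
  have hWψ : ∀ z ∈ W, (Star.star x ⬝ᵥ x) * ψ z.1 = ψ v * (Star.star x ⬝ᵥ z.2) := by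
    intro z hz
    rw [hW] at hz
    induction hz using Submodule.span_induction with
    | mem z hz =>
      obtain ⟨u, hu, rfl⟩ := hz
      change _ * ψ (ρ u v) = _ * (_ ⬝ᵥ ten ι n u x)
      rw [hψ u hu, star_dotProduct_low hx.fixed u hu, mul_comm]
    | zero => simp
    | add y z _ _ hy hz => rw [Prod.fst_add, Prod.snd_add, map_add, dotProduct_add, mul_add, mul_add, hy, hz]
    | smul c y _ hy =>
      rw [Prod.smul_fst, Prod.smul_snd, map_smul, dotProduct_smul, smul_eq_mul, smul_eq_mul,
        mul_left_comm, hy, mul_left_comm]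
  have hWg : ∀ z ∈ W, z.2 ∈ gspan x := by
    intro z hz
    rw [hW] at hz
    refine (Submodule.span_le (p := (gspan x).comap (LinearMap.snd ℂ V _))).2 ?_ hz
    rintro _ ⟨u, hu, rfl⟩
    exact gspan_subrep x u x (mem_gspan x)
  have hK : ∀ t, ((0 : V), t) ∈ W → t = 0 := by
    have hKs : IsSubrep (ten ι n) (W.comap (LinearMap.inr ℂ V _)) := fun g t ht => by
      have := hWs g _ ht
      change (ρ g 0, ten ι n g t) ∈ W at this
      rwa [map_zero] at this
    rcases hx.gspan_irreducible hKs (fun t ht => hWg _ ht) with h | h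
    · intro t ht
      have : t ∈ W.comap (LinearMap.inr ℂ V _) := ht
      rwa [h, Submodule.mem_bot] at this
    · exfalso
      have h1 : x ∈ W.comap (LinearMap.inr ℂ V _) := by
        rw [h]
        exact mem_gspan x
      have := hWψ _ h1
      rw [LinearMap.inr_apply, map_zero, mul_zero] at this
      exact mul_ne_zero hψv hxx this.symm
  have hpr : Function.Bijective ((LinearMap.fst ℂ V _).domRestrict W) := by
    constructor
    · rw [← LinearMap.ker_eq_bot, eq_bot_iff]
      rintro ⟨⟨y, t⟩, hz⟩ h
      rw [LinearMap.mem_ker] at h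
      change y = 0 at h
      subst h
      exact Subtype.ext (Prod.ext rfl (hK t hz))
    · rw [← LinearMap.range_eq_top]
      refine hgen _ ?_ ⟨⟨_, hvx⟩, rfl⟩
      rintro g _ ⟨⟨z, hz⟩, rfl⟩
      exact ⟨⟨_, hWs g z hz⟩, rfl⟩
  set e := LinearEquiv.ofBijective _ hpr with he
  have he1 : ∀ z (hz : z ∈ W), e.symm z.1 = ⟨z, hz⟩ := fun z hz => by
    rw [LinearEquiv.symm_apply_eq]
    rfl
  set φ : V →ₗ[ℂ] ((ι → Fin n) → ℂ) := (LinearMap.snd ℂ V _).domRestrict W ∘ₗ e.symm.toLinearMap with hφ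
  have hφz : ∀ z ∈ W, φ z.1 = z.2 := fun z hz => by
    change ((e.symm z.1 : W) : V × ((ι → Fin n) → ℂ)).2 = _
    rw [he1 z hz]
  have hφW : ∀ y, (y, φ y) ∈ W := fun y => by
    obtain ⟨⟨z, hz⟩, rfl⟩ := hpr.2 y
    change (z.1, φ z.1) ∈ W
    rw [hφz z hz]
    exact hz
  have heq : ∀ g y, φ (ρ g y) = ten ι n g (φ y) := fun g y => hφz _ (hWs g _ (hφW y))
  have hφv : φ v = x := hφz _ hvx
  refine ⟨φ, ?_, heq, le_antisymm ?_ (gspan_le ?_ ⟨v, hφv⟩)⟩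
  · rw [← LinearMap.ker_eq_bot]
    refine (hirr.2 _ fun g y hy => ?_).resolve_right fun h => hx.ne_zero ?_
    · rw [LinearMap.mem_ker] at hy ⊢
      rw [heq, hy, map_zero]
    · rw [← hφv, ← LinearMap.mem_ker, h]
      trivial
  · rintro _ ⟨y, rfl⟩
    exact hWg (y, φ y) (hφW y)
  · rintro g _ ⟨y, rfl⟩
    exact ⟨_, heq g y⟩

end

section
variable {n : ℕ} {ι : Type} [Fintype ι] [DecidableEq ι]

lemma isHW_of_isHWVec {x : (ι → Fin n) → ℂ} {a : Fin n → ℤ} (h : IsHWVec (ten ι n) a x) : IsHW x a :=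
  ⟨h.ne_zero, h.fixed, fun _ hf => weight_support h.weight hf⟩

lemma dg_mul_dg (d e : Fin n → ℂˣ) : dg d * dg e = dg (d * e) :=
  Units.ext (by simp)

lemma dg_mul_tv (d : Fin n → ℂˣ) {i j : Fin n} (h : i ≠ j) (c : ℂ) :
    tv i j h c * dg d = dg d * tv i j h (((d i)⁻¹ : ℂˣ) * c * d j) := by
  refine Units.ext ?_
  ext k l
  simp only [Units.val_mul, coe_tv, coe_dg, transvection, Matrix.mul_diagonal, Matrix.diagonal_mul,
    Matrix.add_apply, Matrix.single_apply, mul_add, add_mul]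
  congr 1
  · rcases eq_or_ne k l with rfl | hkl
    · rw [Matrix.one_apply_eq]; ring
    · rw [Matrix.one_apply_ne hkl]; ring
  · split_ifs with hh
    · obtain ⟨rfl, rfl⟩ := hh
      rw [mul_assoc, Units.mul_inv_cancel_left]
    · ring

lemma exists_isHW {X : Submodule ℂ ((ι → Fin n) → ℂ)} (hX : IsSubrep (ten ι n) X) (h0 : X ≠ ⊥) :
    ∃ x ∈ X, ∃ a, IsHW x a := by
  have := (Submodule.nontrivial_iff_ne_bot).2 h0
  let ρ : Representation ℂ (GL (Fin n) ℂ) X :=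
    { toFun := fun g => (ten ι n g).restrict (hX g)
      map_one' := by
        ext1 y
        exact Subtype.ext (by simp)
      map_mul' := fun g h => by
        ext1 y
        exact Subtype.ext (by simp) }
  obtain ⟨v, hv, hf⟩ := exists_fixed_vector ρ
  let N : Submodule ℂ X := ⨅ (i : Fin n) (j : Fin n) (h : i < j) (c : ℂ), LinearMap.eqLocus (ρ (tv i j h.ne c)) LinearMap.id
  have hN : ∀ y, y ∈ N ↔ ∀ (i j : Fin n) (h : i < j) c, ρ (tv i j h.ne c) y = y := fun y => by
    simp [N, Submodule.mem_iInf]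
  obtain ⟨w, hwN, hw0, hw⟩ := exists_common_eigenvector (fun d => ρ (dg d)) (fun d e y => by
    rw [← Module.End.mul_apply, ← Module.End.mul_apply, ← map_mul, ← map_mul, dg_mul_dg, dg_mul_dg, mul_comm d])
    _ N le_rfl (fun h => hv (by rw [← Submodule.mem_bot ℂ, ← h, hN]; exact hf)) (fun d y hy => by
      rw [hN] at hy ⊢
      intro i j h c
      rw [← Module.End.mul_apply, ← map_mul, dg_mul_tv, map_mul, Module.End.mul_apply, hy i j h])
  have hw0' : (w : (ι → Fin n) → ℂ) ≠ 0 := fun h => hw0 (Subtype.ext h)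
  obtain ⟨f, hf⟩ := Function.ne_iff.1 hw0'
  refine ⟨w, w.2, ct f, isHW_of_isHWVec ⟨hw0', fun i j h c => congrArg Subtype.val ((hN w).1 hwN i j h c), fun d => ?_⟩⟩
  obtain ⟨c, hc⟩ := hw d
  have h1 : ten ι n (dg d) (w : (ι → Fin n) → ℂ) = c • (w : (ι → Fin n) → ℂ) := congrArg Subtype.val hc
  have h2 := congrFun h1 f
  rw [ten_dg, Pi.smul_apply, smul_eq_mul] at h2
  rw [h1, mul_right_cancel₀ hf h2]

lemma IsHW.eq_smul {x y : (ι → Fin n) → ℂ} {a : Fin n → ℤ} (hx : IsHW x a) (hy : y ∈ gspan x)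
    (hya : ∀ f, y f ≠ 0 → ct f = a) : ∃ c : ℂ, y = c • x := by
  obtain ⟨c, hc⟩ := hx.gspan_weight hy
  refine ⟨c, funext fun f => ?_⟩
  by_cases hf : ct f = a
  · exact hc f hf
  · rw [Pi.smul_apply, not_imp_comm.1 (hx.weight f) hf, not_imp_comm.1 (hya f) hf, smul_zero]

lemma IsHW.weight_unique {x y : (ι → Fin n) → ℂ} {a l : Fin n → ℤ} (hx : IsHW x a) (hy : IsHW y l)
    (hyx : y ∈ gspan x) : l = a := by
  have hg : gspan y = gspan x := (hx.gspan_irreducible (gspan_subrep y) (gspan_le (gspan_subrep x) hyx)).resolve_left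
    fun h => hy.ne_zero (by rw [← Submodule.mem_bot ℂ, ← h]; exact mem_gspan y)
  obtain ⟨f, hf⟩ := Function.ne_iff.1 hx.ne_zero
  obtain ⟨f', hf'⟩ := Function.ne_iff.1 hy.ne_zero
  have h1 := hx.gspan_dom hyx hf' strictAnti_rho
  have h2 := hy.gspan_dom (hg ▸ mem_gspan x) hf strictAnti_rho
  rw [hy.weight f' hf'] at h1
  rw [hx.weight f hf] at h2
  exact h1.2 h2.1

variable {V : Type*} [AddCommGroup V] [Module ℂ V]

/-- Equivariant maps to tensors with values in `X`. -/
def homTo (ρ : Representation ℂ (GL (Fin n) ℂ) V) (X : Submodule ℂ ((ι → Fin n) → ℂ)) :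
    Submodule ℂ (V →ₗ[ℂ] ((ι → Fin n) → ℂ)) :=
  equivariantMaps ρ (ten ι n) ⊓ Submodule.compatibleMaps ⊤ X

lemma mem_homTo {ρ : Representation ℂ (GL (Fin n) ℂ) V} {X : Submodule ℂ ((ι → Fin n) → ℂ)}
    {f : V →ₗ[ℂ] ((ι → Fin n) → ℂ)} :
    f ∈ homTo ρ X ↔ (∀ g y, f (ρ g y) = ten ι n g (f y)) ∧ ∀ y, f y ∈ X := by
  rw [homTo, Submodule.mem_inf]
  refine and_congr ⟨fun h g y => LinearMap.congr_fun (h g) y, fun h g => LinearMap.ext (h g)⟩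
    ⟨fun h y => h (x := y) trivial, fun h y _ => h y⟩

lemma IsHWVec.map {ρ : Representation ℂ (GL (Fin n) ℂ) V} {l : Fin n → ℤ} {v : V} (hv : IsHWVec ρ l v)
    {f : V →ₗ[ℂ] ((ι → Fin n) → ℂ)} (hf : ∀ g y, f (ρ g y) = ten ι n g (f y)) (h0 : f v ≠ 0) : IsHW (f v) l :=
  isHW_of_isHWVec ⟨h0, fun i j h c => by rw [← hf, hv.fixed i j h], fun d => by rw [← hf, hv.weight, map_smul]⟩

lemma eq_zero_of_apply_hw {ρ : Representation ℂ (GL (Fin n) ℂ) V} (hirr : IsIrreducibleRep ρ) {l : Fin n → ℤ}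
    {v : V} (hv : IsHWVec ρ l v) {f : V →ₗ[ℂ] ((ι → Fin n) → ℂ)} (hf : ∀ g y, f (ρ g y) = ten ι n g (f y))
    (h0 : f v = 0) : f = 0 := by
  rw [← LinearMap.ker_eq_top]
  refine (hirr.2 _ fun g y hy => ?_).resolve_left fun h => hv.ne_zero ?_
  · rw [LinearMap.mem_ker] at hy ⊢
    rw [hf, hy, map_zero]
  · rwa [← Submodule.mem_bot ℂ, ← h, LinearMap.mem_ker]

/-- Schur's lemma for `gspan x`. -/
lemma finrank_homTo_gspan [FiniteDimensional ℂ V] {ρ : Representation ℂ (GL (Fin n) ℂ) V}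
    (hirr : IsIrreducibleRep ρ) {l : Fin n → ℤ} {v : V} (hv : IsHWVec ρ l v) {x : (ι → Fin n) → ℂ}
    {a : Fin n → ℤ} (hx : IsHW x a) : Module.finrank ℂ (homTo ρ (gspan x)) = if a = l then 1 else 0 := by
  split_ifs with h
  · subst h
    obtain ⟨φ, hi, he, hr⟩ := exists_embedding hirr hv hx
    have hφ : φ v ≠ 0 := fun h0 => hv.ne_zero (hi (h0.trans (map_zero φ).symm))
    have hmem : ∀ y, φ y ∈ gspan x := fun y => hr ▸ LinearMap.mem_range_self φ y
    have hs : homTo ρ (gspan x) = Submodule.span ℂ {φ} := by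
      refine le_antisymm (fun f hf => ?_) ?_
      · obtain ⟨hf1, hf2⟩ := mem_homTo.1 hf
        rw [Submodule.mem_span_singleton]
        obtain ⟨c, hc⟩ := hx.eq_smul (hmem v) (hv.map he hφ).weight
        have hc0 : c ≠ 0 := fun h => hφ (by rw [hc, h, zero_smul])
        obtain ⟨e, hee⟩ : ∃ e : ℂ, f v = e • x := by
          by_cases h0 : f v = 0
          · exact ⟨0, by rw [h0, zero_smul]⟩
          · exact hx.eq_smul (hf2 v) (hv.map hf1 h0).weight
        refine ⟨e / c, (sub_eq_zero.1 (eq_zero_of_apply_hw hirr hv (f := f - (e / c) • φ) (fun g y => ?_) ?_)).symm⟩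
        · simp only [LinearMap.sub_apply, LinearMap.smul_apply, hf1, he, map_sub, map_smul]
        · rw [LinearMap.sub_apply, LinearMap.smul_apply, hee, hc, smul_smul, div_mul_cancel₀ e hc0, sub_self]
      · rw [Submodule.span_singleton_le_iff_mem]
        exact mem_homTo.2 ⟨he, hmem⟩
    rw [hs, finrank_span_singleton fun h0 => hφ (by rw [h0]; rfl)]
  · have : homTo ρ (gspan x) = ⊥ := by
      rw [eq_bot_iff]
      intro f hf
      obtain ⟨hf1, hf2⟩ := mem_homTo.1 hf
      refine eq_zero_of_apply_hw hirr hv hf1 ?_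
      by_contra h0
      exact h (hx.weight_unique (hv.map hf1 h0) (hf2 v)).symm
    rw [this, finrank_bot]

lemma trc_zero : trc (0 : Matrix (ι → Fin n) (ι → Fin n) ℂ) = 0 := by
  rw [← zero_smul ℂ (0 : Matrix (ι → Fin n) (ι → Fin n) ℂ), trc_smul, zero_smul]

/-- Multiplicities in a subrepresentation of tensors are determined by its character. -/
theorem finrank_homTo [FiniteDimensional ℂ V] {ρ : Representation ℂ (GL (Fin n) ℂ) V}
    (hirr : IsIrreducibleRep ρ) {l : Fin n → ℤ} (hl : Antitone l) {v : V} (hv : IsHWVec ρ l v) :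
    ∀ (m : ℕ) (X : Submodule ℂ ((ι → Fin n) → ℂ)) (P : Matrix (ι → Fin n) (ι → Fin n) ℂ), IsProj P →
      (∀ y, P *ᵥ y = y ↔ y ∈ X) → Module.finrank ℂ X ≤ m →
      (toC (alt (rho n)) * trc P).coeff (l + rho n) = Module.finrank ℂ (homTo ρ X) := by
  intro m
  induction m using Nat.strong_induction_on with
  | _ m ih =>
    intro X P hP hr hm
    have hPX : ∀ y, P *ᵥ y ∈ X := fun y => (hr _).1 (by rw [mulVec_mulVec, hP.mul_self])
    have hX : IsSubrep (ten ι n) X := fun g y hy => by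
      rw [← hr] at hy ⊢
      rw [hP.mulVec_ten, hy]
    by_cases h0 : X = ⊥
    · have hP0 : P = 0 := Matrix.ext_of_mulVec_single fun f => by
        have := hPX (Pi.single f 1)
        rw [h0, Submodule.mem_bot] at this
        rw [this, zero_mulVec]
      have hh : homTo ρ X = ⊥ := by
        rw [eq_bot_iff]
        intro f hf
        rw [Submodule.mem_bot]
        ext1 y
        have := (mem_homTo.1 hf).2 y
        rwa [h0, Submodule.mem_bot] at this
      rw [hP0, trc_zero, mul_zero, hh, finrank_bot]
      simp
    · obtain ⟨x, hxX, a, hx⟩ := exists_isHW hX h0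
      have hle : gspan x ≤ X := gspan_le hX hxX
      obtain ⟨Q, hQ, hQr⟩ := exists_isProj (gspan x) (gspan_subrep x)
      have hQX : ∀ y, Q *ᵥ y ∈ gspan x := fun y => (hQr _).1 (by rw [mulVec_mulVec, hQ.mul_self])
      have hPQ : P * Q = Q := Matrix.ext_of_mulVec_single fun f => by
        rw [← mulVec_mulVec, (hr _).2 (hle (hQX _))]
      have hQP : Q * P = Q := by
        have := congrArg conjTranspose hPQ
        rwa [conjTranspose_mul, hQ.herm, hP.herm] at this
      have hS : IsProj (P - Q) := ⟨by
          rw [sub_mul, mul_sub, mul_sub, hP.mul_self, hPQ, hQP, hQ.mul_self, sub_self, sub_zero], by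
          rw [conjTranspose_sub, hP.herm, hQ.herm], fun g => by rw [sub_mul, mul_sub, hP.comm, hQ.comm]⟩
      set Z := LinearMap.eqLocus (P - Q).mulVecLin LinearMap.id with hZ
      have hSr : ∀ y, (P - Q) *ᵥ y = y ↔ y ∈ Z := fun y => Iff.rfl
      have hZX : Z ≤ X := fun y hy => by
        rw [← hSr] at hy
        rw [← hr, ← hy, mulVec_mulVec, mul_sub, hP.mul_self, hPQ]
      have hQZ : ∀ y ∈ Z, Q *ᵥ y = 0 := fun y hy => by
        rw [← hSr] at hy
        rw [← hy, mulVec_mulVec, mul_sub, hQP, hQ.mul_self, sub_self, zero_mulVec]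
      have hxZ : x ∉ Z := fun h => hx.ne_zero (by rw [← hQZ x h, (hQr x).2 (mem_gspan x)])
      have hlt : Module.finrank ℂ Z < Module.finrank ℂ X :=
        Submodule.finrank_lt_finrank_of_lt (lt_of_le_of_ne hZX fun h => hxZ (h ▸ hxX))
      have h1 := ih _ (lt_of_lt_of_le hlt hm) Z (P - Q) hS hSr le_rfl
      have hsup : homTo ρ (gspan x) ⊔ homTo ρ Z = homTo ρ X := by
        refine le_antisymm (sup_le (fun f hf => ?_) fun f hf => ?_) fun f hf => ?_
        · exact mem_homTo.2 ⟨(mem_homTo.1 hf).1, fun y => hle ((mem_homTo.1 hf).2 y)⟩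
        · exact mem_homTo.2 ⟨(mem_homTo.1 hf).1, fun y => hZX ((mem_homTo.1 hf).2 y)⟩
        · obtain ⟨hf1, hf2⟩ := mem_homTo.1 hf
          rw [Submodule.mem_sup]
          refine ⟨Q.mulVecLin ∘ₗ f, mem_homTo.2 ⟨fun g y => ?_, fun y => hQX _⟩,
            (P - Q).mulVecLin ∘ₗ f, mem_homTo.2 ⟨fun g y => ?_, fun y => ?_⟩, ?_⟩
          · rw [LinearMap.comp_apply, hf1]
            exact hQ.mulVec_ten _ _
          · rw [LinearMap.comp_apply, hf1]
            exact hS.mulVec_ten _ _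
          · rw [← hSr]
            change (P - Q) *ᵥ ((P - Q) *ᵥ f y) = _
            rw [mulVec_mulVec, hS.mul_self]
            rfl
          · ext1 y
            change Q *ᵥ f y + (P - Q) *ᵥ f y = f y
            rw [sub_mulVec, add_sub_cancel, (hr _).2 (hf2 y)]
      have hinf : homTo ρ (gspan x) ⊓ homTo ρ Z = ⊥ := by
        rw [eq_bot_iff]
        rintro f ⟨hf, hf'⟩
        rw [Submodule.mem_bot]
        ext1 y
        rw [← (hQr _).2 ((mem_homTo.1 hf).2 y), hQZ _ ((mem_homTo.1 hf').2 y)]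
        rfl
      have hadd := Submodule.finrank_sup_add_finrank_inf_eq (homTo ρ (gspan x)) (homTo ρ Z)
      rw [hsup, hinf, finrank_bot, add_zero, finrank_homTo_gspan hirr hv hx] at hadd
      rw [hadd, ← sub_add_cancel P Q, trc_add, mul_add, AddMonoidAlgebra.coeff_add, Finsupp.add_apply, h1,
        hx.alt_mul_trc hQ hQX ((hQr x).2 (mem_gspan x)), coeff_toC,
        coeff_alt (strictAnti_add_rho hx.antitone) (strictAnti_add_rho hl)]
      simp only [add_left_inj]
      split_ifs <;> push_cast <;> ring

end

section
variable {n : ℕ} {ι κ : Type} [Fintype ι] [DecidableEq ι] [Fintype κ] [DecidableEq κ]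

/-- The product of two tensors. -/
def box : ((ι → Fin n) → ℂ) →ₗ[ℂ] ((κ → Fin n) → ℂ) →ₗ[ℂ] ((ι ⊕ κ → Fin n) → ℂ) :=
  LinearMap.mk₂ ℂ (fun y z f => y (f ∘ Sum.inl) * z (f ∘ Sum.inr))
    (fun _ _ _ => funext fun _ => add_mul _ _ _) (fun _ _ _ => funext fun _ => mul_assoc _ _ _)
    (fun _ _ _ => funext fun _ => mul_add _ _ _) (fun _ _ _ => funext fun _ => mul_left_comm _ _ _)

omit [Fintype ι] [DecidableEq ι] [Fintype κ] [DecidableEq κ] in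
lemma box_apply (y : (ι → Fin n) → ℂ) (z : (κ → Fin n) → ℂ) (f : ι ⊕ κ → Fin n) :
    box y z f = y (f ∘ Sum.inl) * z (f ∘ Sum.inr) := rfl

/-- The Kronecker product, on the space of tensors. -/
def kr (P : Matrix (ι → Fin n) (ι → Fin n) ℂ) (Q : Matrix (κ → Fin n) (κ → Fin n) ℂ) :
    Matrix (ι ⊕ κ → Fin n) (ι ⊕ κ → Fin n) ℂ :=
  (kroneckerMap (· * ·) P Q).submatrix (Equiv.sumArrowEquivProdArrow ι κ (Fin n))
    (Equiv.sumArrowEquivProdArrow ι κ (Fin n))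

omit [Fintype ι] [DecidableEq ι] [Fintype κ] [DecidableEq κ] in
lemma kr_apply (P : Matrix (ι → Fin n) (ι → Fin n) ℂ) (Q : Matrix (κ → Fin n) (κ → Fin n) ℂ)
    (f f' : ι ⊕ κ → Fin n) :
    kr P Q f f' = P (f ∘ Sum.inl) (f' ∘ Sum.inl) * Q (f ∘ Sum.inr) (f' ∘ Sum.inr) := rfl

lemma kr_mul (P P' : Matrix (ι → Fin n) (ι → Fin n) ℂ) (Q Q' : Matrix (κ → Fin n) (κ → Fin n) ℂ) :
    kr P Q * kr P' Q' = kr (P * P') (Q * Q') := by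
  rw [kr, kr, kr, submatrix_mul_equiv, mul_kronecker_mul]

lemma kr_mulVec (P : Matrix (ι → Fin n) (ι → Fin n) ℂ) (Q : Matrix (κ → Fin n) (κ → Fin n) ℂ)
    (y : (ι → Fin n) → ℂ) (z : (κ → Fin n) → ℂ) : kr P Q *ᵥ box y z = box (P *ᵥ y) (Q *ᵥ z) := by
  funext f
  rw [box_apply, mulVec, mulVec, mulVec, dotProduct, dotProduct, dotProduct, Finset.sum_mul_sum,
    ← Fintype.sum_prod_type']
  refine Fintype.sum_equiv (Equiv.sumArrowEquivProdArrow ι κ (Fin n)) _ _ fun f' => ?_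
  rw [kr_apply, box_apply, mul_mul_mul_comm]
  rfl

omit [DecidableEq ι] [DecidableEq κ] in
lemma tpow_sum (A : Matrix (Fin n) (Fin n) ℂ) : tpow (ι ⊕ κ) A = kr (tpow ι A) (tpow κ A) := by
  ext f f'
  rw [kr_apply]
  exact Fintype.prod_sum_type _

lemma ten_box (g : GL (Fin n) ℂ) (y : (ι → Fin n) → ℂ) (z : (κ → Fin n) → ℂ) :
    ten (ι ⊕ κ) n g (box y z) = box (ten ι n g y) (ten κ n g z) := by
  rw [ten_apply, tpow_sum, kr_mulVec]
  rfl

lemma IsProj.kr {P : Matrix (ι → Fin n) (ι → Fin n) ℂ} {Q : Matrix (κ → Fin n) (κ → Fin n) ℂ}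
    (hP : IsProj P) (hQ : IsProj Q) : IsProj (kr P Q) := by
  refine ⟨by rw [kr_mul, hP.mul_self, hQ.mul_self], ?_, fun g => by rw [tpow_sum, kr_mul, kr_mul, hP.comm, hQ.comm]⟩
  conv_rhs => rw [← hP.herm, ← hQ.herm]
  ext f f'
  simp only [conjTranspose_apply, kr_apply, star_mul']

omit [DecidableEq ι] [DecidableEq κ] in
lemma ct_sum (f : ι ⊕ κ → Fin n) : ct f = ct (f ∘ Sum.inl) + ct (f ∘ Sum.inr) := by
  funext i
  simp only [ct, Pi.add_apply, Finset.card_filter, Fintype.sum_sum_type, Function.comp]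
  push_cast
  rfl

lemma trc_kr (P : Matrix (ι → Fin n) (ι → Fin n) ℂ) (Q : Matrix (κ → Fin n) (κ → Fin n) ℂ) :
    trc (kr P Q) = trc P * trc Q := by
  rw [trc, trc, trc, Finset.sum_mul_sum, ← Fintype.sum_prod_type']
  refine Fintype.sum_equiv (Equiv.sumArrowEquivProdArrow ι κ (Fin n)) _ _ fun f => ?_
  rw [ct_sum, kr_apply, AddMonoidAlgebra.single_mul_single]
  rfl

omit [DecidableEq ι] [DecidableEq κ] in
lemma box_single (f : ι ⊕ κ → Fin n) :
    box (Pi.single (f ∘ Sum.inl) 1) (Pi.single (f ∘ Sum.inr) 1) = Pi.single f (1 : ℂ) := by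
  funext f'
  rw [box_apply, Pi.single_apply, Pi.single_apply, Pi.single_apply]
  by_cases h : f' = f
  · simp [h]
  · rw [if_neg h]
    by_cases h1 : f' ∘ Sum.inl = f ∘ Sum.inl
    · rw [if_neg (c := f' ∘ Sum.inr = f ∘ Sum.inr), mul_zero]
      exact fun h2 => h (funext fun b => by
        rcases b with b | b
        · exact congrFun h1 b
        · exact congrFun h2 b)
    · rw [if_neg h1, zero_mul]

omit [DecidableEq ι] [DecidableEq κ] in
lemma lift_box_injective : Function.Injective (TensorProduct.lift (box (n := n) (ι := ι) (κ := κ))) := by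
  have : TensorProduct.lift (box (n := n) (ι := ι) (κ := κ)) =
      (((Pi.basisFun ℂ (ι → Fin n)).tensorProduct (Pi.basisFun ℂ (κ → Fin n))).equiv
        (Pi.basisFun ℂ (ι ⊕ κ → Fin n)) (Equiv.sumArrowEquivProdArrow ι κ (Fin n)).symm).toLinearMap := by
    refine Module.Basis.ext ((Pi.basisFun ℂ (ι → Fin n)).tensorProduct (Pi.basisFun ℂ (κ → Fin n))) fun b => ?_
    rw [LinearEquiv.coe_coe, Module.Basis.equiv_apply, Module.Basis.tensorProduct_apply, TensorProduct.lift.tmul,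
      Pi.basisFun_apply, Pi.basisFun_apply, Pi.basisFun_apply, ← box_single]
    rfl
  rw [this]
  exact LinearEquiv.injective _

variable {Vl Vm Vn : Type*} [AddCommGroup Vl] [Module ℂ Vl]
    [AddCommGroup Vm] [Module ℂ Vm] [AddCommGroup Vn] [Module ℂ Vn]

lemma finrank_comp_of_injective {ρ : Representation ℂ (GL (Fin n) ℂ) Vl} {σ : Representation ℂ (GL (Fin n) ℂ) Vm}
    {Φ : Vm →ₗ[ℂ] ((ι → Fin n) → ℂ)} (hi : Function.Injective Φ) (he : ∀ g y, Φ (σ g y) = ten ι n g (Φ y)) :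
    Module.finrank ℂ (equivariantMaps ρ σ) = Module.finrank ℂ (homTo ρ (LinearMap.range Φ)) := by
  have hc : Function.Injective (LinearMap.compRight ℂ (M := Vl) Φ) := fun f f' h =>
    LinearMap.ext fun y => hi (LinearMap.congr_fun h y)
  rw [(Submodule.equivMapOfInjective _ hc (equivariantMaps ρ σ)).finrank_eq]
  suffices (equivariantMaps ρ σ).map (LinearMap.compRight ℂ (M := Vl) Φ) = homTo ρ (LinearMap.range Φ) by rw [this]
  ext f
  rw [Submodule.mem_map, mem_homTo]
  constructor
  · rintro ⟨f, hf, rfl⟩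
    refine ⟨fun g y => ?_, fun y => ⟨_, rfl⟩⟩
    change Φ (f (ρ g y)) = ten ι n g (Φ (f y))
    rw [← he]
    exact congrArg Φ (LinearMap.congr_fun (hf g) y)
  · rintro ⟨hf1, hf2⟩
    set e := LinearEquiv.ofInjective Φ hi
    have hΦe : ∀ z, Φ (e.symm z) = z := fun z => congrArg Subtype.val (e.apply_symm_apply z)
    refine ⟨e.symm.toLinearMap ∘ₗ f.codRestrict _ hf2, fun g => LinearMap.ext fun y => hi ?_, LinearMap.ext fun y => ?_⟩
    · change Φ (e.symm _) = Φ (σ g (e.symm _))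
      rw [he, hΦe, hΦe]
      exact hf1 g y
    · exact hΦe _

/-- The multiplicity in a tensor product of two irreducibles embedded in tensor powers. -/
theorem finrank_tensor [FiniteDimensional ℂ Vl] [FiniteDimensional ℂ Vm] [FiniteDimensional ℂ Vn]
    {ρl : Representation ℂ (GL (Fin n) ℂ) Vl} {ρm : Representation ℂ (GL (Fin n) ℂ) Vm}
    {ρn : Representation ℂ (GL (Fin n) ℂ) Vn}
    (hl : IsIrreducibleRep ρl) (hm : IsIrreducibleRep ρm) (hn : IsIrreducibleRep ρn) {l a b : Fin n → ℤ}
    (hla : Antitone l) {v : Vl} {w : Vm} {u : Vn} (hv : IsHWVec ρl l v) (hw : IsHWVec ρm a w) (hu : IsHWVec ρn b u)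
    {x : (ι → Fin n) → ℂ} {y : (κ → Fin n) → ℂ} (hx : IsHW x a) (hy : IsHW y b) :
    (Module.finrank ℂ (equivariantMaps ρl (ρm.tprod ρn)) : ℤ) = mult (chi b) a l := by
  obtain ⟨φ, hφi, hφe, hφr⟩ := exists_embedding hm hw hx
  obtain ⟨χ, hχi, hχe, hχr⟩ := exists_embedding hn hu hy
  obtain ⟨P, hP, hPr⟩ := exists_isProj (gspan x) (gspan_subrep x)
  obtain ⟨Q, hQ, hQr⟩ := exists_isProj (gspan y) (gspan_subrep y)
  have hPX : ∀ z, P *ᵥ z ∈ gspan x := fun z => (hPr _).1 (by rw [mulVec_mulVec, hP.mul_self])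
  have hQX : ∀ z, Q *ᵥ z ∈ gspan y := fun z => (hQr _).1 (by rw [mulVec_mulVec, hQ.mul_self])
  set Φ := TensorProduct.lift (box (n := n) (ι := ι) (κ := κ)) ∘ₗ TensorProduct.map φ χ with hΦ
  have hΦi : Function.Injective Φ :=
    lift_box_injective.comp (TensorProduct.map_injective_of_flat_flat _ _ hφi hχi)
  have hΦt : ∀ y z, Φ (y ⊗ₜ z) = box (φ y) (χ z) := fun y z => rfl
  have hΦe : ∀ g z, Φ ((ρm.tprod ρn) g z) = ten (ι ⊕ κ) n g (Φ z) := fun g z => by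
    induction z using TensorProduct.induction_on with
    | zero => simp
    | tmul y z =>
      rw [hΦt, ten_box, ← hφe, ← hχe]
      rfl
    | add y z hy hz => rw [map_add, map_add, map_add, map_add, hy, hz]
  have hr : ∀ z, kr P Q *ᵥ z = z ↔ z ∈ LinearMap.range Φ := fun z => by
    constructor
    · intro hz
      rw [← hz]
      have h1 : z ∈ Submodule.span ℂ (Set.range fun f : ι ⊕ κ → Fin n => (Pi.single f (1 : ℂ) : (ι ⊕ κ → Fin n) → ℂ)) := by
        have := (Pi.basisFun ℂ (ι ⊕ κ → Fin n)).span_eq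
        have h2 : (⇑(Pi.basisFun ℂ (ι ⊕ κ → Fin n))) = fun f => Pi.single f (1 : ℂ) := funext fun f => by simp
        rw [h2] at this
        rw [this]
        trivial
      refine (Submodule.span_le (p := (LinearMap.range Φ).comap (kr P Q).mulVecLin)).2 ?_ h1
      rintro _ ⟨f, rfl⟩
      change kr P Q *ᵥ (Pi.single f 1) ∈ LinearMap.range Φ
      rw [← box_single, kr_mulVec]
      have h3 := hPX (Pi.single (f ∘ Sum.inl) 1)
      have h4 := hQX (Pi.single (f ∘ Sum.inr) 1)
      rw [← hφr] at h3
      rw [← hχr] at h4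
      obtain ⟨s, hs⟩ := h3
      obtain ⟨t, ht⟩ := h4
      exact ⟨s ⊗ₜ t, by rw [hΦt, hs, ht]⟩
    · rintro ⟨s, rfl⟩
      induction s using TensorProduct.induction_on with
      | zero => simp
      | tmul s t =>
        rw [hΦt, kr_mulVec, (hPr _).2 (hφr ▸ LinearMap.mem_range_self φ s),
          (hQr _).2 (hχr ▸ LinearMap.mem_range_self χ t)]
      | add s t hs ht => rw [map_add, mulVec_add, hs, ht]
  have h := finrank_homTo hl hla hv _ _ _ (hP.kr hQ) hr le_rfl
  rw [← finrank_comp_of_injective hΦi hΦe, trc_kr, ← mul_assoc, hx.alt_mul_trc hP hPX ((hPr x).2 (mem_gspan x)),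
    hy.trc_eq hQ hQr, ← map_mul, coeff_toC] at h
  exact_mod_cast h.symm

end

section
variable {n : ℕ}

lemma IsHW.box {ι κ : Type} [Fintype ι] [DecidableEq ι] [Fintype κ] [DecidableEq κ]
    {x : (ι → Fin n) → ℂ} {y : (κ → Fin n) → ℂ} {a b : Fin n → ℤ} (hx : IsHW x a) (hy : IsHW y b) :
    IsHW (box x y) (a + b) := by
  refine ⟨fun h => ?_, fun i j h c => by rw [ten_box, hx.fixed i j h, hy.fixed i j h], fun f hf => ?_⟩
  · obtain ⟨f, hf⟩ := Function.ne_iff.1 hx.ne_zero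
    obtain ⟨f', hf'⟩ := Function.ne_iff.1 hy.ne_zero
    exact mul_ne_zero hf hf' (congrFun h (Sum.elim f f'))
  · rw [box_apply] at hf
    rw [ct_sum, hx.weight _ (left_ne_zero_of_mul hf), hy.weight _ (right_ne_zero_of_mul hf)]

/-- The vector `e_0 ∧ ⋯ ∧ e_(k-1)`. -/
def wedge {k : ℕ} (hk : k ≤ n) (f : Fin k → Fin n) : ℂ :=
  det (Matrix.of fun m b : Fin k => if f b = Fin.castLE hk m then (1 : ℂ) else 0)

lemma ten_wedge {k : ℕ} (hk : k ≤ n) (g : GL (Fin n) ℂ) (f : Fin k → Fin n) :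
    ten (Fin k) n g (wedge hk) f = det (Matrix.of fun m b : Fin k => (g : Matrix (Fin n) (Fin n) ℂ) (f b) (Fin.castLE hk m)) := by
  rw [ten_apply, mulVec, dotProduct]
  simp only [wedge, det_apply', Finset.mul_sum]
  rw [Finset.sum_comm]
  refine Finset.sum_congr rfl fun σ _ => ?_
  rw [Finset.sum_eq_single fun b => Fin.castLE hk (σ b)]
  · simp [tpow, mul_comm]
  · intro f' _ hf'
    obtain ⟨b, hb⟩ := Function.ne_iff.1 hf'
    rw [Finset.prod_eq_zero (Finset.mem_univ b), mul_zero, mul_zero]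
    rw [Matrix.of_apply, if_neg hb]
  · simp

lemma isHW_wedge {k : ℕ} (hk : k ≤ n) : IsHW (wedge hk) fun i => if (i : ℕ) < k then 1 else 0 := by
  refine ⟨fun h => ?_, fun i j h c => funext fun f => ?_, fun f hf => ?_⟩
  · have := congrFun h (Fin.castLE hk)
    have h1 : (Matrix.of fun m b : Fin k => if Fin.castLE hk b = Fin.castLE hk m then (1 : ℂ) else 0) = 1 := by
      ext m b
      rw [Matrix.of_apply, Matrix.one_apply]
      exact if_congr ⟨fun h => (Fin.castLE_injective hk h).symm, fun h => by rw [h]⟩ rfl rfl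
    rw [wedge, h1, det_one] at this
    exact one_ne_zero this
  · have hu : ∀ a b : Fin n, b < a → (transvection i j c) a b = 0 := fun a b hab => by
      simp only [transvection, Matrix.add_apply, Matrix.one_apply_ne hab.ne', Matrix.single_apply]
      rw [if_neg (by rintro ⟨rfl, rfl⟩; exact absurd h hab.not_gt), add_zero]
    have hd : ∀ a : Fin n, (transvection i j c) a a = 1 := fun a => by
      simp only [transvection, Matrix.add_apply, Matrix.one_apply_eq, Matrix.single_apply]
      rw [if_neg (by rintro ⟨rfl, rfl⟩; exact h.false), add_zero]
    have h1 : ∀ A : Matrix (Fin n) (Fin n) ℂ, (∀ a b : Fin n, b < a → A a b = 0) →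
        (Matrix.of fun m b : Fin k => A (f b) (Fin.castLE hk m)) =
        (Matrix.of fun m b : Fin k => A (Fin.castLE hk b) (Fin.castLE hk m)) *
        (Matrix.of fun m b : Fin k => if f b = Fin.castLE hk m then (1 : ℂ) else 0) := by
      intro A hu
      ext m b
      rw [Matrix.mul_apply]
      simp only [Matrix.of_apply, mul_ite, mul_one, mul_zero]
      by_cases hb : (f b : ℕ) < k
      · rw [Finset.sum_eq_single ⟨f b, hb⟩]
        · exact (if_pos (Fin.ext rfl)).symm
        · exact fun q _ hq => if_neg (show ¬ f b = Fin.castLE hk q from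
            fun he => hq (Fin.ext (congrArg Fin.val he).symm))
        · simp
      · rw [hu _ _ (Fin.lt_def.2 (lt_of_lt_of_le m.2 (not_lt.1 hb)))]
        refine (Finset.sum_eq_zero fun q _ => if_neg fun he => hb ?_).symm
        rw [he]
        exact q.2
    rw [ten_wedge, coe_tv, h1 _ hu, det_mul, det_of_isLowerTriangular, Finset.prod_eq_one, one_mul]
    · rfl
    · exact fun b _ => hd _
    · exact fun a b hab => hu _ _ hab
  · rw [wedge, det_apply'] at hf
    obtain ⟨σ, -, hσ⟩ := Finset.exists_ne_zero_of_sum_ne_zero hf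
    have h1 : ∀ b, f b = Fin.castLE hk (σ b) := fun b => by
      by_contra h0
      exact Finset.prod_ne_zero_iff.1 (right_ne_zero_of_mul hσ) b (Finset.mem_univ b)
        (by rw [Matrix.of_apply, if_neg h0])
    funext i
    rw [ct]
    split_ifs with hi
    · rw [Finset.card_eq_one.2 ⟨σ.symm ⟨i, hi⟩, ?_⟩, Nat.cast_one]
      ext b
      rw [Finset.mem_filter_univ, Finset.mem_singleton, h1, Equiv.eq_symm_apply, Fin.ext_iff, Fin.ext_iff]
      rfl
    · rw [Finset.card_eq_zero.2, Nat.cast_zero]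
      rw [Finset.filter_eq_empty_iff]
      intro b _ hb
      rw [h1] at hb
      exact hi (hb ▸ (σ b).2)

/-- Every polynomial dominant weight is the weight of a highest weight vector in tensors. -/
theorem exists_isHW_of_antitone (a : Fin n → ℕ) (ha : Antitone a) :
    ∃ (ι : Type) (_ : Fintype ι) (_ : DecidableEq ι) (x : (ι → Fin n) → ℂ), IsHW x fun i => (a i : ℤ) := by
  have key : ∀ (N : ℕ) (a : Fin n → ℕ), Antitone a → ∑ i, a i = N →
      ∃ (ι : Type) (_ : Fintype ι) (_ : DecidableEq ι) (x : (ι → Fin n) → ℂ), IsHW x fun i => (a i : ℤ) := by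
    intro N
    induction N using Nat.strong_induction_on with
    | _ N ih =>
      intro a ha hN
      by_cases h0 : ∀ i, a i = 0
      · refine ⟨Fin 0, inferInstance, inferInstance, wedge (Nat.zero_le n), ?_⟩
        convert isHW_wedge (Nat.zero_le n) using 2 with i
        simp [h0 i]
      · push Not at h0
        obtain ⟨i₀, hi₀⟩ := h0
        set k := (Finset.univ.filter fun i => a i ≠ 0).card with hkdef
        have hk : k ≤ n := (Finset.card_le_univ _).trans (by simp)
        have hlt : ∀ i : Fin n, (i : ℕ) < k ↔ a i ≠ 0 := by
          intro i
          constructor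
          · intro hi h
            have : (Finset.univ.filter fun i => a i ≠ 0) ⊆ Finset.Iio i := fun j hj => by
              rw [Finset.mem_filter_univ] at hj
              rw [Finset.mem_Iio]
              by_contra hle
              exact hj (Nat.eq_zero_of_le_zero (h ▸ ha (not_lt.1 hle)))
            have := Finset.card_le_card this
            rw [Fin.card_Iio] at this
            omega
          · intro h
            have : Finset.Iic i ⊆ (Finset.univ.filter fun i => a i ≠ 0) := fun j hj => by
              rw [Finset.mem_filter_univ]
              have := ha (Finset.mem_Iic.1 hj)
              omega
            have := Finset.card_le_card this
            rw [Fin.card_Iic] at this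
            omega
        have hsub : Antitone fun i => a i - 1 := fun i j h => Nat.sub_le_sub_right (ha h) 1
        have hsum : ∑ i, (a i - 1) < N := by
          rw [← hN]
          exact Finset.sum_lt_sum (fun i _ => Nat.sub_le _ _) ⟨i₀, Finset.mem_univ _, by omega⟩
        obtain ⟨ι, hι, hd, x, hx⟩ := ih _ hsum _ hsub rfl
        refine ⟨ι ⊕ Fin k, inferInstance, inferInstance, box x (wedge hk), ?_⟩
        convert hx.box (isHW_wedge hk) using 1
        funext i
        rw [Pi.add_apply]
        by_cases h : a i = 0
        · rw [if_neg (by rw [hlt]; exact not_not.2 h), h]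
          simp
        · rw [if_pos ((hlt i).2 h)]
          omega
  exact key _ a ha rfl

end

section
variable {n : ℕ}

lemma chi_add (w : Wt n) (C : ℤ) : chi (w.1 + fun _ => C) = mon (fun _ => C) * chi w.1 := by
  have h := (chi_spec (⟨w.1 + fun _ => C, fun _ _ h => add_le_add_left (w.2 h) _⟩ : Wt n)).1
  refine mul_left_cancel₀ alt_rho_ne_zero (h.trans ?_)
  rw [mul_left_comm, (chi_spec w).1, mul_comm, alt_mul_mon, add_right_comm]

lemma mult_add_add (F : Lau n) (m l : Fin n → ℤ) (C : ℤ) :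
    mult F (m + fun _ => C) (l + fun _ => C) = mult F m l := by
  rw [mult, mult, add_right_comm, ← alt_mul_mon, mul_right_comm, mul_comm, coeff_mon_mul,
    add_right_comm, add_sub_cancel_right]

variable {V W U : Type*} [AddCommGroup V] [Module ℂ V] [AddCommGroup W] [Module ℂ W]
  [AddCommGroup U] [Module ℂ U]

/-- The tensor product of a representation with the `C`-th power of the determinant. -/
def twist (C : ℕ) (ρ : Representation ℂ (GL (Fin n) ℂ) V) : Representation ℂ (GL (Fin n) ℂ) V where
  toFun g := det (g : Matrix (Fin n) (Fin n) ℂ) ^ C • ρ g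
  map_one' := by simp
  map_mul' g h := by
    rw [map_mul, Units.val_mul, det_mul, mul_pow, smul_mul_smul_comm]

lemma twist_apply (C : ℕ) (ρ : Representation ℂ (GL (Fin n) ℂ) V) (g : GL (Fin n) ℂ) (v : V) :
    twist C ρ g v = det (g : Matrix (Fin n) (Fin n) ℂ) ^ C • ρ g v := rfl

lemma det_pow_ne_zero (C : ℕ) (g : GL (Fin n) ℂ) : det (g : Matrix (Fin n) (Fin n) ℂ) ^ C ≠ 0 :=
  pow_ne_zero _ (GeneralLinearGroup.det g).ne_zero

lemma isIrreducibleRep_twist {ρ : Representation ℂ (GL (Fin n) ℂ) V} (h : IsIrreducibleRep ρ) (C : ℕ) :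
    IsIrreducibleRep (twist C ρ) :=
  ⟨h.1, fun X hX => h.2 X fun g x hx => (X.smul_mem_iff (det_pow_ne_zero C g)).1 (hX g x hx)⟩

lemma IsHWVec.twist {ρ : Representation ℂ (GL (Fin n) ℂ) V} {a : Fin n → ℤ} {v : V} (h : IsHWVec ρ a v)
    (C : ℕ) : IsHWVec (twist C ρ) (a + fun _ => (C : ℤ)) v where
  ne_zero := h.ne_zero
  fixed i j hij c := by
    rw [twist_apply, h.fixed i j hij, coe_tv, det_transvection_of_ne _ _ hij.ne, one_pow, one_smul]
  weight d := by
    rw [twist_apply, h.weight, coe_dg, det_diagonal, smul_smul, ← Finset.prod_pow,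
      ← Finset.prod_mul_distrib]
    congr 1
    refine Finset.prod_congr rfl fun i _ => ?_
    rw [Pi.add_apply, zpow_add₀ (d i).ne_zero, zpow_natCast, mul_comm]

lemma equivariantMaps_twist (C D : ℕ) (π : Representation ℂ (GL (Fin n) ℂ) V)
    (ρ : Representation ℂ (GL (Fin n) ℂ) W) (σ : Representation ℂ (GL (Fin n) ℂ) U) :
    equivariantMaps (twist (C + D) π) ((twist C ρ).tprod (twist D σ)) = equivariantMaps π (ρ.tprod σ) := by
  ext f
  refine forall_congr' fun g => ?_
  have h : (twist C ρ).tprod (twist D σ) g =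
      det (g : Matrix (Fin n) (Fin n) ℂ) ^ (C + D) • ρ.tprod σ g := by
    refine TensorProduct.ext' fun x y => ?_
    rw [LinearMap.smul_apply, Representation.tprod_apply, Representation.tprod_apply,
      TensorProduct.map_tmul, TensorProduct.map_tmul, twist_apply, twist_apply,
      TensorProduct.smul_tmul_smul, pow_add]
  have h' : twist (C + D) π g = det (g : Matrix (Fin n) (Fin n) ℂ) ^ (C + D) • π g := rfl
  rw [h, h', LinearMap.comp_smul, LinearMap.smul_comp]
  exact smul_right_inj (det_pow_ne_zero (C + D) g)

/-- The multiplicity of an irreducible representation in a tensor product. -/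
theorem finrank_equivariantMaps_tprod [FiniteDimensional ℂ V] [FiniteDimensional ℂ W]
    [FiniteDimensional ℂ U] {π : Representation ℂ (GL (Fin n) ℂ) V}
    {ρ : Representation ℂ (GL (Fin n) ℂ) W} {σ : Representation ℂ (GL (Fin n) ℂ) U}
    (hπ : IsIrreducibleRep π) (hρ : IsIrreducibleRep ρ) (hσ : IsIrreducibleRep σ) (l a b : Wt n)
    {v : V} {w : W} {u : U} (hv : IsHWVec π l.1 v) (hw : IsHWVec ρ a.1 w) (hu : IsHWVec σ b.1 u) :
    (Module.finrank ℂ (equivariantMaps π (ρ.tprod σ)) : ℤ) = mult (chi b.1) a.1 l.1 := by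
  obtain ⟨C, a', -, ha⟩ := exists_shift a
  obtain ⟨D, b', -, hb⟩ := exists_shift b
  obtain ⟨ι, _, _, x, hx⟩ := exists_isHW_of_antitone (fun i : Fin n => a'.1 i) fun i j h => a'.anti h
  obtain ⟨κ, _, _, y, hy⟩ := exists_isHW_of_antitone (fun i : Fin n => b'.1 i) fun i j h => b'.anti h
  rw [show (fun i : Fin n => (a'.1 i : ℤ)) = a.1 + fun _ => (C : ℤ) from ha] at hx
  rw [show (fun i : Fin n => (b'.1 i : ℤ)) = b.1 + fun _ => (D : ℤ) from hb] at hy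
  rw [← equivariantMaps_twist C D, finrank_tensor (isIrreducibleRep_twist hπ _)
    (isIrreducibleRep_twist hρ _) (isIrreducibleRep_twist hσ _)
    (fun _ _ h => add_le_add_left (l.2 h) _) (hv.twist _) (hw.twist _) (hu.twist _) hx hy, chi_add,
    mult_mon_mul, add_assoc]
  have : ((fun _ => (C : ℤ)) + fun _ => (D : ℤ) : Fin n → ℤ) = fun _ => ((C + D : ℕ) : ℤ) :=
    funext fun _ => (Nat.cast_add C D).symm
  rw [this]
  exact mult_add_add _ _ _ _

end

lemma cast_finsum {ι : Type*} {f : ι → ℕ} {g : ι → ENNReal} (h : ∑' i, g i ≠ ⊤)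
    (hfg : ∀ i, g i ≠ ⊤ → (f i : ENNReal) = g i) : ((∑ᶠ i, f i : ℕ) : ENNReal) = ∑' i, g i := by
  have hg : ∀ i, (f i : ENNReal) = g i := fun i => hfg i (ENNReal.ne_top_of_tsum_ne_top h i)
  have hfin : f.support.Finite := by
    refine (ENNReal.finite_const_le_of_tsum_ne_top h one_ne_zero).subset fun i hi => ?_
    rw [Set.mem_ofPred_eq, ← hg]
    exact_mod_cast Nat.one_le_iff_ne_zero.2 hi
  rw [finsum_eq_sum _ hfin, Nat.cast_sum, tsum_eq_sum]
  · exact Finset.sum_congr rfl fun i _ => hg i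
  · intro i hi
    rw [← hg, Nat.cast_eq_zero]
    simpa using hi

lemma cast_finsum_R (lp lm mp mm np nm : Ptn) (h : R lp lm mp mm np nm ≠ ⊤) :
    ((∑ᶠ (a1 : Ptn) (a2 : Ptn) (b1 : Ptn) (b2 : Ptn) (c1 : Ptn) (c2 : Ptn),
      lrCoeff lp.1 a2.1 a1.1 * lrCoeff mp.1 a1.1 c1.1 * lrCoeff nm.1 c1.1 b2.1 *
      lrCoeff lm.1 b2.1 b1.1 * lrCoeff mm.1 b1.1 c2.1 * lrCoeff np.1 c2.1 a2.1 : ℕ) : ENNReal) =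
    R lp lm mp mm np nm :=
  cast_finsum h fun _ h => cast_finsum h fun _ h => cast_finsum h fun _ h => cast_finsum h fun _ h =>
    cast_finsum h fun _ h => cast_finsum h fun _ _ => by simp only [c, Nat.cast_mul]

theorem repMult_tprod {n p q r s : ℕ} (hn : p + q + r + s ≤ n) (lp lm mp mm np nm : Ptn)
    (hlp : Supp (p + r) lp) (hlm : Supp (q + s) lm) (hmp : Supp p mp) (hmm : Supp q mm)
    (hnp : Supp r np) (hnm : Supp s nm)
    {Vl Vm Vn : Type*} [AddCommGroup Vl] [Module ℂ Vl]
    [AddCommGroup Vm] [Module ℂ Vm] [AddCommGroup Vn] [Module ℂ Vn]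
    {ρl : Representation ℂ (GL (Fin n) ℂ) Vl} {ρm : Representation ℂ (GL (Fin n) ℂ) Vm}
    {ρn : Representation ℂ (GL (Fin n) ℂ) Vn} (hl : IsGLHW n (rat n lp lm) ρl)
    (hm : IsGLHW n (rat n mp mm) ρm) (hn' : IsGLHW n (rat n np nm) ρn) :
    (repMult (ρm.tprod ρn) ρl : ENNReal) = R lp lm mp mm np nm := by
  have := hl.2.1
  have := hm.2.1
  have := hn'.2.1
  obtain ⟨v, hv⟩ := isHWVec_of_isGLHW hl
  obtain ⟨w, hw⟩ := isHWVec_of_isGLHW hm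
  obtain ⟨u, hu⟩ := isHWVec_of_isGLHW hn'
  have h := finrank_equivariantMaps_tprod hl.1 hm.1 hn'.1
    (ratW n lp lm) (ratW n mp mm) (ratW n np nm) hv hw hu
  rw [← E_chi_rat hn hlp hlm hmp hmm hnp hnm, E, repMult]
  exact congrArg Nat.cast (Int.toNat_natCast _ ▸ congrArg Int.toNat h)

end StableGL

/-- Stable tensor product rule for `GL_n`, i.e. the diagonal
`GL_n ⊂ GL_n × GL_n`.  For `n ≥ p+q+r+s` and partitions `lp, lm, mp, mm, np', nm'`
with `ℓ(lp) ≤ p+r`, `ℓ(lm) ≤ q+s`, `ℓ(mp) ≤ p`, `ℓ(mm) ≤ q`, `ℓ(np') ≤ r`,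
`ℓ(nm') ≤ s`, the multiplicity of `F^{(lp,lm)}_(n)` in
`F^{(mp,mm)}_(n) ⊗ F^{(np',nm')}_(n)` is
`∑ c^{lp}_{α₂ α₁} c^{mp}_{α₁ γ₁} c^{nm'}_{γ₁ β₂} c^{lm}_{β₂ β₁} c^{mm}_{β₁ γ₂}
   c^{np'}_{γ₂ α₂}`,
the sum over all sextuples of partitions `(α₁, α₂, β₁, β₂, γ₁, γ₂)`. -/
theorem stable_tensor_product_rule_GL
    (n p q r s : ℕ) (hn : p + q + r + s ≤ n)
    (lp lm mp mm np' nm' : ℕ → ℕ)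
    (hlp : IsPartition lp) (hlm : IsPartition lm) (hmp : IsPartition mp)
    (hmm : IsPartition mm) (hnp : IsPartition np') (hnm : IsPartition nm')
    (hlp' : plen lp ≤ p + r) (hlm' : plen lm ≤ q + s)
    (hmp' : plen mp ≤ p) (hmm' : plen mm ≤ q)
    (hnp' : plen np' ≤ r) (hnm' : plen nm' ≤ s)
    {Vl Vm Vn : Type*} [AddCommGroup Vl] [Module ℂ Vl]
    [AddCommGroup Vm] [Module ℂ Vm] [AddCommGroup Vn] [Module ℂ Vn]
    (ρl : Representation ℂ (GL (Fin n) ℂ) Vl)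
    (ρm : Representation ℂ (GL (Fin n) ℂ) Vm)
    (ρn : Representation ℂ (GL (Fin n) ℂ) Vn)
    (hρl : IsGLHW n (ratWeight n lp lm) ρl)
    (hρm : IsGLHW n (ratWeight n mp mm) ρm)
    (hρn : IsGLHW n (ratWeight n np' nm') ρn) :
    repMult (ρm.tprod ρn) ρl
      = ∑ᶠ (a1 : Ptn) (a2 : Ptn) (b1 : Ptn) (b2 : Ptn) (c1 : Ptn) (c2 : Ptn),
          lrCoeff lp a2.1 a1.1 * lrCoeff mp a1.1 c1.1 * lrCoeff nm' c1.1 b2.1 *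
          lrCoeff lm b2.1 b1.1 * lrCoeff mm b1.1 c2.1 * lrCoeff np' c2.1 a2.1 := by
  have h := StableGL.repMult_tprod hn ⟨lp, hlp⟩ ⟨lm, hlm⟩ ⟨mp, hmp⟩ ⟨mm, hmm⟩ ⟨np', hnp⟩ ⟨nm', hnm⟩
    ((StableGL.supp_plen _).mono hlp') ((StableGL.supp_plen _).mono hlm')
    ((StableGL.supp_plen _).mono hmp') ((StableGL.supp_plen _).mono hmm')
    ((StableGL.supp_plen _).mono hnp') ((StableGL.supp_plen _).mono hnm') hρl hρm hρn
  exact Nat.cast_injective (R := ENNReal) (h.trans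
    (StableGL.cast_finsum_R _ _ _ _ _ _ (h ▸ ENNReal.natCast_ne_top _)).symm)

end
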